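/- Let N ≥ 2, x⁰ ∈ ℝ^N, R > 0, and let h₁, h₂ : ℝ^N → ℝ be nonnegative continuous functions that are Lipschitz on B(x⁰,R) and subharmonic in the distributional sense on B(x⁰,R) (∫ h_i·Δφ dx ≥ 0 for every nonnegative smooth φ compactly supported in B(x⁰,R), i = 1,2). Assume h₁·h₂ ≡ 0 on B(x⁰,R) and h₁(x⁰) = h₂(x⁰) = 0. Then the function φ(r) = r^{−4}·(∫_{B(x⁰,r)} |∇h₁(x)|²·|x−x⁰|^{2−N} dx)·(∫_{B(x⁰,r)} |∇h₂(x)|²·|x−x⁰|^{2−N} dx) is monotone nondecreasing on (0,R), where the gradients (which exist almost everywhere by Rademacher's theorem) are taken in the almost-everywhere sense. -/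

import Mathlib

open MeasureTheory Metric Set Filter
open scoped RealInnerProductSpace

noncomputable section

/-- The Laplacian of `φ` at `x`, as the sum of the pure second derivatives. -/
def lap (N : ℕ) (φ : EuclideanSpace ℝ (Fin N) → ℝ) (x : EuclideanSpace ℝ (Fin N)) : ℝ :=
  ∑ i : Fin N,
    fderiv ℝ (fun y => fderiv ℝ φ y (EuclideanSpace.single i 1)) x (EuclideanSpace.single i 1)

/-- Membership in the class `P_r(z, M)`. -/
def MemP (N : ℕ) (r : ℝ) (z : EuclideanSpace ℝ (Fin N)) (M : ℝ)
    (Ω : Set (EuclideanSpace ℝ (Fin N))) (u : EuclideanSpace ℝ (Fin N) → ℝ) : Prop :=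
  IsOpen Ω ∧ ContDiff ℝ 1 u ∧
    (∀ φ : EuclideanSpace ℝ (Fin N) → ℝ, ContDiff ℝ (⊤ : ℕ∞) φ → tsupport φ ⊆ ball z r →
      ∫ x, u x * lap N φ x = ∫ x in Ω, φ x) ∧
    (∀ x ∈ ball z r \ Ω, u x = 0 ∧ gradient u x = 0) ∧
    (∀ x ∈ ball z r, |u x| ≤ M) ∧
    z ∈ frontier Ω

/-- Membership in the class `P_∞(0, M)` of global solutions with quadratic growth. -/
def MemPinf (N : ℕ) (M : ℝ) (Ω : Set (EuclideanSpace ℝ (Fin N)))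
    (u : EuclideanSpace ℝ (Fin N) → ℝ) : Prop :=
  IsOpen Ω ∧ ContDiff ℝ 1 u ∧
    (∀ φ : EuclideanSpace ℝ (Fin N) → ℝ, ContDiff ℝ (⊤ : ℕ∞) φ → HasCompactSupport φ →
      ∫ x, u x * lap N φ x = ∫ x in Ω, φ x) ∧
    (∀ x ∈ Ωᶜ, u x = 0 ∧ gradient u x = 0) ∧
    (0 : EuclideanSpace ℝ (Fin N)) ∈ frontier Ω ∧
    (∀ x, |u x| ≤ M * (‖x‖ ^ 2 + 1))

/-- The minimum diameter of a set: the smallest width of a slab containing it. -/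
def MD (N : ℕ) (D : Set (EuclideanSpace ℝ (Fin N))) : ℝ :=
  ⨅ e : {e : EuclideanSpace ℝ (Fin N) // ‖e‖ = 1},
    ((⨆ x : D, ⟪(x : EuclideanSpace ℝ (Fin N)), (e : EuclideanSpace ℝ (Fin N))⟫) -
      ⨅ x : D, ⟪(x : EuclideanSpace ℝ (Fin N)), (e : EuclideanSpace ℝ (Fin N))⟫)

/-- The density function `δ_r(u)`. -/
def deltaFn (N : ℕ) (u : EuclideanSpace ℝ (Fin N) → ℝ) (r : ℝ) : ℝ :=
  MD N ({x | u x = 0 ∧ gradient u x = 0} ∩ ball 0 r) / r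

/-- Half-space solutions `x ↦ (max(⟪x,e⟫,0))²/2`. -/
def IsHalfSpaceSol (N : ℕ) (u : EuclideanSpace ℝ (Fin N) → ℝ) : Prop :=
  ∃ e : EuclideanSpace ℝ (Fin N), ‖e‖ = 1 ∧ ∀ x, u x = (max ⟪x, e⟫ 0) ^ 2 / 2

/-- `∂Ω ∩ B` is the graph of a `C¹` function. -/
def IsC1Graph (N : ℕ) (Ω B : Set (EuclideanSpace ℝ (Fin N))) : Prop :=
  ∃ (e : EuclideanSpace ℝ (Fin N)) (f : EuclideanSpace ℝ (Fin N) → ℝ),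
    ‖e‖ = 1 ∧ ContDiff ℝ 1 f ∧
    Ω ∩ B = {x ∈ B | f (x - ⟪x, e⟫ • e) < ⟪x, e⟫} ∧
    frontier Ω ∩ B = {x ∈ B | ⟪x, e⟫ = f (x - ⟪x, e⟫ • e)}

/-- `∂Ω ∩ B` is the graph of a real-analytic function. -/
def IsAnalyticGraph (N : ℕ) (Ω B : Set (EuclideanSpace ℝ (Fin N))) : Prop :=
  ∃ (e : EuclideanSpace ℝ (Fin N)) (f : EuclideanSpace ℝ (Fin N) → ℝ),
    ‖e‖ = 1 ∧ (∀ x, AnalyticAt ℝ f x) ∧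
    Ω ∩ B = {x ∈ B | f (x - ⟪x, e⟫ • e) < ⟪x, e⟫} ∧
    frontier Ω ∩ B = {x ∈ B | ⟪x, e⟫ = f (x - ⟪x, e⟫ • e)}

/-- The Alt–Caffarelli–Friedman functional `φ(r, v)` centered at the origin. -/
def acf (N : ℕ) (v : EuclideanSpace ℝ (Fin N) → ℝ) (r : ℝ) : ℝ :=
  r ^ (-4 : ℤ) *
    (∫ x in ball (0 : EuclideanSpace ℝ (Fin N)) r,
      ‖gradient (fun y => max (v y) 0) x‖ ^ 2 * ‖x‖ ^ ((2 : ℤ) - (N : ℤ))) *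
    ∫ x in ball (0 : EuclideanSpace ℝ (Fin N)) r,
      ‖gradient (fun y => max (-v y) 0) x‖ ^ 2 * ‖x‖ ^ ((2 : ℤ) - (N : ℤ))

/-- `S_j(z, u) = sup_{B(z, 2^{-j})} |u|`. -/
def Sj (N : ℕ) (z : EuclideanSpace ℝ (Fin N)) (u : EuclideanSpace ℝ (Fin N) → ℝ) (j : ℕ) : ℝ :=
  sSup ((fun x => |u x|) '' ball z ((2 : ℝ) ^ (-(j : ℤ))))

open scoped Topology ENNReal NNReal

section PrekopaLeindler

lemma Real.volume_add_le_two_mul_of_midpoint_mem_of_isCompact {K L C : Set ℝ}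
    (hK : IsCompact K) (hL : IsCompact L) (hK0 : K.Nonempty) (hL0 : L.Nonempty)
    (h : ∀ x ∈ K, ∀ y ∈ L, (x + y) / 2 ∈ C) :
    volume K + volume L ≤ 2 * volume C := by
  obtain ⟨k, hkK, hk⟩ := hK.exists_isGreatest hK0
  obtain ⟨l, hlL, hl⟩ := hL.exists_isLeast hL0
  have hvol : ∀ (s : Set ℝ) (c : ℝ), 2 * volume ((2 * ·) ⁻¹' ((· - c) ⁻¹' s)) = volume s := by
    intro s c
    rw [Real.volume_preimage_mul_left two_ne_zero]
    have : volume ((fun x => x - c) ⁻¹' s) = volume s := by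
      simp [sub_eq_add_neg]
    rw [this, ← mul_assoc, show (2 : ℝ≥0∞) = ENNReal.ofReal 2 by simp,
      ← ENNReal.ofReal_mul (by norm_num)]
    norm_num
  set C₁ : Set ℝ := (2 * ·) ⁻¹' ((· - l) ⁻¹' K)
  set C₂ : Set ℝ := (2 * ·) ⁻¹' ((· - k) ⁻¹' L)
  have hC₂ : MeasurableSet C₂ :=
    (hL.measurableSet.preimage (by fun_prop)).preimage (by fun_prop)
  have hsub : C₁ ∪ C₂ ⊆ C := by
    rintro t (ht | ht)
    · have := h _ ht l hlL
      simpa using this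
    · have := h k hkK _ ht
      simpa using this
  have hdisj : AEDisjoint volume C₁ C₂ := by
    refine measure_mono_null (t := {(k + l) / 2}) ?_ (measure_singleton _)
    rintro t ⟨h₁, h₂⟩
    have h₁' : 2 * t - l ≤ k := hk h₁
    have h₂' : l ≤ 2 * t - k := hl h₂
    simp only [mem_singleton_iff]
    linarith
  calc volume K + volume L = 2 * (volume C₁ + volume C₂) := by
        rw [mul_add, hvol, hvol]
    _ = 2 * volume (C₁ ∪ C₂) := by
        rw [measure_union₀ hC₂.nullMeasurableSet hdisj]
    _ ≤ 2 * volume C := by gcongr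

/-- One-dimensional Brunn–Minkowski inequality, for midpoints. -/
lemma Real.volume_add_le_two_mul_of_midpoint_mem {A B C : Set ℝ}
    (hA : MeasurableSet A) (hB : MeasurableSet B) (hA0 : A.Nonempty) (hB0 : B.Nonempty)
    (h : ∀ x ∈ A, ∀ y ∈ B, (x + y) / 2 ∈ C) :
    volume A + volume B ≤ 2 * volume C := by
  have key : ∀ K ⊆ A, IsCompact K → ∀ L ⊆ B, IsCompact L →
      volume K + volume L ≤ 2 * volume C := by
    intro K hKA hK L hLB hL
    obtain ⟨a, ha⟩ := hA0
    obtain ⟨b, hb⟩ := hB0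
    calc volume K + volume L ≤ volume (insert a K) + volume (insert b L) := by
          gcongr <;> exact subset_insert _ _
      _ ≤ _ := by
          refine volume_add_le_two_mul_of_midpoint_mem_of_isCompact (hK.insert a) (hL.insert b)
            (insert_nonempty _ _) (insert_nonempty _ _) fun x hx y hy => h x ?_ y ?_
          · exact (insert_subset ha hKA) hx
          · exact (insert_subset hb hLB) hy
  rw [hA.measure_eq_iSup_isCompact, hB.measure_eq_iSup_isCompact]
  have hand : ∀ S : Set ℝ, (⨆ (K : Set ℝ) (_ : K ⊆ S) (_ : IsCompact K), volume K) =
      ⨆ (K : Set ℝ) (_ : K ⊆ S ∧ IsCompact K), volume K := fun S => by simp_rw [iSup_and]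
  rw [hand, hand]
  exact ENNReal.biSup_add_biSup_le' (p := fun K => K ⊆ A ∧ IsCompact K)
    (q := fun L => L ⊆ B ∧ IsCompact L) ⟨∅, empty_subset _, isCompact_empty⟩
    ⟨∅, empty_subset _, isCompact_empty⟩ fun K hK L hL => key K hK.1 hK.2 L hL.1 hL.2

lemma lintegral_add_le_of_mul_le_midpoint_sq {f g h : ℝ → ℝ} (hf : Measurable f)
    (hg : Measurable g) (hh : Measurable h) (hf0 : ∀ x, 0 ≤ f x) (hg0 : ∀ x, 0 ≤ g x)
    (hh0 : ∀ x, 0 ≤ h x) (hf1 : ∀ x, f x ≤ 1) (hg1 : ∀ x, g x ≤ 1)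
    (hf2 : ∀ s < 1, ∃ x, s < f x) (hg2 : ∀ s < 1, ∃ x, s < g x)
    (H : ∀ x y, f x * g y ≤ h ((x + y) / 2) ^ 2) :
    (∫⁻ x, ENNReal.ofReal (f x)) + ∫⁻ x, ENNReal.ofReal (g x) ≤
      2 * ∫⁻ x, ENNReal.ofReal (h x) := by
  rw [lintegral_eq_lintegral_meas_lt _ (ae_of_all _ hf0) hf.aemeasurable,
    lintegral_eq_lintegral_meas_lt _ (ae_of_all _ hg0) hg.aemeasurable,
    lintegral_eq_lintegral_meas_lt _ (ae_of_all _ hh0) hh.aemeasurable,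
    ← lintegral_const_mul' _ _ (by simp), ← lintegral_add_left]
  · refine setLIntegral_mono' measurableSet_Ioi fun t ht => ?_
    rcases lt_or_ge t 1 with ht1 | ht1
    · refine Real.volume_add_le_two_mul_of_midpoint_mem (measurableSet_lt measurable_const hf)
        (measurableSet_lt measurable_const hg) (hf2 t ht1) (hg2 t ht1) fun x hx y hy => ?_
      simp only [mem_ofPred_eq] at hx hy ⊢
      have ht0 : (0 : ℝ) < t := ht
      refine lt_of_pow_lt_pow_left₀ 2 (hh0 _) (lt_of_lt_of_le ?_ (H x y))
      nlinarith
    · have h₁ : {a | t < f a} = ∅ := by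
        ext a; simpa using (hf1 a).trans ht1
      have h₂ : {a | t < g a} = ∅ := by
        ext a; simpa using (hg1 a).trans ht1
      simp [h₁, h₂]
  · exact Antitone.measurable fun s t hst => measure_mono fun x hx => lt_of_le_of_lt hst hx

lemma ENNReal.mul_le_sq_of_add_le_two_mul {p q r : ℝ≥0∞} (h : p + q ≤ 2 * r) :
    p * q ≤ r ^ 2 := by
  rcases eq_or_ne r ∞ with rfl | hr
  · simp
  have hpq : p + q ≠ ∞ := ne_top_of_le_ne_top (by finiteness) h
  lift r to ℝ≥0 using hr
  lift p to ℝ≥0 using (ENNReal.add_ne_top.1 hpq).1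
  lift q to ℝ≥0 using (ENNReal.add_ne_top.1 hpq).2
  norm_cast at h ⊢
  rw [← NNReal.coe_le_coe] at h ⊢
  push_cast at h ⊢
  nlinarith [sq_nonneg ((p : ℝ) - q), p.2, q.2]

lemma lintegral_mul_lintegral_le_sq_of_bounded {f g h : ℝ → ℝ≥0∞} (hf : Measurable f)
    (hg : Measurable g) (hh : Measurable h) {M : ℝ≥0∞} (hM : M ≠ ∞) (hfM : ∀ x, f x ≤ M)
    (hgM : ∀ x, g x ≤ M) (H : ∀ x y, f x * g y ≤ h ((x + y) / 2) ^ 2) :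
    (∫⁻ x, f x) * ∫⁻ x, g x ≤ (∫⁻ x, h x) ^ 2 := by
  set a := ⨆ x, f x with ha
  set b := ⨆ x, g x with hb
  have ha' : a ≠ ∞ := ne_top_of_le_ne_top hM (iSup_le hfM)
  have hb' : b ≠ ∞ := ne_top_of_le_ne_top hM (iSup_le hgM)
  have hfa : ∀ x, f x ≤ a := le_iSup f
  have hgb : ∀ x, g x ≤ b := le_iSup g
  rcases eq_or_ne a 0 with ha0 | ha0
  · have : ∀ x, f x = 0 := fun x => le_antisymm (ha0 ▸ hfa x) bot_le
    simp [this]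
  rcases eq_or_ne b 0 with hb0 | hb0
  · have : ∀ x, g x = 0 := fun x => le_antisymm (hb0 ▸ hgb x) bot_le
    simp [this]
  have hap : 0 < a.toReal := ENNReal.toReal_pos ha0 ha'
  have hbp : 0 < b.toReal := ENNReal.toReal_pos hb0 hb'
  set c := √(a.toReal * b.toReal) with hc
  have hcp : 0 < c := Real.sqrt_pos.2 (mul_pos hap hbp)
  have hc2 : c ^ 2 = a.toReal * b.toReal := Real.sq_sqrt (mul_pos hap hbp).le
  have hfin : ∀ x, f x ≠ ∞ := fun x => ne_top_of_le_ne_top ha' (hfa x)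
  have hgin : ∀ x, g x ≠ ∞ := fun x => ne_top_of_le_ne_top hb' (hgb x)
  have hfr : ∀ x, (f x).toReal ≤ a.toReal := fun x => ENNReal.toReal_mono ha' (hfa x)
  have hgr : ∀ x, (g x).toReal ≤ b.toReal := fun x => ENNReal.toReal_mono hb' (hgb x)
  have key := lintegral_add_le_of_mul_le_midpoint_sq
    (f := fun x => (f x).toReal / a.toReal) (g := fun x => (g x).toReal / b.toReal)
    (h := fun x => (min (h x) (ENNReal.ofReal c)).toReal / c)
    (hf.ennreal_toReal.div_const _) (hg.ennreal_toReal.div_const _)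
    ((hh.min measurable_const).ennreal_toReal.div_const _)
    (fun x => by positivity) (fun x => by positivity) (fun x => by positivity)
    (fun x => (div_le_one hap).2 (hfr x)) (fun x => (div_le_one hbp).2 (hgr x)) ?_ ?_ ?_
  · set p := ∫⁻ x, ENNReal.ofReal ((f x).toReal / a.toReal)
    set q := ∫⁻ x, ENNReal.ofReal ((g x).toReal / b.toReal)
    set r := ∫⁻ x, ENNReal.ofReal ((min (h x) (ENNReal.ofReal c)).toReal / c)
    have hp : ∫⁻ x, f x = a * p := by
      rw [← lintegral_const_mul' _ _ ha']
      refine lintegral_congr fun x => ?_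
      rw [ENNReal.ofReal_div_of_pos hap, ENNReal.ofReal_toReal ha', ENNReal.ofReal_toReal (hfin x),
        ENNReal.mul_div_cancel ha0 ha']
    have hq : ∫⁻ x, g x = b * q := by
      rw [← lintegral_const_mul' _ _ hb']
      refine lintegral_congr fun x => ?_
      rw [ENNReal.ofReal_div_of_pos hbp, ENNReal.ofReal_toReal hb', ENNReal.ofReal_toReal (hgin x),
        ENNReal.mul_div_cancel hb0 hb']
    have hr : ENNReal.ofReal c * r ≤ ∫⁻ x, h x := by
      rw [← lintegral_const_mul' _ _ (by simp)]
      refine lintegral_mono fun x => ?_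
      rw [ENNReal.ofReal_div_of_pos hcp, ENNReal.ofReal_toReal (by simp),
        ENNReal.mul_div_cancel (by simpa using hcp) (by simp)]
      exact min_le_left _ _
    calc (∫⁻ x, f x) * ∫⁻ x, g x = (a * b) * (p * q) := by rw [hp, hq]; ring
      _ = ENNReal.ofReal c ^ 2 * (p * q) := by
          rw [← ENNReal.ofReal_pow hcp.le, hc2, ENNReal.ofReal_mul hap.le,
            ENNReal.ofReal_toReal ha', ENNReal.ofReal_toReal hb']
      _ ≤ ENNReal.ofReal c ^ 2 * r ^ 2 := by
          gcongr; exact ENNReal.mul_le_sq_of_add_le_two_mul key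
      _ = (ENNReal.ofReal c * r) ^ 2 := by ring
      _ ≤ _ := by gcongr
  · intro s hs
    by_contra! hcon
    have : a ≤ ENNReal.ofReal (s * a.toReal) := iSup_le fun x => by
      rw [← ENNReal.ofReal_toReal (hfin x)]
      exact ENNReal.ofReal_le_ofReal ((div_le_iff₀ hap).1 (hcon x))
    have hs0 : 0 ≤ s := le_trans (by positivity) (hcon 0)
    have := ENNReal.toReal_mono (by simp) this
    rw [ENNReal.toReal_ofReal (by positivity)] at this
    nlinarith
  · intro s hs
    by_contra! hcon
    have : b ≤ ENNReal.ofReal (s * b.toReal) := iSup_le fun x => by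
      rw [← ENNReal.ofReal_toReal (hgin x)]
      exact ENNReal.ofReal_le_ofReal ((div_le_iff₀ hbp).1 (hcon x))
    have hs0 : 0 ≤ s := le_trans (by positivity) (hcon 0)
    have := ENNReal.toReal_mono (by simp) this
    rw [ENNReal.toReal_ofReal (by positivity)] at this
    nlinarith
  · intro x y
    rw [div_mul_div_comm, div_pow, ← hc2]
    gcongr
    rcases le_total (h ((x + y) / 2)) (ENNReal.ofReal c) with hle | hle
    · rw [min_eq_left hle, ← ENNReal.toReal_mul, ← ENNReal.toReal_pow]
      refine ENNReal.toReal_mono ?_ (H x y)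
      exact ENNReal.pow_ne_top (ne_top_of_le_ne_top (by simp) hle)
    · rw [min_eq_right hle, ENNReal.toReal_ofReal hcp.le, hc2]
      gcongr
      exacts [hfa x, hgb y]

/-- One-dimensional Prékopa–Leindler inequality, for midpoints. -/
lemma lintegral_mul_lintegral_le_sq_real {f g h : ℝ → ℝ≥0∞} (hf : Measurable f)
    (hg : Measurable g) (hh : Measurable h) (H : ∀ x y, f x * g y ≤ h ((x + y) / 2) ^ 2) :
    (∫⁻ x, f x) * ∫⁻ x, g x ≤ (∫⁻ x, h x) ^ 2 := by
  have hsup : ∀ f : ℝ → ℝ≥0∞, Measurable f → ∫⁻ x, f x = ⨆ n : ℕ, ∫⁻ x, min (f x) n := by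
    intro f hf
    rw [← lintegral_iSup (fun n => hf.min measurable_const)
      (fun m n hmn x => min_le_min_left _ (by exact_mod_cast hmn))]
    refine lintegral_congr fun x => ?_
    rw [← inf_iSup_eq, ENNReal.iSup_natCast, inf_top_eq]
  rw [hsup f hf, hsup g hg, ENNReal.iSup_mul]
  refine iSup_le fun m => ?_
  rw [ENNReal.mul_iSup]
  refine iSup_le fun n => ?_
  refine lintegral_mul_lintegral_le_sq_of_bounded (M := max m n) (hf.min measurable_const)
    (hg.min measurable_const) hh (by simp) (fun x => ?_) (fun x => ?_) (fun x y => ?_)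
  · exact (min_le_right _ _).trans (le_max_left _ _)
  · exact (min_le_right _ _).trans (le_max_right _ _)
  · exact (mul_le_mul' (min_le_left _ _) (min_le_left _ _)).trans (H x y)

lemma lintegral_mul_lintegral_le_sq_pi : ∀ {n : ℕ} {f g h : (Fin n → ℝ) → ℝ≥0∞},
    Measurable f → Measurable g → Measurable h →
    (∀ x y, f x * g y ≤ h ((2 : ℝ)⁻¹ • (x + y)) ^ 2) →
    (∫⁻ x, f x) * ∫⁻ x, g x ≤ (∫⁻ x, h x) ^ 2
  | 0, f, g, h, _, _, _, H => by
    have h0 : ∀ f : (Fin 0 → ℝ) → ℝ≥0∞, ∫⁻ x, f x = f 0 := fun f => by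
      rw [Measure.volume_pi_eq_dirac 0, lintegral_dirac]
    rw [h0, h0, h0]
    simpa using H 0 0
  | n + 1, f, g, h, hf, hg, hh, H => by
    have e := volume_preserving_piFinSuccAbove (fun _ : Fin (n + 1) => ℝ) 0
    have he : ∀ (t : ℝ) (x : Fin n → ℝ),
        (MeasurableEquiv.piFinSuccAbove (fun _ : Fin (n + 1) => ℝ) 0).symm (t, x) =
          (Fin.cons t x : Fin (n + 1) → ℝ) := fun t x => Fin.insertNth_zero' t x
    have hsplit : ∀ f : (Fin (n + 1) → ℝ) → ℝ≥0∞, Measurable f →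
        ∫⁻ x, f x = ∫⁻ t : ℝ, ∫⁻ x : Fin n → ℝ, f (Fin.cons t x) := by
      intro f hf
      have := (e.symm _).lintegral_comp hf
      rw [← this, Measure.volume_eq_prod, lintegral_prod _ (by fun_prop)]
      simp_rw [he]
    have hm : ∀ f : (Fin (n + 1) → ℝ) → ℝ≥0∞, Measurable f →
        Measurable fun p : ℝ × (Fin n → ℝ) => f (Fin.cons p.1 p.2) :=
      fun f hf => by
        simp_rw [← he]
        exact hf.comp (MeasurableEquiv.measurable _)
    rw [hsplit f hf, hsplit g hg, hsplit h hh]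
    refine lintegral_mul_lintegral_le_sq_real (hm f hf).lintegral_prod_right'
      (hm g hg).lintegral_prod_right' (hm h hh).lintegral_prod_right' fun t s => ?_
    refine lintegral_mul_lintegral_le_sq_pi ((hm f hf).comp measurable_prodMk_left)
      ((hm g hg).comp measurable_prodMk_left) ((hm h hh).comp measurable_prodMk_left)
      fun x y => ?_
    refine (H _ _).trans (le_of_eq ?_)
    congr 2
    ext i
    refine Fin.cases ?_ (fun j => ?_) i
    · simp; ring
    · simp; ring

/-- Prékopa–Leindler inequality, for midpoints. -/
theorem lintegral_mul_lintegral_le_sq {N : ℕ} {f g h : EuclideanSpace ℝ (Fin N) → ℝ≥0∞}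
    (hf : Measurable f) (hg : Measurable g) (hh : Measurable h)
    (H : ∀ x y, f x * g y ≤ h ((2 : ℝ)⁻¹ • (x + y)) ^ 2) :
    (∫⁻ x, f x) * ∫⁻ x, g x ≤ (∫⁻ x, h x) ^ 2 := by
  have e := (EuclideanSpace.volume_preserving_symm_measurableEquiv_toLp (Fin N)).symm
  rw [← e.lintegral_comp hf, ← e.lintegral_comp hg, ← e.lintegral_comp hh]
  refine lintegral_mul_lintegral_le_sq_pi (hf.comp e.measurable) (hg.comp e.measurable)
    (hh.comp e.measurable) fun x y => ?_
  exact H _ _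

end PrekopaLeindler

section Gaussian

open ProbabilityTheory

/-- The density of the standard Gaussian measure. -/
def gaussDensity (N : ℕ) (x : EuclideanSpace ℝ (Fin N)) : ℝ :=
  ((2 * Real.pi) ^ (N / 2 : ℝ))⁻¹ * Real.exp (-‖x‖ ^ 2 / 2)

lemma gaussDensity_pos (N : ℕ) (x : EuclideanSpace ℝ (Fin N)) : 0 < gaussDensity N x := by
  unfold gaussDensity; positivity

lemma continuous_gaussDensity (N : ℕ) : Continuous (gaussDensity N) := by
  unfold gaussDensity; fun_prop

lemma integral_gaussDensity (N : ℕ) : ∫ x, gaussDensity N x = 1 := by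
  have h := GaussianFourier.integral_rexp_neg_mul_sq_norm (V := EuclideanSpace ℝ (Fin N))
    (b := 1 / 2) (by norm_num)
  have h' : ∀ x : EuclideanSpace ℝ (Fin N), -‖x‖ ^ 2 / 2 = -(1 / 2) * ‖x‖ ^ 2 := fun x => by ring
  simp only [gaussDensity, h', integral_const_mul, h, finrank_euclideanSpace, Fintype.card_fin]
  rw [show Real.pi / (1 / 2) = 2 * Real.pi by ring]
  exact inv_mul_cancel₀ (by positivity)

lemma integrable_gaussDensity (N : ℕ) : Integrable (gaussDensity N) := by
  by_contra h
  simpa [integral_undef h] using integral_gaussDensity N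

lemma stdGaussian_eq_withDensity (N : ℕ) :
    stdGaussian (EuclideanSpace ℝ (Fin N)) =
      volume.withDensity fun x => ENNReal.ofReal (gaussDensity N x) := by
  have := isFiniteMeasure_withDensity_ofReal (integrable_gaussDensity N).2
  refine Measure.ext_of_charFun ?_
  ext t
  rw [charFun_stdGaussian, charFun_apply, integral_withDensity_eq_integral_toReal_smul
    (continuous_gaussDensity N).measurable.ennreal_ofReal (by simp)]
  have h := GaussianFourier.integral_cexp_neg_mul_sq_norm_add (V := EuclideanSpace ℝ (Fin N))
    (b := 1 / 2) (by norm_num) Complex.I t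
  have h' : ∀ x : EuclideanSpace ℝ (Fin N),
      (ENNReal.ofReal (gaussDensity N x)).toReal • Complex.exp (⟪x, t⟫ * Complex.I) =
        (((2 * Real.pi) ^ (N / 2 : ℝ))⁻¹ : ℝ) *
          Complex.exp (-(1 / 2) * ‖x‖ ^ 2 + Complex.I * ⟪t, x⟫) := by
    intro x
    rw [ENNReal.toReal_ofReal (gaussDensity_pos N x).le, gaussDensity, Complex.real_smul,
      Complex.exp_add]
    push_cast
    rw [real_inner_comm x t]
    ring_nf
  simp only [h', integral_const_mul, h, finrank_euclideanSpace, Fintype.card_fin]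
  rw [show (Real.pi / (1 / 2) : ℂ) = ((2 * Real.pi : ℝ) : ℂ) by push_cast; ring,
    show ((N : ℂ) / 2) = ((N / 2 : ℝ) : ℂ) by push_cast; ring,
    ← Complex.ofReal_cpow (by positivity), ← mul_assoc, ← Complex.ofReal_mul,
    inv_mul_cancel₀ (by positivity)]
  simp
  ring_nf

lemma stdGaussian_absolutelyContinuous (N : ℕ) :
    stdGaussian (EuclideanSpace ℝ (Fin N)) ≪ volume := by
  rw [stdGaussian_eq_withDensity]
  exact withDensity_absolutelyContinuous _ _

lemma lintegral_stdGaussian {N : ℕ} {f : EuclideanSpace ℝ (Fin N) → ℝ≥0∞} (hf : Measurable f) :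
    ∫⁻ x, f x ∂(stdGaussian _) = ∫⁻ x, ENNReal.ofReal (gaussDensity N x) * f x := by
  rw [stdGaussian_eq_withDensity, lintegral_withDensity_eq_lintegral_mul _
    (continuous_gaussDensity N).measurable.ennreal_ofReal hf]
  rfl

/-- Prékopa–Leindler inequality for the Gaussian measure, with the gain from strict
log-concavity. -/
lemma lintegral_mul_lintegral_le_sq_stdGaussian {N : ℕ}
    {f g h : EuclideanSpace ℝ (Fin N) → ℝ≥0∞}
    (hf : Measurable f) (hg : Measurable g) (hh : Measurable h)
    (H : ∀ x y, f x * g y ≤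
      ENNReal.ofReal (Real.exp (‖x - y‖ ^ 2 / 4)) * h ((2 : ℝ)⁻¹ • (x + y)) ^ 2) :
    (∫⁻ x, f x ∂(stdGaussian _)) * ∫⁻ x, g x ∂(stdGaussian _) ≤
      (∫⁻ x, h x ∂(stdGaussian _)) ^ 2 := by
  rw [lintegral_stdGaussian hf, lintegral_stdGaussian hg, lintegral_stdGaussian hh]
  have hm := (continuous_gaussDensity N).measurable.ennreal_ofReal
  refine lintegral_mul_lintegral_le_sq (hm.mul hf) (hm.mul hg) (hm.mul hh) fun x y => ?_
  have hw : gaussDensity N x * gaussDensity N y * Real.exp (‖x - y‖ ^ 2 / 4) =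
      gaussDensity N ((2 : ℝ)⁻¹ • (x + y)) ^ 2 := by
    have := parallelogram_law_with_norm ℝ x y
    rw [gaussDensity, gaussDensity, gaussDensity, mul_mul_mul_comm, ← Real.exp_add, mul_assoc,
      ← Real.exp_add, ← sq, mul_pow, ← Real.exp_nat_mul, norm_smul]
    congr 2
    norm_num
    linarith
  calc _ = ENNReal.ofReal (gaussDensity N x) * ENNReal.ofReal (gaussDensity N y) *
        (f x * g y) := by ring
    _ ≤ ENNReal.ofReal (gaussDensity N x) * ENNReal.ofReal (gaussDensity N y) *
        (ENNReal.ofReal (Real.exp (‖x - y‖ ^ 2 / 4)) * h ((2 : ℝ)⁻¹ • (x + y)) ^ 2) := by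
      exact mul_le_mul' le_rfl (H x y)
    _ = _ := by
      rw [← mul_assoc, ← ENNReal.ofReal_mul (gaussDensity_pos N x).le, ← ENNReal.ofReal_mul
        (mul_pos (gaussDensity_pos N x) (gaussDensity_pos N y)).le, hw, mul_pow,
        ENNReal.ofReal_pow (gaussDensity_pos N _).le]

lemma integrable_norm_pow_stdGaussian (N n : ℕ) :
    Integrable (fun x => ‖x‖ ^ n) (stdGaussian (EuclideanSpace ℝ (Fin N))) := by
  have := IsGaussian.memLp_id (stdGaussian (EuclideanSpace ℝ (Fin N))) n (by simp)
  exact this.integrable_norm_pow'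

end Gaussian

section OneStep

open ProbabilityTheory

/-- The Mehler (Ornstein–Uhlenbeck) averaging operator. -/
def mehler {N : ℕ} (c σ : ℝ) (f : EuclideanSpace ℝ (Fin N) → ℝ≥0∞)
    (x : EuclideanSpace ℝ (Fin N)) : ℝ≥0∞ :=
  ∫⁻ z, f (c • x + σ • z) ∂(stdGaussian (EuclideanSpace ℝ (Fin N)))

lemma measurable_mehler {N : ℕ} (c σ : ℝ) {f : EuclideanSpace ℝ (Fin N) → ℝ≥0∞}
    (hf : Measurable f) : Measurable (mehler c σ f) :=
  Measurable.lintegral_prod_right' (f := fun p : _ × _ => f (c • p.1 + σ • p.2)) (by fun_prop)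

lemma max_abs_le_add_pow_four_div {a s v : ℝ} (ha : 0 < a) (hs : 2 * s ≤ a) :
    max |a + v| s ≤ a + v + 16 * v ^ 4 / a ^ 3 := by
  rcases le_or_gt (-a / 2) v with h | h
  · have : 0 ≤ 16 * v ^ 4 / a ^ 3 := by positivity
    rw [abs_of_nonneg (by linarith)]
    exact max_le (by linarith) (by linarith)
  · have h1 : -2 * v ≤ 16 * v ^ 4 / a ^ 3 := by
      rw [le_div_iff₀ (by positivity)]
      have h2 : a ^ 3 ≤ (-2 * v) ^ 3 := by
        apply pow_le_pow_left₀ ha.le; linarith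
      have h3 : (-2 * v) * a ^ 3 ≤ (-2 * v) * (-2 * v) ^ 3 := by
        apply mul_le_mul_of_nonneg_left h2; linarith
      nlinarith
    refine max_le (abs_le.2 ⟨by linarith, by linarith⟩) (by linarith)

lemma integrable_inner_pow_stdGaussian {N : ℕ} (e : EuclideanSpace ℝ (Fin N)) (n : ℕ) :
    Integrable (fun m => ⟪e, m⟫ ^ n) (stdGaussian (EuclideanSpace ℝ (Fin N))) := by
  refine ((integrable_norm_pow_stdGaussian N n).const_mul (‖e‖ ^ n)).mono'
    (by fun_prop) (ae_of_all _ fun m => ?_)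
  rw [norm_pow, ← mul_pow]
  gcongr
  exact norm_inner_le_norm e m

lemma integral_inner_stdGaussian {N : ℕ} (e : EuclideanSpace ℝ (Fin N)) :
    ∫ m, ⟪e, m⟫ ∂(stdGaussian (EuclideanSpace ℝ (Fin N))) = 0 :=
  integral_strongDual_stdGaussian (innerSL ℝ e)

lemma lintegral_max_abs_le {N : ℕ} {e : EuclideanSpace ℝ (Fin N)} (he : ‖e‖ = 1) {a s t : ℝ}
    (ha : 0 < a) (hs : 2 * s ≤ a) :
    ∫⁻ m, ENNReal.ofReal (max |a + t * ⟪e, m⟫| s) ∂(stdGaussian (EuclideanSpace ℝ (Fin N))) ≤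
      ENNReal.ofReal (a + 16 * t ^ 4 *
        (∫ m, ‖m‖ ^ 4 ∂(stdGaussian (EuclideanSpace ℝ (Fin N)))) / a ^ 3) := by
  set γ := stdGaussian (EuclideanSpace ℝ (Fin N))
  have h1 : Integrable (fun m => ⟪e, m⟫) γ := by
    simpa using integrable_inner_pow_stdGaussian e 1
  have h4 := integrable_norm_pow_stdGaussian N 4
  have h01 : Integrable (fun m => a + t * ⟪e, m⟫) γ := (integrable_const a).add (h1.const_mul t)
  have hint : Integrable (fun m => a + t * ⟪e, m⟫ + 16 * t ^ 4 / a ^ 3 * ‖m‖ ^ 4) γ :=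
    h01.add (h4.const_mul _)
  have hpt : ∀ m, max |a + t * ⟪e, m⟫| s ≤ a + t * ⟪e, m⟫ + 16 * t ^ 4 / a ^ 3 * ‖m‖ ^ 4 := by
    intro m
    refine (max_abs_le_add_pow_four_div ha hs).trans ?_
    have : ⟪e, m⟫ ^ 4 ≤ ‖m‖ ^ 4 := by
      rw [← Even.pow_abs (by decide : Even 4)]
      gcongr
      simpa [he] using abs_real_inner_le_norm e m
    rw [mul_pow, ← mul_assoc, div_mul_eq_mul_div]
    gcongr
  calc _ ≤ ∫⁻ m, ENNReal.ofReal (a + t * ⟪e, m⟫ + 16 * t ^ 4 / a ^ 3 * ‖m‖ ^ 4) ∂γ :=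
        lintegral_mono fun m => ENNReal.ofReal_le_ofReal (hpt m)
    _ = ENNReal.ofReal (∫ m, a + t * ⟪e, m⟫ + 16 * t ^ 4 / a ^ 3 * ‖m‖ ^ 4 ∂γ) := by
        rw [ofReal_integral_eq_lintegral_ofReal hint
          (ae_of_all _ fun m => (abs_nonneg _).trans ((le_max_left _ _).trans (hpt m)))]
    _ = _ := by
        rw [integral_add h01 (h4.const_mul _),
          integral_add (integrable_const a) (h1.const_mul t), integral_const_mul,
          integral_inner_stdGaussian, integral_const_mul]
        simp
        ring_nf

/-- The Euclidean distance between points coupled by reflection. -/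
lemma norm_sq_reflected {E : Type*} [NormedAddCommGroup E] [InnerProductSpace ℝ E] {e : E}
    (he : ‖e‖ = 1) (a σ : ℝ) (z w : E) :
    ‖a • e + σ • (z - (w - (2 * ⟪e, w⟫) • e))‖ ^ 2 =
      (a + σ * ⟪e, z + w⟫) ^ 2 + σ ^ 2 * (‖z - w‖ ^ 2 - ⟪e, z - w⟫ ^ 2) := by
  have h1 : a • e + σ • (z - (w - (2 * ⟪e, w⟫) • e)) =
      (a + σ * (2 * ⟪e, w⟫)) • e + σ • (z - w) := by module
  rw [h1, norm_add_sq_real, norm_smul, norm_smul, mul_pow, mul_pow, he, inner_smul_left,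
    inner_smul_right, inner_sub_right, inner_add_right]
  simp only [Real.norm_eq_abs, sq_abs, conj_trivial]
  ring

lemma norm_sq_reflected_le {E : Type*} [NormedAddCommGroup E] [InnerProductSpace ℝ E] {e : E}
    (he : ‖e‖ = 1) (a : ℝ) {σ : ℝ} (hσ : 0 ≤ σ) (z w : E) :
    ‖a • e + σ • (z - (w - (2 * ⟪e, w⟫) • e))‖ ^ 2 ≤
      Real.exp (‖z - w‖ ^ 2 / 4) *
        max |a + 2 * σ * ⟪e, (2 : ℝ)⁻¹ • (z + w)⟫| (2 * σ) ^ 2 := by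
  rw [norm_sq_reflected he, inner_smul_right]
  set u := a + 2 * σ * (2⁻¹ * ⟪e, z + w⟫) with hu
  have hu' : a + σ * ⟪e, z + w⟫ = u := by rw [hu]; ring
  rw [hu']
  set M := max |u| (2 * σ)
  have h1 : u ^ 2 ≤ M ^ 2 := by
    rw [← sq_abs]; gcongr; exact le_max_left _ _
  have h2 : 4 * σ ^ 2 ≤ M ^ 2 := by
    calc 4 * σ ^ 2 = (2 * σ) ^ 2 := by ring
      _ ≤ _ := by gcongr; exact le_max_right _ _
  have h3 : ‖z - w‖ ^ 2 / 4 + 1 ≤ Real.exp (‖z - w‖ ^ 2 / 4) := Real.add_one_le_exp _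
  have h4 : (‖z - w‖ ^ 2 / 4 + 1) * M ^ 2 ≤ Real.exp (‖z - w‖ ^ 2 / 4) * M ^ 2 := by gcongr
  nlinarith [sq_nonneg (σ * ⟪e, z - w⟫), mul_le_mul_of_nonneg_right h2 (sq_nonneg ‖z - w‖)]

lemma add_pow_four_div_le {M c σ δ D : ℝ} (hδ : 0 < δ) (hD : δ ≤ D) (hM : 0 ≤ M)
    (hc : 1 / 2 ≤ c) :
    c * D + 16 * (2 * σ) ^ 4 * M / (c * D) ^ 3 ≤ (c + 2048 * M / δ ^ 4 * σ ^ 4) * D := by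
  have hc0 : 0 < c := by linarith
  have hD0 : 0 < D := by linarith
  rw [add_mul]
  gcongr
  rw [div_le_iff₀ (by positivity)]
  have h1 : δ ^ 4 ≤ 8 * (c ^ 3 * D ^ 4) := by
    have : (1 / 2 : ℝ) ^ 3 ≤ c ^ 3 := by gcongr
    have h2 : δ ^ 4 ≤ D ^ 4 := by gcongr
    nlinarith [pow_pos hD0 4]
  calc 16 * (2 * σ) ^ 4 * M = 256 * M * σ ^ 4 / δ ^ 4 * δ ^ 4 := by field_simp; ring
    _ ≤ 256 * M * σ ^ 4 / δ ^ 4 * (8 * (c ^ 3 * D ^ 4)) := by gcongr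
    _ = _ := by ring

lemma mehler_mul_mehler_le {N : ℕ} {p q : EuclideanSpace ℝ (Fin N) → ℝ≥0∞}
    (hp : Measurable p) (hq : Measurable q) {C : ℝ} (hC : 0 ≤ C)
    (H : ∀ x y, p x * q y ≤ ENNReal.ofReal ((C * ‖x - y‖) ^ 2))
    {c σ δ : ℝ} (hσ : 0 ≤ σ) (hδ : 0 < δ) (hc : 1 / 2 ≤ c) (hσδ : 4 * σ ≤ c * δ)
    {x y : EuclideanSpace ℝ (Fin N)} (hxy : δ ≤ ‖x - y‖) :
    mehler c σ p x * mehler c σ q y ≤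
      ENNReal.ofReal ((C * (c + 2048 * (∫ m, ‖m‖ ^ 4 ∂(stdGaussian (EuclideanSpace ℝ (Fin N)))) /
        δ ^ 4 * σ ^ 4) * ‖x - y‖) ^ 2) := by
  set γ := stdGaussian (EuclideanSpace ℝ (Fin N))
  set M4 := ∫ m, ‖m‖ ^ 4 ∂γ
  have hM4 : 0 ≤ M4 := integral_nonneg fun m => by positivity
  set D := ‖x - y‖ with hD
  have hDp : 0 < D := hδ.trans_le hxy
  have hc0 : 0 < c := by linarith
  set e := D⁻¹ • (x - y) with he_def
  have he : ‖e‖ = 1 := by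
    rw [he_def, norm_smul, norm_inv, Real.norm_of_nonneg hDp.le, ← hD, inv_mul_cancel₀ hDp.ne']
  have hxe : x - y = D • e := by rw [he_def, smul_inv_smul₀ hDp.ne']
  let R : EuclideanSpace ℝ (Fin N) ≃ₗᵢ[ℝ] EuclideanSpace ℝ (Fin N) := (ℝ ∙ e)ᗮ.reflection
  have hR : ∀ w, R w = w - (2 * ⟪e, w⟫) • e := by
    intro w
    simp only [R, Submodule.reflection_orthogonal_apply, Submodule.reflection_singleton_apply, he]
    simp
    module
  have hRmp : MeasurePreserving R γ γ := ⟨R.continuous.measurable, stdGaussian_map R⟩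
  have hqR : mehler c σ q y = ∫⁻ w, q (c • y + σ • R w) ∂γ :=
    (hRmp.lintegral_comp (f := fun w => q (c • y + σ • w)) (by fun_prop)).symm
  have hRm := R.continuous.measurable
  have hnn : 0 ≤ C * (c + 2048 * M4 / δ ^ 4 * σ ^ 4) * D :=
    mul_nonneg (mul_nonneg hC (add_nonneg hc0.le (mul_nonneg (div_nonneg (by linarith)
      (pow_nonneg hδ.le _)) (pow_nonneg hσ _)))) hDp.le
  rw [hqR, mehler]
  have key := lintegral_mul_lintegral_le_sq_stdGaussian
    (f := fun z => p (c • x + σ • z)) (g := fun w => q (c • y + σ • R w))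
    (h := fun m => ENNReal.ofReal (C * max |c * D + (2 * σ) * ⟪e, m⟫| (2 * σ)))
    (by fun_prop) (by fun_prop) (by fun_prop) fun z w => ?_
  · refine key.trans ?_
    rw [ENNReal.ofReal_pow hnn]
    gcongr
    simp_rw [ENNReal.ofReal_mul hC]
    rw [lintegral_const_mul' _ _ (by simp), mul_assoc, ENNReal.ofReal_mul hC]
    gcongr
    refine (lintegral_max_abs_le he (by positivity) ?_).trans (ENNReal.ofReal_le_ofReal ?_)
    · nlinarith
    exact add_pow_four_div_le hδ hxy hM4 hc
  · refine (H _ _).trans ?_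
    rw [← ENNReal.ofReal_pow (by positivity), ← ENNReal.ofReal_mul (by positivity)]
    refine ENNReal.ofReal_le_ofReal ?_
    have hv : c • x + σ • z - (c • y + σ • R w) =
        (c * D) • e + σ • (z - (w - (2 * ⟪e, w⟫) • e)) := by
      rw [hR, mul_smul c D e, ← hxe]; module
    rw [hv, mul_pow, mul_pow]
    have := norm_sq_reflected_le he (c * D) hσ z w
    nlinarith [mul_le_mul_of_nonneg_left this (sq_nonneg C)]

end OneStep

section Iteration

open ProbabilityTheory

variable {N : ℕ}

lemma measurePreserving_gaussian_swap (N : ℕ) (θ : ℝ) :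
    MeasurePreserving (fun p : EuclideanSpace ℝ (Fin N) × EuclideanSpace ℝ (Fin N) =>
      (Real.cos θ • p.1 + Real.sin θ • p.2, Real.sin θ • p.1 - Real.cos θ • p.2))
      ((stdGaussian _).prod (stdGaussian _)) ((stdGaussian _).prod (stdGaussian _)) := by
  set γ := stdGaussian (EuclideanSpace ℝ (Fin N))
  have h1 : MeasurePreserving (ContinuousLinearMap.rotation (E := EuclideanSpace ℝ (Fin N)) θ)
      (γ.prod γ) (γ.prod γ) :=
    ⟨by fun_prop, IsGaussian.map_rotation_eq_self integral_id_stdGaussian θ⟩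
  have h2 : MeasurePreserving (fun x : EuclideanSpace ℝ (Fin N) => -x) γ γ :=
    ⟨by fun_prop, stdGaussian_map (LinearIsometryEquiv.neg ℝ)⟩
  convert! ((MeasurePreserving.id γ).prod h2).comp h1 using 1
  ext p <;> (simp [ContinuousLinearMap.rotation_apply]; try ring)

lemma lintegral_mul_mehler {f g : EuclideanSpace ℝ (Fin N) → ℝ≥0∞} (hf : Measurable f)
    (hg : Measurable g) (θ : ℝ) :
    ∫⁻ x, f x * mehler (Real.cos θ) (Real.sin θ) g x ∂(stdGaussian _) =
      ∫⁻ x, mehler (Real.cos θ) (Real.sin θ) f x * g x ∂(stdGaussian _) := by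
  set γ := stdGaussian (EuclideanSpace ℝ (Fin N))
  set c := Real.cos θ
  set σ := Real.sin θ
  calc ∫⁻ x, f x * mehler c σ g x ∂γ
      = ∫⁻ p : _ × _, f p.1 * g (c • p.1 + σ • p.2) ∂(γ.prod γ) := by
        rw [lintegral_prod _ (by fun_prop)]
        refine lintegral_congr fun x => ?_
        rw [mehler, ← lintegral_const_mul _ (by fun_prop)]
    _ = ∫⁻ p : _ × _, f (c • p.1 + σ • p.2) * g p.1 ∂(γ.prod γ) := by
        rw [← (measurePreserving_gaussian_swap N θ).lintegral_comp (by fun_prop)]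
        refine lintegral_congr fun p => ?_
        have : c • (c • p.1 + σ • p.2) + σ • (σ • p.1 - c • p.2) = p.1 := by
          have h : c ^ 2 + σ ^ 2 = 1 := Real.cos_sq_add_sin_sq θ
          calc _ = (c ^ 2 + σ ^ 2) • p.1 := by module
            _ = _ := by rw [h, one_smul]
        rw [this]
    _ = _ := by
        rw [lintegral_prod _ (by fun_prop)]
        refine lintegral_congr fun x => ?_
        rw [mehler, ← lintegral_mul_const _ (by fun_prop)]

/-- The averaging operator killed outside `A`. -/
def killedMehler (θ : ℝ) (A : Set (EuclideanSpace ℝ (Fin N)))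
    (f : EuclideanSpace ℝ (Fin N) → ℝ≥0∞) : EuclideanSpace ℝ (Fin N) → ℝ≥0∞ :=
  A.indicator (mehler (Real.cos θ) (Real.sin θ) f)

lemma measurable_killedMehler_iterate {θ : ℝ} {p : EuclideanSpace ℝ (Fin N) → ℝ≥0∞}
    (hp : Measurable p) (k : ℕ) : Measurable ((killedMehler θ (Function.support p))^[k] p) := by
  induction k with
  | zero => exact hp
  | succ k ih =>
    rw [Function.iterate_succ_apply']
    exact (measurable_mehler _ _ ih).indicator (measurableSet_support hp)

lemma killedMehler_iterate_le {θ : ℝ} {p : EuclideanSpace ℝ (Fin N) → ℝ≥0∞} {M : ℝ≥0∞}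
    (hM : ∀ x, p x ≤ M) (k : ℕ) (x : EuclideanSpace ℝ (Fin N)) :
    (killedMehler θ (Function.support p))^[k] p x ≤ M := by
  induction k generalizing x with
  | zero => exact hM x
  | succ k ih =>
    rw [Function.iterate_succ_apply']
    refine (indicator_le_self _ _ x).trans ?_
    calc _ ≤ ∫⁻ _, M ∂(stdGaussian (EuclideanSpace ℝ (Fin N))) := lintegral_mono fun z => ih _
      _ = M := by simp

lemma killedMehler_iterate_eq_zero {θ : ℝ} {p : EuclideanSpace ℝ (Fin N) → ℝ≥0∞} (k : ℕ)
    {x : EuclideanSpace ℝ (Fin N)} (hx : p x = 0) :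
    (killedMehler θ (Function.support p))^[k] p x = 0 := by
  cases k with
  | zero => exact hx
  | succ k =>
    rw [Function.iterate_succ_apply']
    exact indicator_of_notMem (by simpa using hx) _

lemma killedMehler_iterate_mul_le {p q : EuclideanSpace ℝ (Fin N) → ℝ≥0∞}
    (hp : Measurable p) (hq : Measurable q) {C : ℝ} (hC : 0 ≤ C)
    (H : ∀ x y, p x * q y ≤ ENNReal.ofReal ((C * ‖x - y‖) ^ 2))
    {θ δ : ℝ} (hσ : 0 ≤ Real.sin θ) (hδ : 0 < δ) (hc : 1 / 2 ≤ Real.cos θ)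
    (hσδ : 4 * Real.sin θ ≤ Real.cos θ * δ)
    (hsep : ∀ x y, p x ≠ 0 → q y ≠ 0 → δ ≤ ‖x - y‖) {ρ : ℝ}
    (hρ : Real.cos θ + 2048 * (∫ m, ‖m‖ ^ 4 ∂(stdGaussian (EuclideanSpace ℝ (Fin N)))) /
        δ ^ 4 * Real.sin θ ^ 4 = ρ) (hρ0 : 0 ≤ ρ) (k : ℕ) (x y : EuclideanSpace ℝ (Fin N)) :
    (killedMehler θ (Function.support p))^[k] p x * (killedMehler θ (Function.support q))^[k] q y ≤
      ENNReal.ofReal ((C * ρ ^ k * ‖x - y‖) ^ 2) := by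
  induction k generalizing x y with
  | zero => simpa using H x y
  | succ k ih =>
    by_cases hx : p x = 0
    · rw [killedMehler_iterate_eq_zero _ hx]; simp
    by_cases hy : q y = 0
    · rw [killedMehler_iterate_eq_zero _ hy]; simp
    rw [Function.iterate_succ_apply', Function.iterate_succ_apply', killedMehler, killedMehler,
      indicator_of_mem (by simpa using hx), indicator_of_mem (by simpa using hy)]
    have := mehler_mul_mehler_le (measurable_killedMehler_iterate hp k)
      (measurable_killedMehler_iterate hq k) (by positivity) ih hσ hδ hc hσδ (hsep x y hx hy)
    rwa [hρ, mul_assoc C, ← pow_succ] at this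

lemma lintegral_killedMehler_iterate_mul {θ : ℝ} {p : EuclideanSpace ℝ (Fin N) → ℝ≥0∞}
    (hp : Measurable p) (j k : ℕ) :
    ∫⁻ x, (killedMehler θ (Function.support p))^[j] p x *
        (killedMehler θ (Function.support p))^[k] p x ∂(stdGaussian _) =
      ∫⁻ x, p x * (killedMehler θ (Function.support p))^[j + k] p x ∂(stdGaussian _) := by
  induction j generalizing k with
  | zero => simp
  | succ j ih =>
    have hk : ∀ (f g : EuclideanSpace ℝ (Fin N) → ℝ≥0∞), (∀ x, p x = 0 → g x = 0) → ∀ x,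
        killedMehler θ (Function.support p) f x * g x =
          mehler (Real.cos θ) (Real.sin θ) f x * g x := by
      intro f g hg x
      by_cases hx : p x = 0
      · simp [hg x hx]
      · rw [killedMehler, indicator_of_mem (by simpa using hx)]
    calc _ = ∫⁻ x, mehler (Real.cos θ) (Real.sin θ)
            ((killedMehler θ (Function.support p))^[j] p) x *
          (killedMehler θ (Function.support p))^[k] p x ∂(stdGaussian _) := by
          refine lintegral_congr fun x => ?_
          rw [Function.iterate_succ_apply']
          exact hk _ _ (fun x hx => killedMehler_iterate_eq_zero _ hx) x
      _ = ∫⁻ x, (killedMehler θ (Function.support p))^[j] p x *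
          (killedMehler θ (Function.support p))^[k + 1] p x ∂(stdGaussian _) := by
          rw [← lintegral_mul_mehler (measurable_killedMehler_iterate hp j)
            (measurable_killedMehler_iterate hp k)]
          refine lintegral_congr fun x => ?_
          rw [Function.iterate_succ_apply', mul_comm, mul_comm _ (killedMehler _ _ _ x)]
          exact (hk _ _ (fun x hx => killedMehler_iterate_eq_zero _ hx) x).symm
      _ = _ := by rw [ih, add_right_comm, add_assoc]

lemma sq_lintegral_mul_le {α : Type*} [MeasurableSpace α] {μ : Measure α} {f g : α → ℝ≥0∞}
    (hf : Measurable f) (hg : Measurable g) :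
    (∫⁻ x, f x * g x ∂μ) ^ 2 ≤ (∫⁻ x, f x * f x ∂μ) * ∫⁻ x, g x * g x ∂μ := by
  have h := ENNReal.lintegral_mul_le_Lp_mul_Lq μ Real.HolderConjugate.two_two
    hf.aemeasurable hg.aemeasurable
  have h2 := pow_le_pow_left' h 2
  rw [mul_pow, ← ENNReal.rpow_natCast (_ ^ (1 / (2 : ℝ))), ← ENNReal.rpow_mul,
    ← ENNReal.rpow_natCast (_ ^ (1 / (2 : ℝ))), ← ENNReal.rpow_mul] at h2
  simpa [pow_two] using h2

lemma mul_le_sq_mul_of_moments {u v : ℕ → ℝ} (hu : ∀ k, 0 ≤ u k) (hv : ∀ k, 0 ≤ v k)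
    (hu2 : ∀ k, u k ^ 2 ≤ u 0 * u (2 * k)) (hv2 : ∀ k, v k ^ 2 ≤ v 0 * v (2 * k))
    {S r : ℝ} (hr : 0 < r) (h : ∀ k, u k * v k ≤ S * r ^ k) :
    u 1 * v 1 ≤ r * (u 0 * v 0) := by
  have h0 : 0 ≤ u 0 * v 0 := mul_nonneg (hu 0) (hv 0)
  rcases h0.eq_or_lt with h00 | h00
  · have : (u 1 * v 1) ^ 2 ≤ 0 := by
      calc (u 1 * v 1) ^ 2 = u 1 ^ 2 * v 1 ^ 2 := by ring
        _ ≤ (u 0 * u 2) * (v 0 * v 2) :=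
          mul_le_mul (hu2 1) (hv2 1) (sq_nonneg _) (mul_nonneg (hu 0) (hu 2))
        _ = (u 0 * v 0) * (u 2 * v 2) := by ring
        _ = 0 := by rw [← h00, zero_mul]
    rw [← h00, mul_zero, pow_eq_zero_iff two_ne_zero |>.1 (le_antisymm this (sq_nonneg _))]
  set a := u 0 * v 0
  by_contra! hcon
  have hpow : ∀ j : ℕ, (u 1 * v 1) ^ (2 ^ j) ≤ a ^ (2 ^ j) / a * (u (2 ^ j) * v (2 ^ j)) := by
    intro j
    induction j with
    | zero => simp [h00.ne']
    | succ j ih =>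
      calc (u 1 * v 1) ^ 2 ^ (j + 1) = ((u 1 * v 1) ^ 2 ^ j) ^ 2 := by rw [← pow_mul, pow_succ]
        _ ≤ (a ^ (2 ^ j) / a * (u (2 ^ j) * v (2 ^ j))) ^ 2 :=
          pow_le_pow_left₀ (pow_nonneg (mul_nonneg (hu 1) (hv 1)) _) ih 2
        _ = a ^ (2 ^ (j + 1)) / a ^ 2 * (u (2 ^ j) ^ 2 * v (2 ^ j) ^ 2) := by
          rw [mul_pow, div_pow, ← pow_mul, ← pow_succ, mul_pow (u (2 ^ j))]
        _ ≤ a ^ (2 ^ (j + 1)) / a ^ 2 *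
            ((u 0 * u (2 * 2 ^ j)) * (v 0 * v (2 * 2 ^ j))) := by
          have := mul_le_mul (hu2 (2 ^ j)) (hv2 (2 ^ j)) (sq_nonneg _)
            (mul_nonneg (hu 0) (hu (2 * 2 ^ j)))
          gcongr
        _ = a ^ (2 ^ (j + 1)) / a ^ 2 * (a * (u (2 ^ (j + 1)) * v (2 ^ (j + 1)))) := by
          rw [pow_succ' 2 j]; ring
        _ = _ := by field_simp
  set t := u 1 * v 1 / (r * a)
  have ht : 1 < t := (one_lt_div (by positivity)).2 hcon
  have hbd : ∀ j : ℕ, t ^ (2 ^ j) ≤ S / a := by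
    intro j
    rw [div_pow, div_le_div_iff₀ (by positivity) h00, mul_pow r]
    have h1 := hpow j
    have h2 := mul_le_mul_of_nonneg_left (h (2 ^ j)) (by positivity : 0 ≤ a ^ (2 ^ j) / a)
    have h3 := mul_le_mul_of_nonneg_right (h1.trans h2) h00.le
    refine h3.trans (le_of_eq ?_)
    field_simp
  obtain ⟨n, hn⟩ := pow_unbounded_of_one_lt (S / a) ht
  have := (pow_le_pow_right₀ ht.le (Nat.lt_two_pow_self (n := n)).le).trans (hbd n)
  linarith

lemma lintegral_mul_mehler_support_mul_le {p q : EuclideanSpace ℝ (Fin N) → ℝ≥0∞}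
    (hp : Measurable p) (hq : Measurable q) {M : ℝ≥0} (hpM : ∀ x, p x ≤ M) (hqM : ∀ x, q x ≤ M)
    {θ δ ρ : ℝ} (hσ : 0 ≤ Real.sin θ) (hδ : 0 < δ) (hc : 1 / 2 ≤ Real.cos θ)
    (hσδ : 4 * Real.sin θ ≤ Real.cos θ * δ)
    (hsep : ∀ x y, p x ≠ 0 → q y ≠ 0 → δ ≤ ‖x - y‖)
    (hρ : Real.cos θ + 2048 * (∫ m, ‖m‖ ^ 4 ∂(stdGaussian (EuclideanSpace ℝ (Fin N)))) /
        δ ^ 4 * Real.sin θ ^ 4 = ρ) (hρ0 : 0 < ρ) :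
    (∫⁻ x, p x * mehler (Real.cos θ) (Real.sin θ) p x ∂(stdGaussian _)).toReal *
        (∫⁻ x, q x * mehler (Real.cos θ) (Real.sin θ) q x ∂(stdGaussian _)).toReal ≤
      ρ ^ 2 * ((∫⁻ x, p x * p x ∂(stdGaussian _)).toReal *
        (∫⁻ x, q x * q x ∂(stdGaussian _)).toReal) := by
  set γ := stdGaussian (EuclideanSpace ℝ (Fin N)) with hγ
  have hfin : ∀ (f : EuclideanSpace ℝ (Fin N) → ℝ≥0∞), (∀ x, f x ≤ M) → ∀ k,
      ∫⁻ x, f x * (killedMehler θ (Function.support f))^[k] f x ∂γ ≠ ∞ := by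
    intro f hf k
    refine ne_top_of_le_ne_top (b := (M * M : ℝ≥0∞)) (by finiteness) ?_
    calc _ ≤ ∫⁻ _, (M * M : ℝ≥0∞) ∂γ :=
          lintegral_mono fun x => mul_le_mul' (hf x) (killedMehler_iterate_le hf k x)
      _ = M * M := by simp
  have hone : ∀ (f : EuclideanSpace ℝ (Fin N) → ℝ≥0∞),
      ∫⁻ x, f x * (killedMehler θ (Function.support f))^[1] f x ∂γ =
        ∫⁻ x, f x * mehler (Real.cos θ) (Real.sin θ) f x ∂γ := by
    intro f
    refine lintegral_congr fun x => ?_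
    by_cases hx : f x = 0
    · simp [hx]
    · rw [Function.iterate_one, killedMehler, indicator_of_mem (by simpa using hx)]
  have hsq : ∀ (f : EuclideanSpace ℝ (Fin N) → ℝ≥0∞), Measurable f → (∀ x, f x ≤ M) → ∀ k,
      (∫⁻ x, f x * (killedMehler θ (Function.support f))^[k] f x ∂γ).toReal ^ 2 ≤
      (∫⁻ x, f x * (killedMehler θ (Function.support f))^[0] f x ∂γ).toReal *
      (∫⁻ x, f x * (killedMehler θ (Function.support f))^[2 * k] f x ∂γ).toReal := by
    intro f hf hfM k
    rw [← ENNReal.toReal_pow, ← ENNReal.toReal_mul]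
    refine ENNReal.toReal_mono (ENNReal.mul_ne_top (hfin f hfM 0) (hfin f hfM _)) ?_
    have := sq_lintegral_mul_le (μ := γ) hf (measurable_killedMehler_iterate (θ := θ) hf k)
    rwa [lintegral_killedMehler_iterate_mul hf, ← two_mul] at this
  have h2 : Integrable (fun x : EuclideanSpace ℝ (Fin N) => ‖x‖ ^ 2) γ :=
    integrable_norm_pow_stdGaussian N 2
  have hδ' : ∀ x y, p x * q y ≤ ENNReal.ofReal ((M / δ * ‖x - y‖) ^ 2) := by
    intro x y
    by_cases hx : p x = 0
    · simp [hx]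
    by_cases hy : q y = 0
    · simp [hy]
    calc p x * q y ≤ M * M := mul_le_mul' (hpM x) (hqM y)
      _ = ENNReal.ofReal ((M / δ * δ) ^ 2) := by
        rw [div_mul_cancel₀ _ hδ.ne', ENNReal.ofReal_pow (by positivity)]
        simp [sq]
      _ ≤ _ := by gcongr; exact hsep x y hx hy
  have hdist : ∫⁻ x, ∫⁻ y, ENNReal.ofReal (‖x - y‖ ^ 2) ∂γ ∂γ ≠ ∞ := by
    have hle : ∀ x y : EuclideanSpace ℝ (Fin N),
        ENNReal.ofReal (‖x - y‖ ^ 2) ≤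
          ENNReal.ofReal (2 * ‖x‖ ^ 2) + ENNReal.ofReal (2 * ‖y‖ ^ 2) := by
      intro x y
      rw [← ENNReal.ofReal_add (by positivity) (by positivity)]
      refine ENNReal.ofReal_le_ofReal ?_
      nlinarith [norm_sub_le x y, norm_nonneg (x - y), sq_nonneg (‖x‖ - ‖y‖)]
    have hI : ∫⁻ x : EuclideanSpace ℝ (Fin N), ENNReal.ofReal (2 * ‖x‖ ^ 2) ∂γ ≠ ∞ := by
      rw [← ofReal_integral_eq_lintegral_ofReal (h2.const_mul 2)
        (ae_of_all _ fun x => by positivity)]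
      simp
    refine ne_top_of_le_ne_top (ENNReal.add_ne_top.2 ⟨hI, hI⟩)
      ((lintegral_mono fun x => lintegral_mono fun y => hle x y).trans (le_of_eq ?_))
    simp_rw [lintegral_add_left (measurable_const : Measurable fun _ : EuclideanSpace ℝ (Fin N) =>
      ENNReal.ofReal (2 * ‖_‖ ^ 2))]
    rw [lintegral_add_right _ measurable_const]
    simp
  have key := mul_le_sq_mul_of_moments
    (u := fun k => (∫⁻ x, p x * (killedMehler θ (Function.support p))^[k] p x ∂γ).toReal)
    (v := fun k => (∫⁻ x, q x * (killedMehler θ (Function.support q))^[k] q x ∂γ).toReal)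
    (fun k => ENNReal.toReal_nonneg) (fun k => ENNReal.toReal_nonneg)
    (hsq p hp hpM) (hsq q hq hqM) (r := ρ ^ 2)
    (S := (M * M * ENNReal.ofReal ((M / δ) ^ 2) *
      ∫⁻ x, ∫⁻ y, ENNReal.ofReal (‖x - y‖ ^ 2) ∂γ ∂γ).toReal) (by positivity) fun k => ?_
  · simpa only [hone, Function.iterate_zero, id] using key
  have hpk := measurable_killedMehler_iterate (θ := θ) hp k
  have hqk := measurable_killedMehler_iterate (θ := θ) hq k
  rw [← ENNReal.toReal_mul, ← ENNReal.toReal_ofReal (by positivity : 0 ≤ (ρ ^ 2) ^ k),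
    ← ENNReal.toReal_mul]
  refine ENNReal.toReal_mono (by finiteness) ?_
  calc _ = ∫⁻ x, ∫⁻ y, (p x * (killedMehler θ (Function.support p))^[k] p x) *
        (q y * (killedMehler θ (Function.support q))^[k] q y) ∂γ ∂γ := by
        rw [← lintegral_mul_const _ (by fun_prop)]
        refine lintegral_congr fun x => ?_
        rw [lintegral_const_mul _ (by fun_prop)]
    _ ≤ ∫⁻ x, ∫⁻ y, M * M * ENNReal.ofReal ((M / δ) ^ 2) * ENNReal.ofReal ((ρ ^ 2) ^ k) *
        ENNReal.ofReal (‖x - y‖ ^ 2) ∂γ ∂γ := by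
        refine lintegral_mono fun x => lintegral_mono fun y => ?_
        calc _ = (p x * q y) * ((killedMehler θ (Function.support p))^[k] p x *
              (killedMehler θ (Function.support q))^[k] q y) := by ring
          _ ≤ (M * M) * ENNReal.ofReal ((M / δ * ρ ^ k * ‖x - y‖) ^ 2) :=
            mul_le_mul' (mul_le_mul' (hpM x) (hqM y)) (killedMehler_iterate_mul_le hp hq
              (by positivity) hδ' hσ hδ hc hσδ hsep hρ hρ0.le k x y)
          _ = _ := by
            rw [mul_pow, mul_pow, ENNReal.ofReal_mul (by positivity),
              ENNReal.ofReal_mul (by positivity), ← pow_mul, mul_comm k, pow_mul]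
            ring
    _ = _ := by
        simp_rw [lintegral_const_mul' _ _ (show M * M * ENNReal.ofReal ((M / δ) ^ 2) *
          ENNReal.ofReal ((ρ ^ 2) ^ k) ≠ ∞ by finiteness)]
        ring

end Iteration

section GaussianInequality

open ProbabilityTheory

variable {N : ℕ}

/-- The discrete Dirichlet energy of `F` between correlated Gaussian vectors. -/
def corrEnergy (F : EuclideanSpace ℝ (Fin N) → ℝ) (θ : ℝ) : ℝ :=
  ∫ w : EuclideanSpace ℝ (Fin N) × EuclideanSpace ℝ (Fin N),
    (F (Real.cos θ • w.1 + Real.sin θ • w.2) - F w.1) ^ 2 ∂((stdGaussian _).prod (stdGaussian _))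

lemma toReal_lintegral_mul_mehler {p : EuclideanSpace ℝ (Fin N) → ℝ} (hp : Continuous p)
    (hp0 : ∀ x, 0 ≤ p x) {M : ℝ} (hpM : ∀ x, p x ≤ M) (θ : ℝ) :
    (∫⁻ x, ENNReal.ofReal (p x) * mehler (Real.cos θ) (Real.sin θ)
        (fun x => ENNReal.ofReal (p x)) x ∂(stdGaussian _)).toReal =
      (∫ x, p x ^ 2 ∂(stdGaussian _)) - corrEnergy p θ / 2 := by
  set γ := stdGaussian (EuclideanSpace ℝ (Fin N))
  set c := Real.cos θ
  set σ := Real.sin θ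
  have hpm := hp.measurable
  have hb : ∀ f g : EuclideanSpace ℝ (Fin N) × EuclideanSpace ℝ (Fin N) →
      EuclideanSpace ℝ (Fin N), Continuous f → Continuous g →
      Integrable (fun w => p (f w) * p (g w)) (γ.prod γ) := by
    intro f g hf hg
    refine Integrable.of_bound (by fun_prop) (M * M) (ae_of_all _ fun w => ?_)
    rw [Real.norm_of_nonneg (mul_nonneg (hp0 _) (hp0 _))]
    exact mul_le_mul (hpM _) (hpM _) (hp0 _) ((hp0 0).trans (hpM 0))
  have h1 : (∫⁻ x, ENNReal.ofReal (p x) * mehler c σ (fun x => ENNReal.ofReal (p x)) x ∂γ).toReal =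
      ∫ w, p w.1 * p (c • w.1 + σ • w.2) ∂(γ.prod γ) := by
    rw [integral_eq_lintegral_of_nonneg_ae (ae_of_all _ fun w => mul_nonneg (hp0 _) (hp0 _))
      (by fun_prop), lintegral_prod _ (by fun_prop)]
    congr 1
    refine lintegral_congr fun x => ?_
    rw [mehler, ← lintegral_const_mul _ (by fun_prop)]
    simp_rw [ENNReal.ofReal_mul (hp0 x)]
    rfl
  have h2 : ∫ w, p w.1 * p w.1 ∂(γ.prod γ) = ∫ x, p x ^ 2 ∂γ := by
    have := integral_prod_mul (μ := γ) (ν := γ) (fun x => p x ^ 2) (fun _ => (1 : ℝ))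
    simpa [sq] using this
  have h3 : ∫ w, p (c • w.1 + σ • w.2) * p (c • w.1 + σ • w.2) ∂(γ.prod γ) = ∫ x, p x ^ 2 ∂γ := by
    rw [← h2]
    have hmp := measurePreserving_gaussian_swap N θ
    rw [← hmp.map_eq, integral_map hmp.measurable.aemeasurable
      (Continuous.aestronglyMeasurable (by fun_prop)), hmp.map_eq]
    refine integral_congr_ae (ae_of_all _ fun w => ?_)
    have h : c • (c • w.1 + σ • w.2) + σ • (σ • w.1 - c • w.2) = w.1 := by
      have h1 : c * c + σ * σ = 1 := by
        simpa [c, σ, sq] using Real.cos_sq_add_sin_sq θ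
      calc _ = (c * c + σ * σ) • w.1 := by module
        _ = w.1 := by rw [h1, one_smul]
    exact congrArg (fun x => p x * p x) h
  have i1 : Integrable (fun w => p (c • w.1 + σ • w.2) * p (c • w.1 + σ • w.2)) (γ.prod γ) :=
    hb _ _ (by fun_prop : Continuous fun w : EuclideanSpace ℝ (Fin N) × EuclideanSpace ℝ (Fin N) =>
      c • w.1 + σ • w.2) (by fun_prop)
  have i2 : Integrable (fun w => p w.1 * p w.1) (γ.prod γ) := hb _ _ continuous_fst continuous_fst
  have i3 : Integrable (fun w => p w.1 * p (c • w.1 + σ • w.2)) (γ.prod γ) :=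
    hb _ _ continuous_fst (by fun_prop)
  have i12 : Integrable (fun w => p (c • w.1 + σ • w.2) * p (c • w.1 + σ • w.2) + p w.1 * p w.1)
    (γ.prod γ) := i1.add i2
  have h4 : corrEnergy p θ = (∫ w, p (c • w.1 + σ • w.2) * p (c • w.1 + σ • w.2) ∂(γ.prod γ)) +
      (∫ w, p w.1 * p w.1 ∂(γ.prod γ)) - 2 * ∫ w, p w.1 * p (c • w.1 + σ • w.2) ∂(γ.prod γ) := by
    rw [← integral_add i1 i2, ← integral_const_mul, ← integral_sub i12 (i3.const_mul 2)]
    refine integral_congr_ae (ae_of_all _ fun w => ?_)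
    simp only [c, σ]
    ring
  rw [h1, h4, h2, h3]
  ring

lemma toReal_lintegral_mul_self {p : EuclideanSpace ℝ (Fin N) → ℝ} (hp : Continuous p)
    (hp0 : ∀ x, 0 ≤ p x) :
    (∫⁻ x, ENNReal.ofReal (p x) * ENNReal.ofReal (p x) ∂(stdGaussian _)).toReal =
      ∫ x, p x ^ 2 ∂(stdGaussian _) := by
  rw [integral_eq_lintegral_of_nonneg_ae (ae_of_all _ fun w => sq_nonneg _) (by fun_prop)]
  simp_rw [sq, ENNReal.ofReal_mul (hp0 _)]

lemma corrEnergy_inequality {p q : EuclideanSpace ℝ (Fin N) → ℝ} (hp : Continuous p)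
    (hq : Continuous q) (hp0 : ∀ x, 0 ≤ p x) (hq0 : ∀ x, 0 ≤ q x) {M : ℝ}
    (hpM : ∀ x, p x ≤ M) (hqM : ∀ x, q x ≤ M)
    {θ δ ρ : ℝ} (hσ : 0 ≤ Real.sin θ) (hδ : 0 < δ) (hc : 1 / 2 ≤ Real.cos θ)
    (hσδ : 4 * Real.sin θ ≤ Real.cos θ * δ)
    (hsep : ∀ x y, p x ≠ 0 → q y ≠ 0 → δ ≤ ‖x - y‖)
    (hρ : Real.cos θ + 2048 * (∫ m, ‖m‖ ^ 4 ∂(stdGaussian (EuclideanSpace ℝ (Fin N)))) /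
        δ ^ 4 * Real.sin θ ^ 4 = ρ) (hρ0 : 0 < ρ) :
    (1 - ρ ^ 2) * ((∫ x, p x ^ 2 ∂(stdGaussian _)) * ∫ x, q x ^ 2 ∂(stdGaussian _)) ≤
      (corrEnergy p θ * (∫ x, q x ^ 2 ∂(stdGaussian _)) +
        corrEnergy q θ * (∫ x, p x ^ 2 ∂(stdGaussian _))) / 2 := by
  have hM : 0 ≤ M := (hp0 0).trans (hpM 0)
  have key := lintegral_mul_mehler_support_mul_le (p := fun x => ENNReal.ofReal (p x))
    (q := fun x => ENNReal.ofReal (q x)) (by fun_prop) (by fun_prop) (M := M.toNNReal)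
    (fun x => ENNReal.ofReal_le_ofReal (hpM x)) (fun x => ENNReal.ofReal_le_ofReal (hqM x))
    hσ hδ hc hσδ (fun x y hx hy => hsep x y (fun h => hx (by simp [h])) (fun h => hy (by simp [h])))
    hρ hρ0
  rw [toReal_lintegral_mul_mehler hp hp0 hpM, toReal_lintegral_mul_mehler hq hq0 hqM,
    toReal_lintegral_mul_self hp hp0, toReal_lintegral_mul_self hq hq0] at key
  have h1 : 0 ≤ corrEnergy p θ := integral_nonneg fun w => sq_nonneg _
  have h2 : 0 ≤ corrEnergy q θ := integral_nonneg fun w => sq_nonneg _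
  nlinarith [mul_nonneg h1 h2]

lemma integral_sq_strongDual_stdGaussian (L : StrongDual ℝ (EuclideanSpace ℝ (Fin N))) :
    ∫ z, L z ^ 2 ∂(stdGaussian _) = ‖L‖ ^ 2 := by
  rw [← variance_dual_stdGaussian L,
    variance_of_integral_eq_zero (by fun_prop) (integral_strongDual_stdGaussian L)]

lemma integrable_sq_norm_add_norm :
    Integrable (fun w : EuclideanSpace ℝ (Fin N) × EuclideanSpace ℝ (Fin N) =>
      (‖w.1‖ + ‖w.2‖) ^ 2) ((stdGaussian _).prod (stdGaussian _)) := by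
  set γ := stdGaussian (EuclideanSpace ℝ (Fin N))
  have h2 := integrable_norm_pow_stdGaussian N 2
  have h1 : Integrable (fun w : EuclideanSpace ℝ (Fin N) × EuclideanSpace ℝ (Fin N) =>
      2 * (‖w.1‖ ^ 2 + ‖w.2‖ ^ 2)) (γ.prod γ) :=
    ((h2.comp_fst γ).add (h2.comp_snd γ)).const_mul 2
  refine h1.mono' (by fun_prop) (ae_of_all _ fun w => ?_)
  rw [Real.norm_of_nonneg (by positivity)]
  nlinarith [sq_nonneg (‖w.1‖ - ‖w.2‖)]

lemma norm_rotate_sub_le (θ : ℝ) (x z : EuclideanSpace ℝ (Fin N)) :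
    ‖Real.cos θ • x + Real.sin θ • z - x‖ ≤ |θ| * (‖x‖ + ‖z‖) := by
  have h1 : |Real.cos θ - 1| ≤ |θ| := by
    rw [abs_sub_comm, abs_of_nonneg (by linarith [Real.cos_le_one θ])]
    rcases le_total |θ| 2 with h | h
    · nlinarith [Real.one_sub_sq_div_two_le_cos (x := θ), sq_abs θ, abs_nonneg θ]
    · linarith [Real.neg_one_le_cos θ]
  have h2 : |Real.sin θ| ≤ |θ| := Real.abs_sin_le_abs
  calc _ = ‖(Real.cos θ - 1) • x + Real.sin θ • z‖ := by congr 1; module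
    _ ≤ |Real.cos θ - 1| * ‖x‖ + |Real.sin θ| * ‖z‖ := by
      refine (norm_add_le _ _).trans ?_
      rw [norm_smul, norm_smul, Real.norm_eq_abs, Real.norm_eq_abs]
    _ ≤ _ := by rw [mul_add]; gcongr

lemma tendsto_corrEnergy_div {F : EuclideanSpace ℝ (Fin N) → ℝ} {K : ℝ≥0}
    (hF : LipschitzWith K F) :
    Tendsto (fun θ => corrEnergy F θ / θ ^ 2) (𝓝[>] 0)
      (𝓝 (∫ x, ‖fderiv ℝ F x‖ ^ 2 ∂(stdGaussian _))) := by
  set γ := stdGaussian (EuclideanSpace ℝ (Fin N))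
  have hd : ∀ᵐ x ∂γ, DifferentiableAt ℝ F x :=
    (stdGaussian_absolutelyContinuous N).ae_le hF.ae_differentiableAt
  have hd2 : ∀ᵐ w ∂(γ.prod γ), DifferentiableAt ℝ F w.1 :=
    Measure.quasiMeasurePreserving_fst.ae hd
  have hmeas : Measurable (fderiv ℝ F) := measurable_fderiv ℝ F
  have hlim : ∫ x, ‖fderiv ℝ F x‖ ^ 2 ∂γ = ∫ w, (fderiv ℝ F w.1 w.2) ^ 2 ∂(γ.prod γ) := by
    rw [integral_prod]
    · exact integral_congr_ae (ae_of_all _ fun x => (integral_sq_strongDual_stdGaussian _).symm)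
    · have hm : Measurable fun w : EuclideanSpace ℝ (Fin N) × EuclideanSpace ℝ (Fin N) =>
          fderiv ℝ F w.1 w.2 :=
        isBoundedBilinearMap_apply.continuous.measurable.comp
          ((hmeas.comp measurable_fst).prodMk measurable_snd)
      refine (integrable_sq_norm_add_norm.const_mul ((K : ℝ) ^ 2)).mono'
        (hm.pow_const 2).aestronglyMeasurable (ae_of_all _ fun w => ?_)
      rw [norm_pow, ← mul_pow]
      gcongr
      calc _ ≤ ‖fderiv ℝ F w.1‖ * ‖w.2‖ := ContinuousLinearMap.le_opNorm _ _
        _ ≤ K * (‖w.1‖ + ‖w.2‖) := by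
          gcongr
          · exact norm_fderiv_le_of_lipschitz ℝ hF
          · simp
  rw [hlim]
  have heq : ∀ θ, corrEnergy F θ / θ ^ 2 =
      ∫ w : EuclideanSpace ℝ (Fin N) × EuclideanSpace ℝ (Fin N),
        ((F (Real.cos θ • w.1 + Real.sin θ • w.2) - F w.1) / θ) ^ 2 ∂(γ.prod γ) := by
    intro θ
    simp_rw [div_pow, integral_div]
    rfl
  simp_rw [heq]
  have hFc := hF.continuous
  refine tendsto_integral_filter_of_dominated_convergence
    (fun w => (K : ℝ) ^ 2 * (‖w.1‖ + ‖w.2‖) ^ 2) (Eventually.of_forall fun θ => by fun_prop)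
    ?_ (integrable_sq_norm_add_norm.const_mul _) ?_
  · filter_upwards [self_mem_nhdsWithin] with θ hθ
    have hθ : 0 < θ := hθ
    refine ae_of_all _ fun w => ?_
    rw [norm_pow, ← mul_pow]
    gcongr
    rw [norm_div, Real.norm_of_nonneg hθ.le, div_le_iff₀ hθ, ← dist_eq_norm]
    refine (hF.dist_le_mul _ _).trans ?_
    rw [mul_assoc]
    gcongr
    rw [dist_eq_norm]
    refine (norm_rotate_sub_le θ w.1 w.2).trans (le_of_eq ?_)
    rw [abs_of_pos hθ, mul_comm]
  · filter_upwards [hd2] with w hw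
    have h1 : HasDerivAt (fun θ : ℝ => Real.cos θ • w.1 + Real.sin θ • w.2) w.2 0 := by
      simpa using ((Real.hasDerivAt_cos 0).smul_const w.1).fun_add
        ((Real.hasDerivAt_sin 0).smul_const w.2)
    have h2 : HasDerivAt (fun θ : ℝ => F (Real.cos θ • w.1 + Real.sin θ • w.2))
        (fderiv ℝ F w.1 w.2) 0 := by
      have : HasFDerivAt F (fderiv ℝ F w.1) (Real.cos 0 • w.1 + Real.sin 0 • w.2) := by
        simpa using hw.hasFDerivAt
      exact this.comp_hasDerivAt 0 h1
    have h3 := (hasDerivAt_iff_tendsto_slope_zero.1 h2).mono_left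
      (nhdsWithin_mono (0 : ℝ) (show Ioi (0 : ℝ) ⊆ {0}ᶜ from fun x hx => ne_of_gt hx))
    refine (h3.pow 2).congr fun θ => ?_
    simp [div_eq_inv_mul]

lemma tendsto_one_sub_sq_div (K : ℝ) :
    Tendsto (fun θ : ℝ => (1 - (Real.cos θ + K * Real.sin θ ^ 4) ^ 2) / θ ^ 2) (𝓝[>] 0) (𝓝 1) := by
  have h1 : Tendsto (fun θ : ℝ => Real.sin θ / θ) (𝓝[>] 0) (𝓝 1) := by
    have := (hasDerivAt_iff_tendsto_slope_zero.1 (Real.hasDerivAt_sin 0)).mono_left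
      (nhdsWithin_mono (0 : ℝ) (show Ioi (0 : ℝ) ⊆ {0}ᶜ from fun x hx => ne_of_gt hx))
    simpa [div_eq_inv_mul] using this
  have h2 : Tendsto (fun θ : ℝ => 1 - 2 * K * Real.cos θ * Real.sin θ ^ 2 - K ^ 2 * Real.sin θ ^ 6)
      (𝓝[>] 0) (𝓝 1) := by
    have : Continuous fun θ : ℝ =>
      1 - 2 * K * Real.cos θ * Real.sin θ ^ 2 - K ^ 2 * Real.sin θ ^ 6 := by fun_prop
    simpa using (this.tendsto 0).mono_left nhdsWithin_le_nhds
  have h3 := (h1.pow 2).mul h2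
  simp only [one_pow, mul_one] at h3
  refine h3.congr fun θ => ?_
  rw [div_pow, div_mul_eq_mul_div]
  congr 1
  have := Real.sin_sq_add_cos_sq θ
  have h : Real.cos θ ^ 2 = 1 - Real.sin θ ^ 2 := by linarith
  ring_nf
  rw [h]
  ring

lemma integrable_sq_stdGaussian_of_lipschitz {F : EuclideanSpace ℝ (Fin N) → ℝ} {K : ℝ≥0}
    (hF : LipschitzWith K F) : Integrable (fun x => F x ^ 2) (stdGaussian _) := by
  have h2 := integrable_norm_pow_stdGaussian N 2
  refine ((((integrable_const (2 * |F 0| ^ 2)).add (h2.const_mul (2 * (K : ℝ) ^ 2)))).mono'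
    (hF.continuous.pow 2).aestronglyMeasurable (ae_of_all _ fun x => ?_))
  have h := hF.dist_le_mul x 0
  rw [Real.dist_eq, dist_zero_right] at h
  have h' : |F x| ≤ |F 0| + K * ‖x‖ := by
    have := abs_sub_abs_le_abs_sub (F x) (F 0); linarith
  rw [norm_pow, Real.norm_eq_abs]
  simp only [Pi.add_apply]
  nlinarith [abs_nonneg (F x), sq_nonneg (|F 0| - K * ‖x‖), abs_nonneg (F 0),
    mul_nonneg K.2 (norm_nonneg x)]

lemma corrEnergy_comp_le {F : EuclideanSpace ℝ (Fin N) → ℝ} {K : ℝ≥0} (hF : LipschitzWith K F)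
    {T : ℝ → ℝ} (hT : LipschitzWith 1 T) (θ : ℝ) :
    corrEnergy (fun x => T (F x)) θ ≤ corrEnergy F θ := by
  have hFc := hF.continuous
  have hTc := hT.continuous
  have hle : ∀ w : EuclideanSpace ℝ (Fin N) × EuclideanSpace ℝ (Fin N),
      (T (F (Real.cos θ • w.1 + Real.sin θ • w.2)) - T (F w.1)) ^ 2 ≤
        (F (Real.cos θ • w.1 + Real.sin θ • w.2) - F w.1) ^ 2 := fun w => by
    have := hT.dist_le_mul (F (Real.cos θ • w.1 + Real.sin θ • w.2)) (F w.1)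
    rw [Real.dist_eq, Real.dist_eq, NNReal.coe_one, one_mul] at this
    exact sq_le_sq.2 this
  have hint : Integrable (fun w : EuclideanSpace ℝ (Fin N) × EuclideanSpace ℝ (Fin N) =>
      (F (Real.cos θ • w.1 + Real.sin θ • w.2) - F w.1) ^ 2)
      ((stdGaussian _).prod (stdGaussian _)) := by
    refine (integrable_sq_norm_add_norm.const_mul ((K * |θ|) ^ 2)).mono' (by fun_prop)
      (ae_of_all _ fun w => ?_)
    rw [norm_pow, ← mul_pow, ← dist_eq_norm]
    gcongr
    refine (hF.dist_le_mul _ _).trans ?_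
    rw [mul_assoc]
    gcongr
    rw [dist_eq_norm]
    exact norm_rotate_sub_le θ w.1 w.2
  exact integral_mono_of_nonneg (ae_of_all _ fun w => sq_nonneg _) hint (ae_of_all _ hle)

lemma gaussian_two_function_inequality_trunc {F G : EuclideanSpace ℝ (Fin N) → ℝ} {K L : ℝ≥0}
    (hF : LipschitzWith K F) (hG : LipschitzWith L G) (hF0 : ∀ x, 0 ≤ F x)
    (hFG : ∀ x, F x * G x = 0) {ε M : ℝ} (hε : 0 < ε) (hM : 0 ≤ M) :
    2 * ((∫ x, (min (max (F x - ε) 0) M) ^ 2 ∂(stdGaussian _)) *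
        ∫ x, (min (max (G x - ε) 0) M) ^ 2 ∂(stdGaussian _)) ≤
      (∫ x, ‖fderiv ℝ F x‖ ^ 2 ∂(stdGaussian _)) *
          (∫ x, (min (max (G x - ε) 0) M) ^ 2 ∂(stdGaussian _)) +
        (∫ x, ‖fderiv ℝ G x‖ ^ 2 ∂(stdGaussian _)) *
          (∫ x, (min (max (F x - ε) 0) M) ^ 2 ∂(stdGaussian _)) := by
  set γ := stdGaussian (EuclideanSpace ℝ (Fin N))
  set T : ℝ → ℝ := fun s => min (max (s - ε) 0) M with hTdef
  have hT : LipschitzWith 1 T := by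
    have : LipschitzWith 1 fun s : ℝ => s - ε := LipschitzWith.of_dist_le_mul fun x y => by simp
    exact (this.max_const 0).min_const M
  have hT0 : ∀ s, 0 ≤ T s := fun s => le_min (le_max_right _ _) hM
  have hTM : ∀ s, T s ≤ M := fun s => min_le_right _ _
  have hTs : ∀ s, T s ≠ 0 → ε < s := by
    intro s hs
    by_contra! h
    exact hs (by simp [hTdef, max_eq_right (sub_nonpos.2 h), hM])
  set A := ∫ x, (T (F x)) ^ 2 ∂γ
  set B := ∫ x, (T (G x)) ^ 2 ∂γ
  have hA : 0 ≤ A := integral_nonneg fun x => sq_nonneg _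
  have hB : 0 ≤ B := integral_nonneg fun x => sq_nonneg _
  set δ : ℝ := ε / (K + 1) with hδdef
  have hδ : 0 < δ := by positivity
  set k := 2048 * (∫ m, ‖m‖ ^ 4 ∂γ) / δ ^ 4 with hk
  have hk0 : 0 ≤ k := by
    have : 0 ≤ ∫ m, ‖m‖ ^ 4 ∂γ := integral_nonneg fun m => by positivity
    positivity
  have hsep : ∀ x y, T (F x) ≠ 0 → T (G y) ≠ 0 → δ ≤ ‖x - y‖ := by
    intro x y hx hy
    have h1 := hTs _ hx
    have h2 := hTs _ hy
    have h3 : F y = 0 := by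
      rcases mul_eq_zero.1 (hFG y) with h | h
      · exact h
      · linarith
    have h4 := hF.dist_le_mul x y
    rw [Real.dist_eq, h3, sub_zero, abs_of_nonneg (hF0 x), dist_eq_norm] at h4
    rw [hδdef, div_le_iff₀ (by positivity)]
    nlinarith [norm_nonneg (x - y)]
  have hev : ∀ᶠ θ in 𝓝[>] (0 : ℝ),
      (1 - (Real.cos θ + k * Real.sin θ ^ 4) ^ 2) / θ ^ 2 * (A * B) ≤
        (corrEnergy F θ / θ ^ 2 * B + corrEnergy G θ / θ ^ 2 * A) / 2 := by
    have hcos : ∀ᶠ θ in 𝓝[>] (0 : ℝ), 1 / 2 ≤ Real.cos θ := by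
      refine nhdsWithin_le_nhds (Real.continuous_cos.continuousAt.eventually ?_)
      exact Ici_mem_nhds (by rw [Real.cos_zero]; norm_num)
    have hsin : ∀ᶠ θ in 𝓝[>] (0 : ℝ), Real.sin θ ≤ δ / 8 := by
      have h8 : ∀ᶠ y in 𝓝 (0 : ℝ), y ≤ δ / 8 := Iic_mem_nhds (by positivity)
      exact nhdsWithin_le_nhds ((Real.continuous_sin.tendsto' 0 0 Real.sin_zero).eventually h8)
    have hpi : ∀ᶠ θ in 𝓝[>] (0 : ℝ), θ < Real.pi :=
      nhdsWithin_le_nhds (Iio_mem_nhds Real.pi_pos)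
    filter_upwards [hcos, hsin, hpi, self_mem_nhdsWithin] with θ h1 h2 h3 h4
    have h4 : 0 < θ := h4
    have hs : 0 ≤ Real.sin θ := (Real.sin_pos_of_pos_of_lt_pi h4 h3).le
    have := corrEnergy_inequality (p := fun x => T (F x)) (q := fun x => T (G x))
      (hT.continuous.comp hF.continuous) (hT.continuous.comp hG.continuous)
      (fun x => hT0 _) (fun x => hT0 _) (fun x => hTM _) (fun x => hTM _) hs hδ h1
      (by nlinarith) hsep rfl (by rw [← hk]; positivity)
    rw [← hk] at this
    have h5 := mul_le_mul_of_nonneg_right (corrEnergy_comp_le hF hT θ) hB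
    have h6 := mul_le_mul_of_nonneg_right (corrEnergy_comp_le hG hT θ) hA
    clear_value k
    have e1 : (corrEnergy F θ / θ ^ 2 * B + corrEnergy G θ / θ ^ 2 * A) / 2 =
        (corrEnergy F θ * B + corrEnergy G θ * A) / 2 / θ ^ 2 := by ring
    rw [div_mul_eq_mul_div, e1]
    exact div_le_div_of_nonneg_right (by linarith) (sq_nonneg θ)
  have hlim := le_of_tendsto_of_tendsto ((tendsto_one_sub_sq_div k).mul_const (A * B))
    ((((tendsto_corrEnergy_div hF).mul_const B).add
      ((tendsto_corrEnergy_div hG).mul_const A)).div_const 2) hev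
  linarith

/-- Two nonnegative Lipschitz functions with disjoint supports have Gaussian Rayleigh quotients
summing to at least `2`. -/
theorem gaussian_two_function_inequality {F G : EuclideanSpace ℝ (Fin N) → ℝ} {K L : ℝ≥0}
    (hF : LipschitzWith K F) (hG : LipschitzWith L G) (hF0 : ∀ x, 0 ≤ F x) (hG0 : ∀ x, 0 ≤ G x)
    (hFG : ∀ x, F x * G x = 0) :
    2 * ((∫ x, F x ^ 2 ∂(stdGaussian _)) * ∫ x, G x ^ 2 ∂(stdGaussian _)) ≤
      (∫ x, ‖fderiv ℝ F x‖ ^ 2 ∂(stdGaussian _)) * (∫ x, G x ^ 2 ∂(stdGaussian _)) +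
        (∫ x, ‖fderiv ℝ G x‖ ^ 2 ∂(stdGaussian _)) * ∫ x, F x ^ 2 ∂(stdGaussian _) := by
  have hlim : ∀ {H : EuclideanSpace ℝ (Fin N) → ℝ} {J : ℝ≥0}, LipschitzWith J H →
      (∀ x, 0 ≤ H x) → Tendsto (fun n : ℕ =>
        ∫ x, (min (max (H x - 1 / ((n : ℝ) + 1)) 0) n) ^ 2 ∂(stdGaussian _)) atTop
        (𝓝 (∫ x, H x ^ 2 ∂(stdGaussian _))) := by
    intro H J hH hH0
    have hHc := hH.continuous
    refine tendsto_integral_of_dominated_convergence (fun x => H x ^ 2)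
      (fun n => Continuous.aestronglyMeasurable (by fun_prop))
      (integrable_sq_stdGaussian_of_lipschitz hH) (fun n => ae_of_all _ fun x => ?_)
      (ae_of_all _ fun x => ?_)
    · rw [Real.norm_of_nonneg (sq_nonneg _)]
      have h0 : 0 ≤ min (max (H x - 1 / ((n : ℝ) + 1)) 0) n :=
        le_min (le_max_right _ _) (Nat.cast_nonneg n)
      gcongr
      refine (min_le_left _ _).trans (max_le ?_ (hH0 x))
      have : 0 ≤ 1 / ((n : ℝ) + 1) := by positivity
      linarith
    · refine Tendsto.pow ?_ 2
      have h1 : Tendsto (fun n : ℕ => max (H x - 1 / ((n : ℝ) + 1)) 0) atTop (𝓝 (H x)) := by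
        have := ((tendsto_const_nhds (x := H x)).sub
          (tendsto_one_div_add_atTop_nhds_zero_nat (𝕜 := ℝ))).max (tendsto_const_nhds (x := 0))
        simpa [hH0 x] using this
      refine h1.congr' ?_
      filter_upwards [eventually_ge_atTop ⌈H x⌉₊] with n hn
      rw [min_eq_left]
      have h2 : H x ≤ n := Nat.ceil_le.1 hn
      have : 0 ≤ 1 / ((n : ℝ) + 1) := by positivity
      exact max_le (by linarith) (Nat.cast_nonneg n)
  exact le_of_tendsto_of_tendsto' (((hlim hF hF0).mul (hlim hG hG0)).const_mul 2)
    (((hlim hG hG0).const_mul _).add ((hlim hF hF0).const_mul _)) fun n =>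
      gaussian_two_function_inequality_trunc hF hG hF0 hFG (by positivity) (Nat.cast_nonneg n)

end GaussianInequality

section Polar

variable {N : ℕ}

/-- The surface measure on the unit sphere. -/
abbrev surfMeasure (N : ℕ) : Measure (sphere (0 : EuclideanSpace ℝ (Fin N)) 1) :=
  (volume : Measure (EuclideanSpace ℝ (Fin N))).toSphere

/-- The measure `s ^ (N - 1) ds` on the positive half line. -/
def radialMeasure (N : ℕ) : Measure ℝ :=
  (volume.restrict (Ioi (0 : ℝ))).withDensity fun s => ENNReal.ofReal (s ^ (N - 1))

instance : SigmaFinite (radialMeasure N) := by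
  unfold radialMeasure
  exact SigmaFinite.withDensity_ofReal _

lemma radialMeasure_ae_pos : ∀ᵐ s ∂(radialMeasure N), 0 < s :=
  (withDensity_absolutelyContinuous _ _).ae_le (ae_restrict_mem measurableSet_Ioi)

lemma map_volumeIoiPow (N : ℕ) :
    (Measure.volumeIoiPow (N - 1)).map ((↑) : Ioi (0 : ℝ) → ℝ) = radialMeasure N := by
  refine Measure.ext fun s hs => ?_
  rw [Measure.map_apply measurable_subtype_coe hs, Measure.volumeIoiPow,
    withDensity_apply _ (measurable_subtype_coe hs), radialMeasure, withDensity_apply _ hs,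
    setLIntegral_subtype measurableSet_Ioi _ fun a : ℝ => ENNReal.ofReal (a ^ (N - 1)),
    Subtype.image_preimage_coe, Measure.restrict_restrict hs, inter_comm]

lemma measurePreserving_polar (hN : 1 ≤ N) :
    MeasurePreserving
      (fun p : sphere (0 : EuclideanSpace ℝ (Fin N)) 1 × ℝ =>
        p.2 • (p.1 : EuclideanSpace ℝ (Fin N)))
      ((surfMeasure N).prod (radialMeasure N)) volume := by
  have : Nonempty (Fin N) := ⟨⟨0, hN⟩⟩
  have h1 : MeasurePreserving
      ((↑) : ({0}ᶜ : Set (EuclideanSpace ℝ (Fin N))) → EuclideanSpace ℝ (Fin N))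
      (volume.comap ((↑) : ({0}ᶜ : Set (EuclideanSpace ℝ (Fin N))) → EuclideanSpace ℝ (Fin N)))
      volume := by
    refine ⟨measurable_subtype_coe, ?_⟩
    rw [map_comap_subtype_coe (measurableSet_singleton _).compl]
    exact Measure.restrict_eq_self_of_ae_mem (by simp [ae_iff, measure_singleton])
  have h2 := (volume : Measure
    (EuclideanSpace ℝ (Fin N))).measurePreserving_homeomorphUnitSphereProd
  rw [finrank_euclideanSpace_fin] at h2
  have h3 : MeasurePreserving (Homeomorph.toMeasurableEquiv
      (homeomorphUnitSphereProd (EuclideanSpace ℝ (Fin N)))) _ _ := h2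
  have h4 := h1.comp (h3.symm _)
  have h5 : MeasurePreserving (Prod.map id ((↑) : Ioi (0 : ℝ) → ℝ))
      ((surfMeasure N).prod (Measure.volumeIoiPow (N - 1)))
      ((surfMeasure N).prod (radialMeasure N)) :=
    (MeasurePreserving.id _).prod ⟨measurable_subtype_coe, map_volumeIoiPow N⟩
  refine ⟨by fun_prop, ?_⟩
  rw [← h5.map_eq, Measure.map_map (by fun_prop) h5.measurable, ← h4.map_eq]
  rfl

lemma integral_polar (hN : 1 ≤ N) {g : EuclideanSpace ℝ (Fin N) → ℝ} (hg : Measurable g) :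
    ∫ x, g x = ∫ p, g (p.2 • (p.1 : EuclideanSpace ℝ (Fin N)))
      ∂((surfMeasure N).prod (radialMeasure N)) := by
  have h := measurePreserving_polar hN
  nth_rewrite 1 [← h.map_eq]
  exact integral_map h.measurable.aemeasurable hg.aestronglyMeasurable

lemma integral_radialMeasure (g : ℝ → ℝ) :
    ∫ s, g s ∂(radialMeasure N) = ∫ s in Ioi (0 : ℝ), s ^ (N - 1) * g s := by
  rw [radialMeasure, integral_withDensity_eq_integral_toReal_smul (by fun_prop) (by simp)]
  refine setIntegral_congr_fun measurableSet_Ioi fun s hs => ?_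
  have : (0 : ℝ) ≤ s ^ (N - 1) := pow_nonneg (le_of_lt hs) _
  simp [ENNReal.toReal_ofReal this]

lemma integrable_radialMeasure_iff (g : ℝ → ℝ) :
    Integrable g (radialMeasure N) ↔ IntegrableOn (fun s => s ^ (N - 1) * g s) (Ioi (0 : ℝ)) := by
  rw [radialMeasure, integrable_withDensity_iff_integrable_smul' (by fun_prop) (by simp)]
  refine integrable_congr ?_
  filter_upwards [ae_restrict_mem measurableSet_Ioi] with s hs
  have : (0 : ℝ) ≤ s ^ (N - 1) := pow_nonneg (le_of_lt hs) _
  simp [ENNReal.toReal_ofReal this]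

end Polar

section Cone

variable {E : Type*} [NormedAddCommGroup E] [InnerProductSpace ℝ E]

/-- The function with radial profile `η` and angular profile `u` on the sphere of radius `r`. -/
def coneExt (η : ℝ → ℝ) (u : E → ℝ) (r : ℝ)
    (x : E) : ℝ :=
  η ‖x‖ * u ((r * ‖x‖⁻¹) • x)

lemma coneExt_smul (η : ℝ → ℝ) (u : E → ℝ) (r : ℝ)
    {θ : E} (hθ : ‖θ‖ = 1) {s : ℝ} (hs : 0 < s) :
    coneExt η u r (s • θ) = η s * u (r • θ) := by
  rw [coneExt, norm_smul, hθ, mul_one, Real.norm_of_nonneg hs.le, smul_smul]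
  congr 3
  field_simp

lemma norm_smul_inv_norm_sub_le (x y : E) :
    ‖y‖ * ‖‖x‖⁻¹ • x - ‖y‖⁻¹ • y‖ ≤ 2 * ‖x - y‖ := by
  rcases eq_or_ne y 0 with rfl | hy
  · simp
  rcases eq_or_ne x 0 with rfl | hx
  · have : ‖y‖ ≠ 0 := norm_ne_zero_iff.2 hy
    simp only [inv_zero, norm_zero, zero_smul, zero_sub, norm_neg, norm_smul, norm_inv, norm_norm]
    rw [inv_mul_cancel₀ this, mul_one]
    linarith [norm_nonneg y]
  have hx' : ‖x‖ ≠ 0 := norm_ne_zero_iff.2 hx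
  have hy' : ‖y‖ ≠ 0 := norm_ne_zero_iff.2 hy
  have e : ‖y‖ • (‖x‖⁻¹ • x - ‖y‖⁻¹ • y) = ((‖y‖ - ‖x‖) * ‖x‖⁻¹) • x + (x - y) := by
    rw [smul_sub, smul_smul, smul_smul, mul_inv_cancel₀ hy', sub_mul, mul_inv_cancel₀ hx',
      sub_smul]
    module
  calc ‖y‖ * ‖‖x‖⁻¹ • x - ‖y‖⁻¹ • y‖ = ‖((‖y‖ - ‖x‖) * ‖x‖⁻¹) • x + (x - y)‖ := by
        rw [← e, norm_smul, norm_norm]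
    _ ≤ |‖y‖ - ‖x‖| + ‖x - y‖ := by
        refine (norm_add_le _ _).trans (le_of_eq ?_)
        rw [norm_smul, norm_mul, norm_inv, norm_norm, mul_assoc, inv_mul_cancel₀ hx', mul_one,
          Real.norm_eq_abs]
    _ ≤ ‖x - y‖ + ‖x - y‖ := by
        gcongr
        rw [abs_sub_comm]
        exact abs_norm_sub_norm_le x y
    _ = _ := by ring

lemma exists_lipschitzWith_coneExt {η : ℝ → ℝ} {C : ℝ≥0} (hη : LipschitzWith C η) (hη0 : η 0 = 0)
    {u : E → ℝ} {K : ℝ≥0} (hu : LipschitzWith K u) (r : ℝ) :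
    ∃ L : ℝ≥0, LipschitzWith L (coneExt η u r) := by
  have hub : ∀ x : E, |u ((r * ‖x‖⁻¹) • x)| ≤ |u 0| + K * |r| := by
    intro x
    have h := hu.dist_le_mul ((r * ‖x‖⁻¹) • x) 0
    rw [Real.dist_eq, dist_zero_right, norm_smul, norm_mul, norm_inv, norm_norm] at h
    have h1 : ‖r‖ * ‖x‖⁻¹ * ‖x‖ ≤ |r| := by
      rcases eq_or_ne ‖x‖ 0 with h0 | h0
      · simp [h0]
      · rw [mul_assoc, inv_mul_cancel₀ h0, mul_one, Real.norm_eq_abs]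
    have h2 := abs_sub_abs_le_abs_sub (u ((r * ‖x‖⁻¹) • x)) (u 0)
    have h3 : (K : ℝ) * (‖r‖ * ‖x‖⁻¹ * ‖x‖) ≤ K * |r| := mul_le_mul_of_nonneg_left h1 K.2
    linarith
  refine ⟨C * (‖u 0‖₊ + K * ‖r‖₊) + C * (K * (‖r‖₊ * 2)),
    LipschitzWith.of_dist_le_mul fun x y => ?_⟩
  have hηy : |η ‖y‖| ≤ C * ‖y‖ := by
    have h := hη.dist_le_mul ‖y‖ 0
    rwa [Real.dist_eq, hη0, sub_zero, dist_zero_right, norm_norm] at h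
  have e : coneExt η u r x - coneExt η u r y =
      (η ‖x‖ - η ‖y‖) * u ((r * ‖x‖⁻¹) • x) +
        η ‖y‖ * (u ((r * ‖x‖⁻¹) • x) - u ((r * ‖y‖⁻¹) • y)) := by
    rw [coneExt, coneExt]; ring
  have h1 : |η ‖x‖ - η ‖y‖| ≤ C * ‖x - y‖ := by
    rw [← Real.dist_eq]
    refine (hη.dist_le_mul _ _).trans ?_
    gcongr
    exact abs_norm_sub_norm_le x y
  have h2 : |η ‖y‖| * |u ((r * ‖x‖⁻¹) • x) - u ((r * ‖y‖⁻¹) • y)| ≤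
      C * (K * (|r| * (2 * ‖x - y‖))) := by
    calc _ ≤ (C * ‖y‖) * (K * (|r| * ‖‖x‖⁻¹ • x - ‖y‖⁻¹ • y‖)) := by
          gcongr
          rw [← Real.dist_eq]
          refine (hu.dist_le_mul _ _).trans ?_
          rw [dist_eq_norm, mul_smul, mul_smul, ← smul_sub, norm_smul, Real.norm_eq_abs]
      _ = C * (K * (|r| * (‖y‖ * ‖‖x‖⁻¹ • x - ‖y‖⁻¹ • y‖))) := by ring
      _ ≤ _ := by
          have := norm_smul_inv_norm_sub_le x y
          gcongr
  rw [Real.dist_eq, e, dist_eq_norm]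
  refine (abs_add_le _ _).trans ?_
  rw [abs_mul, abs_mul]
  have h3 := mul_le_mul h1 (hub x) (abs_nonneg _) (by positivity)
  push_cast
  rw [Real.norm_eq_abs, Real.norm_eq_abs]
  linarith

lemma hasFDerivAt_norm_smul_unit {E : Type*} [NormedAddCommGroup E] [InnerProductSpace ℝ E]
    {θ : E} (hθ : ‖θ‖ = 1) {s : ℝ} (hs : 0 < s) :
    HasFDerivAt (fun x : E => ‖x‖) (innerSL ℝ θ) (s • θ) := by
  have hnx : ‖s • θ‖ = s := by rw [norm_smul, hθ, mul_one, Real.norm_of_nonneg hs.le]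
  have h1 : HasFDerivAt (fun x : E => ‖x‖ ^ 2) _ (s • θ) :=
    (hasStrictFDerivAt_norm_sq (s • θ)).hasFDerivAt
  have h2 := h1.sqrt (by rw [hnx]; positivity)
  simp only [Real.sqrt_sq (norm_nonneg _), hnx] at h2
  refine h2.congr_fderiv ?_
  ext v
  rw [Real.sqrt_sq hs.le]
  simp
  field_simp

lemma sq_norm_fderiv_coneExt [CompleteSpace E] {η : ℝ → ℝ} {u : E → ℝ} {r s e : ℝ}
    {θ : E} (hθ : ‖θ‖ = 1) (hs : 0 < s) (hη : HasDerivAt η e s)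
    (hu : DifferentiableAt ℝ u (r • θ)) :
    ‖fderiv ℝ (coneExt η u r) (s • θ)‖ ^ 2 = e ^ 2 * u (r • θ) ^ 2 +
      (η s / s) ^ 2 * (r ^ 2 * (‖gradient u (r • θ)‖ ^ 2 - ⟪gradient u (r • θ), θ⟫ ^ 2)) := by
  set D := gradient u (r • θ)
  have hx : s • θ ≠ 0 := by
    rw [smul_ne_zero_iff]
    exact ⟨hs.ne', fun h => by simp [h] at hθ⟩
  have hnx : ‖s • θ‖ = s := by rw [norm_smul, hθ, mul_one, Real.norm_of_nonneg hs.le]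
  have hnorm := hasFDerivAt_norm_smul_unit hθ hs
  have hr : HasFDerivAt (fun x : E => r * ‖x‖⁻¹)
      ((-(r / s ^ 2)) • innerSL ℝ θ) (s • θ) := by
    have h1 := (hasDerivAt_inv (x := ‖s • θ‖) (by rw [hnx]; exact hs.ne')).comp_hasFDerivAt
      (s • θ) hnorm
    refine (h1.const_mul r).congr_fderiv ?_
    ext v
    simp [hnx]
    ring
  have hdir := hr.smul (hasFDerivAt_id (s • θ))
  have hpt : (r * ‖s • θ‖⁻¹) • (s • θ) = r • θ := by
    rw [hnx, smul_smul]; congr 1; field_simp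
  have hu' : HasFDerivAt u (InnerProductSpace.toDual ℝ _ D) ((r * ‖s • θ‖⁻¹) • id (s • θ)) := by
    rw [id, hpt]
    exact hu.hasGradientAt.hasFDerivAt
  have hη' : HasDerivAt η e ‖s • θ‖ := by rwa [hnx]
  have hF := (hη'.comp_hasFDerivAt (s • θ) hnorm).mul
    (HasFDerivAt.comp (g := u) (f := fun x : E => (r * ‖x‖⁻¹) • id x) (s • θ) hu' hdir)
  have hgrad : fderiv ℝ (coneExt η u r) (s • θ) = InnerProductSpace.toDual ℝ _
      ((e * u (r • θ)) • θ + (η s * (r / s)) • (D - ⟪D, θ⟫ • θ)) := by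
    refine HasFDerivAt.fderiv (hF.congr_fderiv ?_)
    rw [hnx] at hpt
    ext v
    simp only [Function.comp_apply, id, hnx, hpt]
    simp [inner_smul_right]
    field_simp
    ring
  rw [hgrad, LinearIsometryEquiv.norm_map, ← real_inner_self_eq_norm_sq,
    ← real_inner_self_eq_norm_sq]
  have hθ2 : ⟪θ, θ⟫ = 1 := by rw [real_inner_self_eq_norm_sq, hθ]; norm_num
  simp only [inner_add_left, inner_sub_left, inner_smul_left, inner_smul_right,
      inner_add_right, inner_sub_right, hθ2, real_inner_comm D θ]
  simp
  field_simp
  ring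

end Cone

section Spherical

open ProbabilityTheory

variable {N : ℕ}

lemma measurable_gradient (u : EuclideanSpace ℝ (Fin N) → ℝ) : Measurable (gradient u) := by
  have h : gradient u = fun x => (InnerProductSpace.toDual ℝ _).symm (fderiv ℝ u x) := rfl
  rw [h]
  exact (InnerProductSpace.toDual ℝ (EuclideanSpace ℝ (Fin N))).symm.continuous.measurable.comp
    (measurable_fderiv ℝ u)

lemma norm_gradient (u : EuclideanSpace ℝ (Fin N) → ℝ) (x : EuclideanSpace ℝ (Fin N)) :
    ‖gradient u x‖ = ‖fderiv ℝ u x‖ := by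
  rw [← toDual_gradient, LinearIsometryEquiv.norm_map]

lemma norm_gradient_le_of_lipschitz {u : EuclideanSpace ℝ (Fin N) → ℝ} {K : ℝ≥0}
    (hu : LipschitzWith K u) (x : EuclideanSpace ℝ (Fin N)) : ‖gradient u x‖ ≤ K := by
  rw [norm_gradient]
  exact norm_fderiv_le_of_lipschitz ℝ hu

/-- The squared `L²` norm of `u` on the sphere of radius `r`, in angular variables. -/
def sphMass (u : EuclideanSpace ℝ (Fin N) → ℝ) (r : ℝ) : ℝ :=
  ∫ θ, u (r • (θ : EuclideanSpace ℝ (Fin N))) ^ 2 ∂(surfMeasure N)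

/-- The squared norm of the tangential part of `r ∇u (r θ)`. -/
def tangSq (u : EuclideanSpace ℝ (Fin N) → ℝ) (r : ℝ) (θ : EuclideanSpace ℝ (Fin N)) : ℝ :=
  r ^ 2 * (‖gradient u (r • θ)‖ ^ 2 - ⟪gradient u (r • θ), θ⟫ ^ 2)

/-- The tangential Dirichlet energy of `u` on the sphere of radius `r`, in angular variables. -/
def sphTangEnergy (u : EuclideanSpace ℝ (Fin N) → ℝ) (r : ℝ) : ℝ :=
  ∫ θ, tangSq u r (θ : EuclideanSpace ℝ (Fin N)) ∂(surfMeasure N)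

lemma tangSq_nonneg (u : EuclideanSpace ℝ (Fin N) → ℝ) (r : ℝ) {θ : EuclideanSpace ℝ (Fin N)}
    (hθ : ‖θ‖ = 1) : 0 ≤ tangSq u r θ := by
  have h := abs_real_inner_le_norm (gradient u (r • θ)) θ
  rw [hθ, mul_one] at h
  have := pow_le_pow_left₀ (abs_nonneg _) h 2
  rw [sq_abs] at this
  exact mul_nonneg (sq_nonneg r) (by linarith)

lemma integrable_sphere_of_bound {g : sphere (0 : EuclideanSpace ℝ (Fin N)) 1 → ℝ} {C : ℝ}
    (hg : Measurable g) (h : ∀ θ, |g θ| ≤ C) : Integrable g (surfMeasure N) :=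
  Integrable.of_bound hg.aestronglyMeasurable C (ae_of_all _ h)

lemma integrable_sphere_sq {u : EuclideanSpace ℝ (Fin N) → ℝ} (hu : Continuous u) (r : ℝ) :
    Integrable (fun θ : sphere (0 : EuclideanSpace ℝ (Fin N)) 1 =>
      u (r • (θ : EuclideanSpace ℝ (Fin N))) ^ 2) (surfMeasure N) := by
  have hc : Continuous fun θ : sphere (0 : EuclideanSpace ℝ (Fin N)) 1 =>
      u (r • (θ : EuclideanSpace ℝ (Fin N))) ^ 2 := by fun_prop
  exact hc.integrable_of_hasCompactSupport (HasCompactSupport.of_compactSpace _)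

lemma integrable_tangSq {u : EuclideanSpace ℝ (Fin N) → ℝ} {K : ℝ≥0}
    (hu : LipschitzWith K u) (r : ℝ) :
    Integrable (fun θ : sphere (0 : EuclideanSpace ℝ (Fin N)) 1 =>
      tangSq u r (θ : EuclideanSpace ℝ (Fin N))) (surfMeasure N) := by
  have hm : Measurable fun θ : sphere (0 : EuclideanSpace ℝ (Fin N)) 1 =>
      gradient u (r • (θ : EuclideanSpace ℝ (Fin N))) :=
    (measurable_gradient u).comp (by fun_prop)
  refine integrable_sphere_of_bound (C := r ^ 2 * K ^ 2) ?_ fun θ => ?_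
  · unfold tangSq
    fun_prop
  · have hθ : ‖(θ : EuclideanSpace ℝ (Fin N))‖ = 1 := norm_eq_of_mem_sphere θ
    rw [abs_of_nonneg (tangSq_nonneg u r hθ), tangSq]
    have h1 := norm_gradient_le_of_lipschitz hu (r • (θ : EuclideanSpace ℝ (Fin N)))
    have h2 : ‖gradient u (r • (θ : EuclideanSpace ℝ (Fin N)))‖ ^ 2 ≤ (K : ℝ) ^ 2 :=
      pow_le_pow_left₀ (norm_nonneg _) h1 2
    refine mul_le_mul_of_nonneg_left ?_ (sq_nonneg r)
    exact (sub_le_self _ (sq_nonneg _)).trans h2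

lemma integral_stdGaussian_eq_polar (hN : 1 ≤ N) {g : EuclideanSpace ℝ (Fin N) → ℝ}
    (hg : Measurable g) :
    ∫ x, g x ∂(stdGaussian _) = ((2 * Real.pi) ^ ((N : ℝ) / 2))⁻¹ *
      ∫ p, Real.exp (-p.2 ^ 2 / 2) * g (p.2 • (p.1 : EuclideanSpace ℝ (Fin N)))
        ∂((surfMeasure N).prod (radialMeasure N)) := by
  have hd : Measurable fun x => gaussDensity N x := (continuous_gaussDensity N).measurable
  rw [stdGaussian_eq_withDensity, integral_withDensity_eq_integral_toReal_smul
    hd.ennreal_ofReal (by simp), integral_polar hN (by fun_prop), ← integral_const_mul]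
  refine integral_congr_ae (ae_of_all _ fun p => ?_)
  have hθ : ‖(p.1 : EuclideanSpace ℝ (Fin N))‖ = 1 := norm_eq_of_mem_sphere p.1
  simp only [smul_eq_mul]
  rw [ENNReal.toReal_ofReal (gaussDensity_pos N _).le, gaussDensity, norm_smul, hθ, mul_one,
    Real.norm_eq_abs, sq_abs]
  ring

lemma integrable_rpow_mul_exp_radialMeasure (hN : 1 ≤ N) {p : ℝ} (hp : -N < p) :
    Integrable (fun s => s ^ p * Real.exp (-s ^ 2 / 2)) (radialMeasure N) := by
  rw [integrable_radialMeasure_iff]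
  have h := integrableOn_rpow_mul_exp_neg_mul_sq (b := 1 / 2) (by norm_num)
    (s := p + (N - 1)) (by linarith)
  refine h.congr_fun (fun s hs => ?_) measurableSet_Ioi
  have hs : 0 < s := hs
  have e : s ^ (p + ((N : ℝ) - 1)) = s ^ p * s ^ (N - 1) := by
    rw [Real.rpow_add hs, ← Real.rpow_natCast, Nat.cast_sub hN, Nat.cast_one]
  simp only [e]
  rw [show -(1 / 2) * s ^ 2 = -s ^ 2 / 2 by ring]
  ring

lemma integrable_exp_radialMeasure (hN : 1 ≤ N) :
    Integrable (fun s => Real.exp (-s ^ 2 / 2)) (radialMeasure N) := by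
  have hN' : (1 : ℝ) ≤ N := by exact_mod_cast hN
  simpa using integrable_rpow_mul_exp_radialMeasure hN (p := 0) (by linarith)

lemma integral_sq_coneExt (hN : 1 ≤ N) {η : ℝ → ℝ} {r : ℝ}
    {u : EuclideanSpace ℝ (Fin N) → ℝ} (hF : Measurable (coneExt η u r)) :
    ∫ x, coneExt η u r x ^ 2 ∂(stdGaussian _) = ((2 * Real.pi) ^ ((N : ℝ) / 2))⁻¹ *
      (sphMass u r * ∫ s, Real.exp (-s ^ 2 / 2) * η s ^ 2 ∂(radialMeasure N)) := by
  rw [integral_stdGaussian_eq_polar hN (hF.pow_const 2), sphMass, ← integral_prod_mul]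
  congr 1
  refine integral_congr_ae ?_
  filter_upwards [Measure.quasiMeasurePreserving_snd.ae (radialMeasure_ae_pos (N := N))] with p hp
  have hθ : ‖(p.1 : EuclideanSpace ℝ (Fin N))‖ = 1 := norm_eq_of_mem_sphere p.1
  rw [coneExt_smul _ _ _ hθ hp]
  ring

lemma integral_sq_norm_fderiv_coneExt (hN : 1 ≤ N) {η η' : ℝ → ℝ}
    (hη : ∀ s, HasDerivAt η (η' s) s) {C : ℝ≥0} (hηC : LipschitzWith C η) (hη0 : η 0 = 0)
    {u : EuclideanSpace ℝ (Fin N) → ℝ} {K : ℝ≥0} (hu : LipschitzWith K u) {r : ℝ}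
    (hd : ∀ᵐ θ : sphere (0 : EuclideanSpace ℝ (Fin N)) 1 ∂(surfMeasure N),
      DifferentiableAt ℝ u (r • (θ : EuclideanSpace ℝ (Fin N)))) :
    ∫ x, ‖fderiv ℝ (coneExt η u r) x‖ ^ 2 ∂(stdGaussian _) =
      ((2 * Real.pi) ^ ((N : ℝ) / 2))⁻¹ *
      (sphMass u r * (∫ s, Real.exp (-s ^ 2 / 2) * η' s ^ 2 ∂(radialMeasure N)) +
        sphTangEnergy u r * ∫ s, Real.exp (-s ^ 2 / 2) * (η s / s) ^ 2 ∂(radialMeasure N)) := by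
  have hηc : Continuous η := hηC.continuous
  have hη'm : Measurable η' := by
    have : η' = deriv η := funext fun s => (hη s).deriv.symm
    rw [this]
    exact measurable_deriv η
  have hη'C : ∀ s, |η' s| ≤ C := fun s => by
    rw [← (hη s).deriv, ← Real.norm_eq_abs]
    exact norm_deriv_le_of_lipschitz hηC
  have hηs : ∀ s, |η s / s| ≤ C := fun s => by
    rcases eq_or_ne s 0 with rfl | hs
    · simp
    · have h := hηC.dist_le_mul s 0
      rw [Real.dist_eq, hη0, sub_zero, Real.dist_eq, sub_zero] at h
      rw [abs_div, div_le_iff₀ (abs_pos.2 hs)]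
      exact h
  have hint : ∀ g : ℝ → ℝ, Measurable g → (∀ s, |g s| ≤ C) →
      Integrable (fun s => Real.exp (-s ^ 2 / 2) * g s ^ 2) (radialMeasure N) := by
    intro g hg hgC
    refine (integrable_exp_radialMeasure hN).mul_bdd (c := (C : ℝ) ^ 2)
      (hg.pow_const 2).aestronglyMeasurable
      (ae_of_all _ fun s => ?_)
    rw [norm_pow]
    exact pow_le_pow_left₀ (norm_nonneg _) (hgC s) 2
  have i1 := (integrable_sphere_sq hu.continuous r).mul_prod (hint η' hη'm hη'C)
  have i2 := (integrable_tangSq hu r).mul_prod (hint (fun s => η s / s) (by fun_prop) hηs)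
  rw [integral_stdGaussian_eq_polar hN ((measurable_fderiv ℝ _).norm.pow_const 2), sphMass,
    sphTangEnergy, ← integral_prod_mul, ← integral_prod_mul, ← integral_add i1 i2]
  congr 1
  refine integral_congr_ae ?_
  filter_upwards [Measure.quasiMeasurePreserving_snd.ae (radialMeasure_ae_pos (N := N)),
    Measure.quasiMeasurePreserving_fst.ae hd] with p hp hdp
  have hθ : ‖(p.1 : EuclideanSpace ℝ (Fin N))‖ = 1 := norm_eq_of_mem_sphere p.1
  rw [sq_norm_fderiv_coneExt hθ hp (hη p.2) hdp, tangSq]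
  ring

lemma coneExt_nonneg {η : ℝ → ℝ} (hη : ∀ s, 0 ≤ s → 0 ≤ η s) {u : EuclideanSpace ℝ (Fin N) → ℝ}
    (hu : ∀ x, 0 ≤ u x) (r : ℝ) (x : EuclideanSpace ℝ (Fin N)) : 0 ≤ coneExt η u r x :=
  mul_nonneg (hη _ (norm_nonneg x)) (hu _)

/-- The Gaussian two-function inequality for products of radial and angular functions. -/
lemma cone_inequality (hN : 1 ≤ N) {η₁ η₁' η₂ η₂' : ℝ → ℝ}
    (h₁ : ∀ s, HasDerivAt η₁ (η₁' s) s) {C₁ : ℝ≥0} (hC₁ : LipschitzWith C₁ η₁) (h₁0 : η₁ 0 = 0)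
    (h₁p : ∀ s, 0 ≤ s → 0 ≤ η₁ s)
    (h₂ : ∀ s, HasDerivAt η₂ (η₂' s) s) {C₂ : ℝ≥0} (hC₂ : LipschitzWith C₂ η₂) (h₂0 : η₂ 0 = 0)
    (h₂p : ∀ s, 0 ≤ s → 0 ≤ η₂ s)
    {u₁ u₂ : EuclideanSpace ℝ (Fin N) → ℝ} {K₁ K₂ : ℝ≥0} (hu₁ : LipschitzWith K₁ u₁)
    (hu₂ : LipschitzWith K₂ u₂) (hp₁ : ∀ x, 0 ≤ u₁ x) (hp₂ : ∀ x, 0 ≤ u₂ x) {r : ℝ} (hr : 0 < r)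
    (hprod : ∀ x, ‖x‖ = r → u₁ x * u₂ x = 0)
    (hd₁ : ∀ᵐ θ : sphere (0 : EuclideanSpace ℝ (Fin N)) 1 ∂(surfMeasure N),
      DifferentiableAt ℝ u₁ (r • (θ : EuclideanSpace ℝ (Fin N))))
    (hd₂ : ∀ᵐ θ : sphere (0 : EuclideanSpace ℝ (Fin N)) 1 ∂(surfMeasure N),
      DifferentiableAt ℝ u₂ (r • (θ : EuclideanSpace ℝ (Fin N)))) :
    2 * ((sphMass u₁ r * ∫ s, Real.exp (-s ^ 2 / 2) * η₁ s ^ 2 ∂(radialMeasure N)) *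
      (sphMass u₂ r * ∫ s, Real.exp (-s ^ 2 / 2) * η₂ s ^ 2 ∂(radialMeasure N))) ≤
    (sphMass u₁ r * (∫ s, Real.exp (-s ^ 2 / 2) * η₁' s ^ 2 ∂(radialMeasure N)) +
        sphTangEnergy u₁ r * ∫ s, Real.exp (-s ^ 2 / 2) * (η₁ s / s) ^ 2 ∂(radialMeasure N)) *
      (sphMass u₂ r * ∫ s, Real.exp (-s ^ 2 / 2) * η₂ s ^ 2 ∂(radialMeasure N)) +
    (sphMass u₂ r * (∫ s, Real.exp (-s ^ 2 / 2) * η₂' s ^ 2 ∂(radialMeasure N)) +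
        sphTangEnergy u₂ r * ∫ s, Real.exp (-s ^ 2 / 2) * (η₂ s / s) ^ 2 ∂(radialMeasure N)) *
      (sphMass u₁ r * ∫ s, Real.exp (-s ^ 2 / 2) * η₁ s ^ 2 ∂(radialMeasure N)) := by
  obtain ⟨L₁, hL₁⟩ := exists_lipschitzWith_coneExt hC₁ h₁0 hu₁ r
  obtain ⟨L₂, hL₂⟩ := exists_lipschitzWith_coneExt hC₂ h₂0 hu₂ r
  have hFG : ∀ x, coneExt η₁ u₁ r x * coneExt η₂ u₂ r x = 0 := by
    intro x
    rcases eq_or_ne x 0 with rfl | hx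
    · simp [coneExt, h₁0]
    · have hx' : ‖x‖ ≠ 0 := norm_ne_zero_iff.2 hx
      have := hprod ((r * ‖x‖⁻¹) • x) (by
        rw [norm_smul, norm_mul, norm_inv, norm_norm, mul_assoc, inv_mul_cancel₀ hx', mul_one,
          Real.norm_of_nonneg hr.le])
      rw [coneExt, coneExt, mul_mul_mul_comm, this, mul_zero]
  have key := gaussian_two_function_inequality hL₁ hL₂ (coneExt_nonneg h₁p hp₁ r)
    (coneExt_nonneg h₂p hp₂ r) hFG
  rw [integral_sq_coneExt hN hL₁.continuous.measurable,
    integral_sq_coneExt hN hL₂.continuous.measurable,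
    integral_sq_norm_fderiv_coneExt hN h₁ hC₁ h₁0 hu₁ hd₁,
    integral_sq_norm_fderiv_coneExt hN h₂ hC₂ h₂0 hu₂ hd₂] at key
  have hk : 0 < ((2 * Real.pi) ^ ((N : ℝ) / 2))⁻¹ := by positivity
  refine le_of_mul_le_mul_left (a := (((2 * Real.pi) ^ ((N : ℝ) / 2))⁻¹) ^ 2) ?_ (by positivity)
  linarith

end Spherical

section RadialProfile

/-- A bounded regularisation of `s ^ 2`. -/
def regSq (ε s : ℝ) : ℝ := (s ^ 2 + ε) / (1 + ε * s ^ 2)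

/-- A Lipschitz regularisation of `s ^ α`. -/
def regPow (α ε s : ℝ) : ℝ := s * regSq ε s ^ ((α - 1) / 2)

/-- The derivative of `regPow`. -/
def regPowDeriv (α ε s : ℝ) : ℝ :=
  regSq ε s ^ ((α - 1) / 2) *
    (1 + (α - 1) / 2 * (2 * s ^ 2 * (1 - ε ^ 2) / ((1 + ε * s ^ 2) * (s ^ 2 + ε))))

variable {α ε s : ℝ}

lemma regSq_pos (hε : 0 < ε) (s : ℝ) : 0 < regSq ε s := by
  unfold regSq; positivity

lemma hasDerivAt_regPow (α : ℝ) (hε : 0 < ε) (s : ℝ) :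
    HasDerivAt (regPow α ε) (regPowDeriv α ε s) s := by
  have h0 : (1 + ε * s ^ 2) ≠ 0 := by positivity
  have h1 : HasDerivAt (regSq ε) (2 * s * (1 - ε ^ 2) / (1 + ε * s ^ 2) ^ 2) s := by
    have ha : HasDerivAt (fun s : ℝ => s ^ 2 + ε) (2 * s) s := by
      simpa using ((hasDerivAt_id s).fun_pow 2).add_const ε
    have hb : HasDerivAt (fun s : ℝ => 1 + ε * s ^ 2) (ε * (2 * s)) s := by
      simpa using (((hasDerivAt_id s).fun_pow 2).const_mul ε).const_add 1
    refine (ha.fun_div hb h0).congr_deriv ?_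
    congr 1
    ring
  have h2 := h1.rpow_const (p := (α - 1) / 2) (Or.inl (regSq_pos hε s).ne')
  refine ((hasDerivAt_id s).fun_mul h2).congr_deriv ?_
  have hq := regSq_pos hε s
  rw [regPowDeriv, Real.rpow_sub_one hq.ne', id]
  have hs : s ^ 2 + ε ≠ 0 := by positivity
  have e : regSq ε s ^ ((α - 1) / 2) / regSq ε s =
      regSq ε s ^ ((α - 1) / 2) * ((1 + ε * s ^ 2) / (s ^ 2 + ε)) := by
    rw [div_eq_mul_inv]
    congr 1
    rw [regSq, inv_div]
  rw [e]
  field_simp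

lemma abs_one_add_mul_le (hε : 0 < ε) (hε1 : ε ≤ 1) (p s : ℝ) :
    |1 + p * (2 * s ^ 2 * (1 - ε ^ 2) / ((1 + ε * s ^ 2) * (s ^ 2 + ε)))| ≤ 1 + 2 * |p| := by
  have h0 : 0 ≤ 1 - ε ^ 2 := by nlinarith
  have h1 : 0 ≤ 2 * s ^ 2 * (1 - ε ^ 2) / ((1 + ε * s ^ 2) * (s ^ 2 + ε)) := by positivity
  have h2 : 2 * s ^ 2 * (1 - ε ^ 2) / ((1 + ε * s ^ 2) * (s ^ 2 + ε)) ≤ 2 := by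
    rw [div_le_iff₀ (by positivity)]
    nlinarith [mul_nonneg hε.le (sq_nonneg s), mul_nonneg hε.le (sq_nonneg (s ^ 2)),
      mul_nonneg (sq_nonneg ε) (sq_nonneg s)]
  refine (abs_add_le _ _).trans ?_
  rw [abs_one, abs_mul, abs_of_nonneg h1]
  nlinarith [abs_nonneg p]

lemma rpow_le_one_add_rpow {q t p : ℝ} (hq : 0 < q) (ht : 0 < t) (h1 : min 1 t ≤ q)
    (h2 : q ≤ max 1 t) : q ^ p ≤ 1 + t ^ p := by
  have htp : 0 ≤ t ^ p := Real.rpow_nonneg ht.le p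
  rcases le_total 0 p with hp | hp
  · refine (Real.rpow_le_rpow hq.le h2 hp).trans ?_
    rcases le_total 1 t with h | h
    · rw [max_eq_right h]; linarith
    · rw [max_eq_left h, Real.one_rpow]; linarith
  · refine (Real.rpow_le_rpow_of_nonpos (lt_min one_pos ht) h1 hp).trans ?_
    rcases le_total 1 t with h | h
    · rw [min_eq_left h, Real.one_rpow]; linarith
    · rw [min_eq_right h]; linarith

lemma regSq_rpow_le (hε : 0 < ε) (hε1 : ε ≤ 1) (hs : 0 < s) (p : ℝ) :
    regSq ε s ^ p ≤ 1 + (s ^ 2) ^ p := by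
  have hd : 0 < 1 + ε * s ^ 2 := by positivity
  refine rpow_le_one_add_rpow (regSq_pos hε s) (by positivity) ?_ ?_
  · rw [regSq, le_div_iff₀ hd]
    rcases le_total 1 (s ^ 2) with h | h
    · rw [min_eq_left h]; nlinarith
    · rw [min_eq_right h]; nlinarith [mul_nonneg hε.le (sub_nonneg.2 h), sq_nonneg (s ^ 2)]
  · rw [regSq, div_le_iff₀ hd]
    rcases le_total 1 (s ^ 2) with h | h
    · rw [max_eq_right h]; nlinarith [mul_nonneg hε.le (sub_nonneg.2 h)]
    · rw [max_eq_left h]; nlinarith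

lemma exists_lipschitzWith_regPow (α : ℝ) (hε : 0 < ε) (hε1 : ε ≤ 1) :
    ∃ C : ℝ≥0, LipschitzWith C (regPow α ε) := by
  set p := (α - 1) / 2 with hp
  have hb : ∀ s, regSq ε s ^ p ≤ 1 / ε ^ |p| := by
    intro s
    have hq := regSq_pos hε s
    have hd : 0 < 1 + ε * s ^ 2 := by positivity
    rw [one_div, ← Real.inv_rpow hε.le]
    rcases le_total 0 p with h | h
    · rw [abs_of_nonneg h]
      refine Real.rpow_le_rpow hq.le ?_ h
      rw [regSq, div_le_iff₀ hd, mul_add, ← mul_assoc, inv_mul_cancel₀ hε.ne', mul_one, one_mul]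
      have : ε ≤ ε⁻¹ := hε1.trans (one_le_inv₀ hε |>.2 hε1)
      linarith
    · rw [abs_of_nonpos h, Real.rpow_neg (by positivity), Real.inv_rpow hε.le, inv_inv]
      refine Real.rpow_le_rpow_of_nonpos hε ?_ h
      rw [regSq, le_div_iff₀ hd]
      nlinarith [mul_nonneg (sub_nonneg.2 hε1) (sq_nonneg s),
        mul_nonneg (mul_nonneg hε.le (sub_nonneg.2 hε1)) (sq_nonneg s)]
  refine ⟨Real.toNNReal (1 / ε ^ |p| * (1 + 2 * |p|)), lipschitzWith_of_nnnorm_deriv_le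
    (fun s => (hasDerivAt_regPow α hε s).differentiableAt) fun s => ?_⟩
  rw [(hasDerivAt_regPow α hε s).deriv, ← NNReal.coe_le_coe, coe_nnnorm,
    Real.coe_toNNReal _ (by positivity), regPowDeriv, norm_mul,
    Real.norm_of_nonneg (Real.rpow_nonneg (regSq_pos hε s).le _), Real.norm_eq_abs]
  exact mul_le_mul (hb s) (abs_one_add_mul_le hε hε1 _ s) (abs_nonneg _) (by positivity)

lemma regPow_zero (α ε : ℝ) : regPow α ε 0 = 0 := by simp [regPow]

lemma regPow_nonneg (α : ℝ) (hε : 0 < ε) (hs : 0 ≤ s) : 0 ≤ regPow α ε s :=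
  mul_nonneg hs (Real.rpow_nonneg (regSq_pos hε s).le _)

lemma sq_regSq_rpow (α : ℝ) (hε : 0 < ε) (s : ℝ) :
    (regSq ε s ^ ((α - 1) / 2)) ^ 2 = regSq ε s ^ (α - 1) := by
  rw [← Real.rpow_natCast, ← Real.rpow_mul (regSq_pos hε s).le]
  congr 1
  push_cast
  ring

lemma tendsto_regSq_rpow (p : ℝ) (hs : 0 < s) :
    Tendsto (fun ε => regSq ε s ^ p) (𝓝[>] 0) (𝓝 ((s ^ 2) ^ p)) := by
  have h : Tendsto (fun ε => regSq ε s) (𝓝[>] 0) (𝓝 (s ^ 2)) := by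
    have h1 : Tendsto (fun ε => (s ^ 2 + ε) / (1 + ε * s ^ 2)) (𝓝 0)
        (𝓝 ((s ^ 2 + 0) / (1 + 0 * s ^ 2))) :=
      Tendsto.div (Continuous.tendsto (by fun_prop) 0) (Continuous.tendsto (by fun_prop) 0)
        (by simp)
    simpa [regSq] using h1.mono_left nhdsWithin_le_nhds
  exact h.rpow_const (Or.inl (by positivity))

lemma tendsto_regPow_factor (p : ℝ) (hs : 0 < s) :
    Tendsto (fun ε => 1 + p * (2 * s ^ 2 * (1 - ε ^ 2) / ((1 + ε * s ^ 2) * (s ^ 2 + ε))))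
      (𝓝[>] 0) (𝓝 (1 + 2 * p)) := by
  have h1 : Tendsto (fun ε : ℝ => 2 * s ^ 2 * (1 - ε ^ 2) / ((1 + ε * s ^ 2) * (s ^ 2 + ε))) (𝓝 0)
      (𝓝 (2 * s ^ 2 * (1 - 0 ^ 2) / ((1 + 0 * s ^ 2) * (s ^ 2 + 0)))) :=
    Tendsto.div (Continuous.tendsto (by fun_prop) 0) (Continuous.tendsto (by fun_prop) 0)
      (by simp [hs.ne'])
  have h2 : 2 * s ^ 2 * (1 - 0 ^ 2) / ((1 + 0 * s ^ 2) * (s ^ 2 + 0)) = 2 := by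
    field_simp
    simp
  rw [h2] at h1
  have := ((h1.mono_left (nhdsWithin_le_nhds (s := Ioi (0 : ℝ)))).const_mul p).const_add 1
  simpa [mul_comm] using this

variable {N : ℕ}

/-- The Gaussian moment `∫ s ^ p e ^ (-s ^ 2 / 2)` for the radial measure. -/
def radialMoment (N : ℕ) (p : ℝ) : ℝ := ∫ s, s ^ p * Real.exp (-s ^ 2 / 2) ∂(radialMeasure N)

lemma radialMoment_eq (hN : 1 ≤ N) {p : ℝ} (hp : -N < p) :
    radialMoment N p = (1 / 2 : ℝ) ^ (-(p + N) / 2) * (1 / 2) * Real.Gamma ((p + N) / 2) := by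
  rw [radialMoment, integral_radialMeasure]
  have h := integral_rpow_mul_exp_neg_mul_rpow (p := 2) (q := p + (N - 1)) (b := 1 / 2)
    (by norm_num) (by linarith) (by norm_num)
  rw [show p + ((N : ℝ) - 1) + 1 = p + N by ring] at h
  rw [← h]
  refine setIntegral_congr_fun measurableSet_Ioi fun s hs => ?_
  have hs : 0 < s := hs
  have e : s ^ (p + ((N : ℝ) - 1)) = s ^ p * s ^ (N - 1) := by
    rw [Real.rpow_add hs, ← Real.rpow_natCast, Nat.cast_sub hN, Nat.cast_one]
  simp only [e]
  rw [show -(1 / 2) * s ^ (2 : ℝ) = -s ^ 2 / 2 by rw [Real.rpow_two]; ring]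
  ring

lemma radialMoment_pos (hN : 1 ≤ N) {p : ℝ} (hp : -N < p) : 0 < radialMoment N p := by
  rw [radialMoment_eq hN hp]
  have := Real.Gamma_pos_of_pos (s := (p + N) / 2) (by linarith)
  positivity

lemma radialMoment_add_two (hN : 1 ≤ N) {p : ℝ} (hp : -N < p) :
    radialMoment N (p + 2) = (p + N) * radialMoment N p := by
  rw [radialMoment_eq hN hp, radialMoment_eq hN (by linarith),
    show (p + 2 + N) / 2 = (p + N) / 2 + 1 by ring, Real.Gamma_add_one (by linarith),
    show -(p + 2 + N) / 2 = -(p + N) / 2 - 1 by ring, Real.rpow_sub_one (by norm_num)]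
  ring

lemma sq_rpow_sub_one (hs : 0 < s) (α : ℝ) : (s ^ 2) ^ (α - 1) = s ^ (2 * α - 2) := by
  rw [← Real.rpow_natCast, ← Real.rpow_mul hs.le]
  congr 1
  push_cast
  ring

lemma tendsto_integral_regSq (hN : 2 ≤ N) (hα : 0 < α) {g : ℝ → ℝ → ℝ} {M c : ℝ}
    (hgm : ∀ ε, Measurable (g ε)) (hM : ∀ ε s, 0 < ε → ε ≤ 1 → |g ε s| ≤ M)
    (hg : ∀ s, 0 < s → Tendsto (fun ε => g ε s) (𝓝[>] 0) (𝓝 c)) (k : ℕ) :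
    Tendsto (fun ε => ∫ s, Real.exp (-s ^ 2 / 2) * (s ^ k * (regSq ε s ^ (α - 1) * g ε s))
      ∂(radialMeasure N)) (𝓝[>] 0) (𝓝 (c * radialMoment N (2 * α - 2 + k))) := by
  have hN' : (2 : ℝ) ≤ N := by exact_mod_cast hN
  have hN1 : 1 ≤ N := by omega
  have hk0 : (0 : ℝ) ≤ k := Nat.cast_nonneg k
  rw [radialMoment, ← integral_const_mul]
  refine tendsto_integral_filter_of_dominated_convergence
    (fun s => (s ^ (k : ℝ) * Real.exp (-s ^ 2 / 2) +
      s ^ (2 * α - 2 + k) * Real.exp (-s ^ 2 / 2)) * M) ?_ ?_ ?_ ?_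
  · refine Eventually.of_forall fun ε => ?_
    have := hgm ε
    unfold regSq
    fun_prop
  · filter_upwards [self_mem_nhdsWithin, nhdsWithin_le_nhds (Iio_mem_nhds one_pos)] with ε h0 h1
    have h0 : 0 < ε := h0
    have h1 : ε ≤ 1 := le_of_lt h1
    filter_upwards [radialMeasure_ae_pos (N := N)] with s hs
    have hq := regSq_rpow_le h0 h1 hs (α - 1)
    rw [sq_rpow_sub_one hs] at hq
    have hq0 := Real.rpow_nonneg (regSq_pos h0 s).le (α - 1)
    rw [norm_mul, norm_mul, norm_mul, Real.norm_of_nonneg (Real.exp_pos _).le,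
      Real.norm_of_nonneg (pow_nonneg hs.le k), Real.norm_of_nonneg hq0, Real.norm_eq_abs,
      Real.rpow_add hs, Real.rpow_natCast]
    calc _ ≤ Real.exp (-s ^ 2 / 2) * (s ^ k * ((1 + s ^ (2 * α - 2)) * M)) := by
          gcongr
          exact hM ε s h0 h1
      _ = _ := by ring
  · refine Integrable.mul_const (Integrable.add ?_ ?_) M
    · exact integrable_rpow_mul_exp_radialMeasure hN1 (by linarith)
    · exact integrable_rpow_mul_exp_radialMeasure hN1 (by linarith)
  · filter_upwards [radialMeasure_ae_pos (N := N)] with s hs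
    have h := (((tendsto_regSq_rpow (α - 1) hs).mul (hg s hs)).const_mul (s ^ k)).const_mul
      (Real.exp (-s ^ 2 / 2))
    rw [sq_rpow_sub_one hs] at h
    rw [Real.rpow_add hs, Real.rpow_natCast]
    convert h using 2
    ring

lemma tendsto_integral_regPow_sq (hN : 2 ≤ N) (hα : 0 < α) :
    Tendsto (fun ε => ∫ s, Real.exp (-s ^ 2 / 2) * regPow α ε s ^ 2 ∂(radialMeasure N))
      (𝓝[>] 0) (𝓝 ((2 * α + N - 2) * radialMoment N (2 * α - 2))) := by
  have hN' : (2 : ℝ) ≤ N := by exact_mod_cast hN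
  have h := tendsto_integral_regSq hN hα (g := fun _ _ => 1) (M := 1) (c := 1) (by fun_prop)
    (by simp) (by simp) 2
  rw [Nat.cast_ofNat, radialMoment_add_two (by omega) (by linarith), one_mul,
    show 2 * α - 2 + (N : ℝ) = 2 * α + N - 2 by ring] at h
  refine h.congr' ?_
  filter_upwards [self_mem_nhdsWithin] with ε hε
  refine integral_congr_ae (ae_of_all _ fun s => ?_)
  simp only [regPow, mul_pow, sq_regSq_rpow α hε s, mul_one]

lemma tendsto_integral_regPow_div_sq (hN : 2 ≤ N) (hα : 0 < α) :
    Tendsto (fun ε => ∫ s, Real.exp (-s ^ 2 / 2) * (regPow α ε s / s) ^ 2 ∂(radialMeasure N))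
      (𝓝[>] 0) (𝓝 (radialMoment N (2 * α - 2))) := by
  have h := tendsto_integral_regSq hN hα (g := fun _ _ => 1) (M := 1) (c := 1) (by fun_prop)
    (by simp) (by simp) 0
  rw [Nat.cast_zero, add_zero, one_mul] at h
  refine h.congr' ?_
  filter_upwards [self_mem_nhdsWithin] with ε hε
  refine integral_congr_ae ?_
  filter_upwards [radialMeasure_ae_pos (N := N)] with s hs
  rw [regPow, mul_div_cancel_left₀ _ hs.ne', sq_regSq_rpow α hε s, mul_one, pow_zero, one_mul]

lemma tendsto_integral_regPowDeriv_sq (hN : 2 ≤ N) (hα : 0 < α) :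
    Tendsto (fun ε => ∫ s, Real.exp (-s ^ 2 / 2) * regPowDeriv α ε s ^ 2 ∂(radialMeasure N))
      (𝓝[>] 0) (𝓝 (α ^ 2 * radialMoment N (2 * α - 2))) := by
  have h := tendsto_integral_regSq hN hα (g := fun ε s => (1 + (α - 1) / 2 *
      (2 * s ^ 2 * (1 - ε ^ 2) / ((1 + ε * s ^ 2) * (s ^ 2 + ε)))) ^ 2)
    (M := (1 + 2 * |(α - 1) / 2|) ^ 2) (c := α ^ 2) (by fun_prop)
    (fun ε s h0 h1 => by
      rw [abs_pow]
      exact pow_le_pow_left₀ (abs_nonneg _) (abs_one_add_mul_le h0 h1 _ s) 2)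
    (fun s hs => by
      have := (tendsto_regPow_factor ((α - 1) / 2) hs).pow 2
      rwa [show 1 + 2 * ((α - 1) / 2) = α by ring] at this) 0
  rw [Nat.cast_zero, add_zero] at h
  refine h.congr' ?_
  filter_upwards [self_mem_nhdsWithin] with ε hε
  refine integral_congr_ae (ae_of_all _ fun s => ?_)
  simp only [regPowDeriv, mul_pow, sq_regSq_rpow α hε s, pow_zero, one_mul]

/-- A spherical two-function inequality of Friedland–Hayman type. -/
theorem spherical_two_function_inequality (hN : 2 ≤ N) {α β : ℝ} (hα : 0 < α) (hβ : 0 < β)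
    {u₁ u₂ : EuclideanSpace ℝ (Fin N) → ℝ} {K₁ K₂ : ℝ≥0} (hu₁ : LipschitzWith K₁ u₁)
    (hu₂ : LipschitzWith K₂ u₂) (hp₁ : ∀ x, 0 ≤ u₁ x) (hp₂ : ∀ x, 0 ≤ u₂ x) {r : ℝ} (hr : 0 < r)
    (hprod : ∀ x, ‖x‖ = r → u₁ x * u₂ x = 0)
    (hd₁ : ∀ᵐ θ : sphere (0 : EuclideanSpace ℝ (Fin N)) 1 ∂(surfMeasure N),
      DifferentiableAt ℝ u₁ (r • (θ : EuclideanSpace ℝ (Fin N))))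
    (hd₂ : ∀ᵐ θ : sphere (0 : EuclideanSpace ℝ (Fin N)) 1 ∂(surfMeasure N),
      DifferentiableAt ℝ u₂ (r • (θ : EuclideanSpace ℝ (Fin N)))) :
    2 * ((sphMass u₁ r * (2 * α + N - 2)) * (sphMass u₂ r * (2 * β + N - 2))) ≤
      (α ^ 2 * sphMass u₁ r + sphTangEnergy u₁ r) * (sphMass u₂ r * (2 * β + N - 2)) +
        (β ^ 2 * sphMass u₂ r + sphTangEnergy u₂ r) * (sphMass u₁ r * (2 * α + N - 2)) := by
  have hN' : (2 : ℝ) ≤ N := by exact_mod_cast hN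
  have hX := radialMoment_pos (N := N) (by omega) (p := 2 * α - 2) (by linarith)
  have hY := radialMoment_pos (N := N) (by omega) (p := 2 * β - 2) (by linarith)
  have a1 := (tendsto_integral_regPow_sq hN hα).const_mul (sphMass u₁ r)
  have a2 := (tendsto_integral_regPow_sq hN hβ).const_mul (sphMass u₂ r)
  have b1 := ((tendsto_integral_regPowDeriv_sq hN hα).const_mul (sphMass u₁ r)).add
    ((tendsto_integral_regPow_div_sq hN hα).const_mul (sphTangEnergy u₁ r))
  have b2 := ((tendsto_integral_regPowDeriv_sq hN hβ).const_mul (sphMass u₂ r)).add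
    ((tendsto_integral_regPow_div_sq hN hβ).const_mul (sphTangEnergy u₂ r))
  have key := le_of_tendsto_of_tendsto ((a1.mul a2).const_mul 2) ((b1.mul a2).add (b2.mul a1)) (by
    filter_upwards [self_mem_nhdsWithin, nhdsWithin_le_nhds (Iio_mem_nhds one_pos)] with ε h0 h1
    have h0 : 0 < ε := h0
    have h1 : ε ≤ 1 := le_of_lt h1
    obtain ⟨C₁, hC₁⟩ := exists_lipschitzWith_regPow α h0 h1
    obtain ⟨C₂, hC₂⟩ := exists_lipschitzWith_regPow β h0 h1
    exact cone_inequality (by omega) (hasDerivAt_regPow α h0) hC₁ (regPow_zero _ _)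
      (fun s => regPow_nonneg α h0) (hasDerivAt_regPow β h0) hC₂ (regPow_zero _ _)
      (fun s => regPow_nonneg β h0) hu₁ hu₂ hp₁ hp₂ hr hprod hd₁ hd₂)
  refine le_of_mul_le_mul_left
    (a := radialMoment N (2 * α - 2) * radialMoment N (2 * β - 2)) ?_ (mul_pos hX hY)
  linarith

end RadialProfile

section Mollify

open scoped Convolution

variable {N : ℕ}

/-- A bump function supported in the ball of radius `2 / (n + 1)`. -/
def mollBump (N n : ℕ) : ContDiffBump (0 : EuclideanSpace ℝ (Fin N)) where
  rIn := 1 / (n + 1)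
  rOut := 2 / (n + 1)
  rIn_pos := by positivity
  rIn_lt_rOut := by gcongr; norm_num

/-- The mollification of `ψ` at scale `2 / (n + 1)`. -/
def mollify (n : ℕ) (ψ : EuclideanSpace ℝ (Fin N) → ℝ) : EuclideanSpace ℝ (Fin N) → ℝ :=
  (mollBump N n).normed volume ⋆[ContinuousLinearMap.lsmul ℝ ℝ, volume] ψ

lemma mollify_apply (n : ℕ) (ψ : EuclideanSpace ℝ (Fin N) → ℝ) (x : EuclideanSpace ℝ (Fin N)) :
    mollify n ψ x = ∫ t, (mollBump N n).normed volume t * ψ (x - t) := rfl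

lemma integrable_mollBump_normed (n : ℕ) :
    Integrable ((mollBump N n).normed volume) :=
  (mollBump N n).continuous_normed.integrable_of_hasCompactSupport
    (mollBump N n).hasCompactSupport_normed

lemma integrable_mollBump_normed_mul (n : ℕ) {g : EuclideanSpace ℝ (Fin N) → ℝ}
    (hg : Continuous g) : Integrable fun t => (mollBump N n).normed volume t * g t :=
  ((mollBump N n).continuous_normed.mul hg).integrable_of_hasCompactSupport
    (mollBump N n).hasCompactSupport_normed.mul_right

lemma contDiff_mollify (n : ℕ) {ψ : EuclideanSpace ℝ (Fin N) → ℝ} (hψ : Continuous ψ) :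
    ContDiff ℝ (⊤ : ℕ∞) (mollify n ψ) :=
  (mollBump N n).hasCompactSupport_normed.contDiff_convolution_left _
    (mollBump N n).contDiff_normed hψ.locallyIntegrable

lemma mollify_nonneg (n : ℕ) {ψ : EuclideanSpace ℝ (Fin N) → ℝ} (hψ : ∀ x, 0 ≤ ψ x)
    (x : EuclideanSpace ℝ (Fin N)) : 0 ≤ mollify n ψ x := by
  rw [mollify_apply]
  exact integral_nonneg fun t => mul_nonneg ((mollBump N n).nonneg_normed _) (hψ _)

lemma mollify_eq_zero (n : ℕ) {ψ : EuclideanSpace ℝ (Fin N) → ℝ} {ρ : ℝ}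
    (hψ : ∀ x, ρ < ‖x‖ → ψ x = 0) {x : EuclideanSpace ℝ (Fin N)}
    (hx : ρ + 2 / (n + 1) < ‖x‖) : mollify n ψ x = 0 := by
  rw [mollify_apply]
  refine integral_eq_zero_of_ae (ae_of_all _ fun t => ?_)
  change _ * _ = (0 : ℝ)
  by_cases ht : t ∈ Function.support ((mollBump N n).normed volume)
  · rw [ContDiffBump.support_normed_eq, mem_ball_zero_iff] at ht
    have ht' : ‖t‖ < 2 / (n + 1) := ht
    rw [hψ (x - t), mul_zero]
    linarith [norm_sub_norm_le x t]
  · rw [Function.notMem_support.1 ht, zero_mul]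

lemma abs_integral_mollBump_le (n : ℕ) {g : EuclideanSpace ℝ (Fin N) → ℝ} {C : ℝ}
    (h : ∀ t, |g t| ≤ C) : |∫ t, (mollBump N n).normed volume t * g t| ≤ C := by
  have := norm_integral_le_of_norm_le (f := fun t => (mollBump N n).normed volume t * g t)
    ((integrable_mollBump_normed (N := N) n).mul_const C) (ae_of_all _ fun t => by
      rw [norm_mul, Real.norm_of_nonneg ((mollBump N n).nonneg_normed t)]
      exact mul_le_mul_of_nonneg_left (h t) ((mollBump N n).nonneg_normed t))
  rwa [integral_mul_const, ContDiffBump.integral_normed, one_mul] at this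

lemma fderiv_mollify (n : ℕ) {ψ : EuclideanSpace ℝ (Fin N) → ℝ} {K : ℝ≥0}
    (hψ : LipschitzWith K ψ) (x v : EuclideanSpace ℝ (Fin N)) :
    fderiv ℝ (mollify n ψ) x v = mollify n (fun y => fderiv ℝ ψ y v) x := by
  have hd : DifferentiableAt ℝ (mollify n ψ) x :=
    (contDiff_mollify n hψ.continuous).differentiable (by simp) x
  rw [← hd.lineDeriv_eq_fderiv]
  have hae : ∀ᵐ t : EuclideanSpace ℝ (Fin N), DifferentiableAt ℝ ψ (x - t) :=
    (Measure.measurePreserving_sub_left volume x).quasiMeasurePreserving.ae hψ.ae_differentiableAt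
  refine (hasDerivAt_integral_of_dominated_loc_of_lip (s := univ) (𝕜 := ℝ)
    (F := fun s t => (mollBump N n).normed volume t * ψ (x + s • v - t))
    (bound := fun t => (mollBump N n).normed volume t * (K * ‖v‖)) (x₀ := (0 : ℝ))
    univ_mem ?_ ?_ ?_ ?_ ?_ ?_).2.deriv
  · refine Eventually.of_forall fun s => ?_
    have := (mollBump N n).continuous_normed (μ := volume)
    have hψc := hψ.continuous
    exact (by fun_prop : Continuous _).aestronglyMeasurable
  · have hψc := hψ.continuous
    exact integrable_mollBump_normed_mul n (by fun_prop)
  · refine (((mollBump N n).continuous_normed (μ := volume)).measurable.mul ?_).aestronglyMeasurable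
    exact (measurable_fderiv_apply_const ℝ ψ v).comp (by fun_prop)
  · refine ae_of_all _ fun t => LipschitzOnWith.of_dist_le_mul fun a _ b _ => ?_
    have hρ := (mollBump N n).nonneg_normed (μ := volume) t
    have h := hψ.dist_le_mul (x + a • v - t) (x + b • v - t)
    rw [Real.coe_nnabs, abs_of_nonneg (by positivity), Real.dist_eq, ← mul_sub, abs_mul,
      abs_of_nonneg hρ, mul_assoc]
    refine mul_le_mul_of_nonneg_left (h.trans (le_of_eq ?_)) hρ
    rw [dist_eq_norm, show x + a • v - t - (x + b • v - t) = (a - b) • v by module, norm_smul,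
      Real.norm_eq_abs, Real.dist_eq]
    ring
  · exact (integrable_mollBump_normed n).mul_const _
  · filter_upwards [hae] with t ht
    refine HasDerivAt.const_mul _ ?_
    have h1 : HasDerivAt (fun s : ℝ => x + s • v - t) v 0 := by
      simpa using (((hasDerivAt_id (0 : ℝ)).smul_const v).const_add x).sub_const t
    have h2 : HasFDerivAt ψ (fderiv ℝ ψ (x - t)) (x + (0 : ℝ) • v - t) := by
      rw [zero_smul, add_zero]
      exact ht.hasFDerivAt
    exact h2.comp_hasDerivAt 0 h1

lemma abs_fderiv_apply_le_of_lipschitz {ψ : EuclideanSpace ℝ (Fin N) → ℝ} {K : ℝ≥0}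
    (hψ : LipschitzWith K ψ) (x v : EuclideanSpace ℝ (Fin N)) :
    |fderiv ℝ ψ x v| ≤ K * ‖v‖ :=
  (ContinuousLinearMap.le_opNorm _ _).trans
    (mul_le_mul_of_nonneg_right (norm_fderiv_le_of_lipschitz ℝ hψ) (norm_nonneg v))

lemma abs_fderiv_mollify_le (n : ℕ) {ψ : EuclideanSpace ℝ (Fin N) → ℝ} {K : ℝ≥0}
    (hψ : LipschitzWith K ψ) (x v : EuclideanSpace ℝ (Fin N)) :
    |fderiv ℝ (mollify n ψ) x v| ≤ K * ‖v‖ := by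
  rw [fderiv_mollify n hψ, mollify_apply]
  exact abs_integral_mollBump_le n fun t => abs_fderiv_apply_le_of_lipschitz hψ _ v

lemma ae_tendsto_mollify {g : EuclideanSpace ℝ (Fin N) → ℝ} (hg : LocallyIntegrable g) :
    ∀ᵐ x, Tendsto (fun n => mollify n g x) atTop (𝓝 (g x)) := by
  refine ContDiffBump.ae_convolution_tendsto_right_of_locallyIntegrable (K := 2) ?_ ?_ hg
  · have := (tendsto_one_div_add_atTop_nhds_zero_nat (𝕜 := ℝ)).const_mul 2
    rw [mul_zero] at this
    refine this.congr fun n => ?_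
    change 2 * (1 / ((n : ℝ) + 1)) = 2 / (n + 1)
    ring
  · refine Eventually.of_forall fun n => le_of_eq ?_
    change 2 / ((n : ℝ) + 1) = 2 * (1 / ((n : ℝ) + 1))
    ring

lemma ae_tendsto_fderiv_mollify {ψ : EuclideanSpace ℝ (Fin N) → ℝ} {K : ℝ≥0}
    (hψ : LipschitzWith K ψ) (v : EuclideanSpace ℝ (Fin N)) :
    ∀ᵐ x, Tendsto (fun n => fderiv ℝ (mollify n ψ) x v) atTop (𝓝 (fderiv ℝ ψ x v)) := by
  have hm : Measurable fun y => fderiv ℝ ψ y v := measurable_fderiv_apply_const ℝ ψ v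
  have hg : LocallyIntegrable fun y => fderiv ℝ ψ y v := by
    refine (locallyIntegrable_const (K * ‖v‖ : ℝ)).mono hm.aestronglyMeasurable
      (ae_of_all _ fun x => ?_)
    rw [Real.norm_of_nonneg (by positivity : (0 : ℝ) ≤ K * ‖v‖)]
    exact abs_fderiv_apply_le_of_lipschitz hψ x v
  simp only [fderiv_mollify _ hψ]
  exact ae_tendsto_mollify hg

end Mollify

section WeakSubharmonic

variable {N : ℕ}

lemma inner_gradient_eq_sum (u ψ : EuclideanSpace ℝ (Fin N) → ℝ) (x : EuclideanSpace ℝ (Fin N)) :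
    ⟪gradient u x, gradient ψ x⟫ = ∑ i : Fin N, fderiv ℝ u x (EuclideanSpace.single i 1) *
      fderiv ℝ ψ x (EuclideanSpace.single i 1) := by
  rw [← (EuclideanSpace.basisFun (Fin N) ℝ).sum_inner_mul_inner]
  simp [inner_gradient_left, inner_gradient_right]

/-- Distributional subharmonicity on a ball centred at the origin. -/
def WeakSubharmonicOn (u : EuclideanSpace ℝ (Fin N) → ℝ) (R : ℝ) : Prop :=
  ∀ φ : EuclideanSpace ℝ (Fin N) → ℝ, ContDiff ℝ (⊤ : ℕ∞) φ → tsupport φ ⊆ ball 0 R →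
    (∀ x, 0 ≤ φ x) → 0 ≤ ∫ x, u x * lap N φ x

lemma integral_sum_fderiv_mul {u φ : EuclideanSpace ℝ (Fin N) → ℝ} {K : ℝ≥0}
    (hu : LipschitzWith K u) (hφ : ContDiff ℝ (⊤ : ℕ∞) φ) (hc : HasCompactSupport φ) :
    ∑ i : Fin N, ∫ x, fderiv ℝ u x (EuclideanSpace.single i 1) *
      fderiv ℝ φ x (EuclideanSpace.single i 1) = -∫ x, u x * lap N φ x := by
  have hsm : ∀ i : Fin N, ContDiff ℝ (⊤ : ℕ∞) fun y =>
      fderiv ℝ φ y (EuclideanSpace.single i 1) := fun i =>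
    (hφ.fderiv_right (m := (⊤ : ℕ∞)) (by simp)).clm_apply contDiff_const
  have hcs : ∀ i : Fin N, HasCompactSupport fun y =>
      fderiv ℝ φ y (EuclideanSpace.single i 1) := fun i => hc.fderiv_apply ℝ _
  have hsm2 : ∀ i : Fin N, Continuous fun y =>
      fderiv ℝ (fun y => fderiv ℝ φ y (EuclideanSpace.single i 1)) y
        (EuclideanSpace.single i 1) := fun i =>
    ((hsm i).continuous_fderiv (by simp)).clm_apply continuous_const
  have hcs2 : ∀ i : Fin N, HasCompactSupport fun y =>
      fderiv ℝ (fun y => fderiv ℝ φ y (EuclideanSpace.single i 1)) y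
        (EuclideanSpace.single i 1) := fun i => (hcs i).fderiv_apply ℝ _
  have hint : ∀ i : Fin N, Integrable fun y => u y *
      fderiv ℝ (fun y => fderiv ℝ φ y (EuclideanSpace.single i 1)) y
        (EuclideanSpace.single i 1) := fun i =>
    (hu.continuous.mul (hsm2 i)).integrable_of_hasCompactSupport (hcs2 i).mul_left
  simp only [lap, Finset.mul_sum]
  rw [integral_finsetSum _ fun i _ => hint i, ← Finset.sum_neg_distrib]
  refine Finset.sum_congr rfl fun i _ => ?_
  obtain ⟨C, hC⟩ := ContDiff.lipschitzWith_of_hasCompactSupport (𝕂 := ℝ) (hcs i) (hsm i) (by simp)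
  have h := hu.integral_lineDeriv_mul_eq (μ := volume) hC (hcs i) (EuclideanSpace.single i 1)
  rw [← integral_neg]
  calc _ = ∫ x, lineDeriv ℝ u x (EuclideanSpace.single i 1) *
        fderiv ℝ φ x (EuclideanSpace.single i 1) := by
        refine integral_congr_ae ?_
        filter_upwards [hu.ae_differentiableAt] with x hx
        rw [hx.lineDeriv_eq_fderiv]
    _ = _ := by
        rw [h]
        refine integral_congr_ae (ae_of_all _ fun x => ?_)
        have hd := (hsm i).differentiable (by simp) x
        simp only [hd.lineDeriv_eq_fderiv, map_neg]
        ring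

lemma integrable_inner_gradient {u ψ : EuclideanSpace ℝ (Fin N) → ℝ} {K L : ℝ≥0}
    (hu : LipschitzWith K u) (hψ : LipschitzWith L ψ) (hc : HasCompactSupport ψ)
    (v w : EuclideanSpace ℝ (Fin N)) :
    Integrable fun x => fderiv ℝ u x v * fderiv ℝ ψ x w := by
  have h1 : Measurable fun x => fderiv ℝ u x v := measurable_fderiv_apply_const ℝ u v
  have h2 : Measurable fun x => fderiv ℝ ψ x w := measurable_fderiv_apply_const ℝ ψ w
  refine Measure.integrableOn_of_bounded (s := tsupport ψ) (M := K * ‖v‖ * (L * ‖w‖))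
    hc.measure_lt_top.ne (h1.mul h2).aestronglyMeasurable (ae_of_all _ fun x => ?_)
    |>.integrable_of_forall_notMem_eq_zero fun x hx => ?_
  · rw [Pi.mul_apply, norm_mul]
    exact mul_le_mul (abs_fderiv_apply_le_of_lipschitz hu x v)
      (abs_fderiv_apply_le_of_lipschitz hψ x w) (abs_nonneg _) (by positivity)
  · have : fderiv ℝ ψ x = 0 := by
      by_contra h
      exact hx (support_fderiv_subset ℝ (f := ψ) h)
    simp [this]

/-- Weakly subharmonic Lipschitz functions may be tested against Lipschitz functions. -/
lemma WeakSubharmonicOn.integral_inner_gradient_nonpos {u ψ : EuclideanSpace ℝ (Fin N) → ℝ}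
    {R ρ : ℝ} {K L : ℝ≥0} (hs : WeakSubharmonicOn u R) (hu : LipschitzWith K u)
    (hψ : LipschitzWith L ψ) (hψ0 : ∀ x, 0 ≤ ψ x) (hρ : ρ < R)
    (hψρ : ∀ x, ρ < ‖x‖ → ψ x = 0) :
    ∫ x, ⟪gradient u x, gradient ψ x⟫ ≤ 0 := by
  have hsupp : ∀ {f : EuclideanSpace ℝ (Fin N) → ℝ} {s : ℝ}, (∀ x, s < ‖x‖ → f x = 0) →
      tsupport f ⊆ closedBall 0 s := fun {f s} h =>
    closure_minimal (fun x hx => by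
      rw [mem_closedBall_zero_iff]
      exact not_lt.1 fun h' => hx (h x h')) isClosed_closedBall
  have hcs : ∀ {f : EuclideanSpace ℝ (Fin N) → ℝ} {s : ℝ}, (∀ x, s < ‖x‖ → f x = 0) →
      HasCompactSupport f := fun h =>
    (isCompact_closedBall _ _).of_isClosed_subset (isClosed_tsupport _) (hsupp h)
  simp only [inner_gradient_eq_sum]
  rw [integral_finsetSum _ fun i _ => integrable_inner_gradient hu hψ (hcs hψρ) _ _]
  have hlim : Tendsto (fun n => ∑ i : Fin N, ∫ x, fderiv ℝ u x (EuclideanSpace.single i 1) *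
      fderiv ℝ (mollify n ψ) x (EuclideanSpace.single i 1)) atTop
      (𝓝 (∑ i : Fin N, ∫ x, fderiv ℝ u x (EuclideanSpace.single i 1) *
        fderiv ℝ ψ x (EuclideanSpace.single i 1))) := by
    refine tendsto_finsetSum _ fun i _ => ?_
    refine tendsto_integral_of_dominated_convergence
      ((closedBall (0 : EuclideanSpace ℝ (Fin N)) (ρ + 2)).indicator
        fun _ => K * ‖EuclideanSpace.single i (1 : ℝ)‖ * (L * ‖EuclideanSpace.single i (1 : ℝ)‖))
      (fun n => ?_) ?_ (fun n => ae_of_all _ fun x => ?_) ?_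
    · exact ((measurable_fderiv_apply_const ℝ u _).mul
        (measurable_fderiv_apply_const ℝ _ _)).aestronglyMeasurable
    · exact (integrable_indicator_iff measurableSet_closedBall).2
        (integrableOn_const (isCompact_closedBall _ _).measure_lt_top.ne)
    · by_cases hx : x ∈ closedBall (0 : EuclideanSpace ℝ (Fin N)) (ρ + 2)
      · rw [indicator_of_mem hx, norm_mul]
        exact mul_le_mul (abs_fderiv_apply_le_of_lipschitz hu x _)
          (abs_fderiv_mollify_le n hψ x _) (abs_nonneg _) (by positivity)
      · have h2 : (2 : ℝ) / (n + 1) ≤ 2 :=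
          div_le_self (by norm_num) (by linarith [n.cast_nonneg (α := ℝ)])
        have h0 : fderiv ℝ (mollify n ψ) x = 0 := by
          by_contra h
          refine hx (closedBall_subset_closedBall (by linarith) (hsupp (s := ρ + 2 / (n + 1))
            (fun y hy => mollify_eq_zero n hψρ hy)
            (support_fderiv_subset ℝ (f := mollify n ψ) h)))
        simp [h0, indicator_of_notMem hx]
    · filter_upwards [ae_tendsto_fderiv_mollify hψ (EuclideanSpace.single i 1)] with x hx
      exact hx.const_mul _
  refine le_of_tendsto hlim ?_
  have hsmall : ∀ᶠ n : ℕ in atTop, 2 / ((n : ℝ) + 1) < R - ρ := by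
    have := (tendsto_one_div_add_atTop_nhds_zero_nat (𝕜 := ℝ)).const_mul 2
    rw [mul_zero] at this
    filter_upwards [this.eventually_lt_const (sub_pos.2 hρ)] with n hn
    rwa [mul_one_div] at hn
  filter_upwards [hsmall] with n hn
  have hz : ∀ x, ρ + 2 / ((n : ℝ) + 1) < ‖x‖ → mollify n ψ x = 0 := fun x hx =>
    mollify_eq_zero n hψρ hx
  rw [integral_sum_fderiv_mul hu (contDiff_mollify n hψ.continuous) (hcs hz)]
  have := hs (mollify n ψ) (contDiff_mollify n hψ.continuous)
    ((hsupp hz).trans (closedBall_subset_ball (by linarith))) (mollify_nonneg n hψ0)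
  linarith

end WeakSubharmonic

section RadialCalculus

variable {N : ℕ}

lemma ae_radialMeasure_iff {P : ℝ → Prop} :
    (∀ᵐ s ∂(radialMeasure N), P s) ↔ ∀ᵐ s ∂(volume.restrict (Ioi (0 : ℝ))), P s := by
  rw [radialMeasure, ae_withDensity_iff (by fun_prop)]
  refine eventually_congr ?_
  filter_upwards [ae_restrict_mem measurableSet_Ioi] with s hs
  have : 0 < s ^ (N - 1) := pow_pos hs _
  simp [this]

lemma ae_sphere_of_ae (hN : 1 ≤ N) {P : EuclideanSpace ℝ (Fin N) → Prop} (h : ∀ᵐ x, P x) :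
    ∀ᵐ s ∂(volume.restrict (Ioi (0 : ℝ))),
      ∀ᵐ θ : sphere (0 : EuclideanSpace ℝ (Fin N)) 1 ∂(surfMeasure N),
        P (s • (θ : EuclideanSpace ℝ (Fin N))) := by
  have h1 := (measurePreserving_polar hN).quasiMeasurePreserving.ae h
  have h2 := (Measure.measurePreserving_swap (μ := radialMeasure N)
    (ν := surfMeasure N)).quasiMeasurePreserving.ae h1
  exact ae_radialMeasure_iff.1 (Measure.ae_ae_of_ae_prod h2)

lemma ae_interval_of_ae (hN : 1 ≤ N) {P : EuclideanSpace ℝ (Fin N) → Prop} (h : ∀ᵐ x, P x) :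
    ∀ᵐ θ : sphere (0 : EuclideanSpace ℝ (Fin N)) 1 ∂(surfMeasure N),
      ∀ᵐ s ∂(volume.restrict (Ioi (0 : ℝ))), P (s • (θ : EuclideanSpace ℝ (Fin N))) := by
  have h1 := Measure.ae_ae_of_ae_prod
    ((measurePreserving_polar hN).quasiMeasurePreserving.ae h)
  filter_upwards [h1] with θ hθ
  exact ae_radialMeasure_iff.1 hθ

lemma integral_ball_polar (hN : 1 ≤ N) {G : EuclideanSpace ℝ (Fin N) → ℝ} (hG : Measurable G)
    {r : ℝ} (hr : 0 ≤ r) {b : ℝ → ℝ}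
    (hb : IntegrableOn (fun s => s ^ (N - 1) * b s) (Ioc 0 r))
    (h : ∀ x, |G x| ≤ b ‖x‖) :
    ∫ x in ball 0 r, G x = ∫ s in 0..r, s ^ (N - 1) *
      ∫ θ, G (s • (θ : EuclideanSpace ℝ (Fin N))) ∂(surfMeasure N) := by
  have hGm : Measurable ((ball (0 : EuclideanSpace ℝ (Fin N)) r).indicator G) :=
    hG.indicator measurableSet_ball
  have hpm : Measurable fun p : sphere (0 : EuclideanSpace ℝ (Fin N)) 1 × ℝ =>
      p.2 • (p.1 : EuclideanSpace ℝ (Fin N)) := (measurePreserving_polar hN).measurable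
  have hint : Integrable (fun p : sphere (0 : EuclideanSpace ℝ (Fin N)) 1 × ℝ =>
      (ball (0 : EuclideanSpace ℝ (Fin N)) r).indicator G
        (p.2 • (p.1 : EuclideanSpace ℝ (Fin N)))) ((surfMeasure N).prod (radialMeasure N)) := by
    have hb' : Integrable ((Ioc 0 r).indicator b) (radialMeasure N) := by
      rw [integrable_radialMeasure_iff]
      have : Integrable ((Ioc 0 r).indicator fun s => s ^ (N - 1) * b s) :=
        hb.integrable_indicator measurableSet_Ioc
      refine this.integrableOn.congr_fun (fun s _ => ?_) measurableSet_Ioi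
      by_cases hs : s ∈ Ioc 0 r <;> simp [hs]
    refine ((integrable_const (1 : ℝ) (μ := surfMeasure N)).mul_prod hb').mono'
      (hGm.comp hpm).aestronglyMeasurable ?_
    filter_upwards [Measure.quasiMeasurePreserving_snd.ae (radialMeasure_ae_pos (N := N))]
      with p hp
    have hθ : ‖p.2 • (p.1 : EuclideanSpace ℝ (Fin N))‖ = p.2 := by
      rw [norm_smul, norm_eq_of_mem_sphere p.1, mul_one, Real.norm_of_nonneg hp.le]
    rw [one_mul]
    by_cases hs : p.2 • (p.1 : EuclideanSpace ℝ (Fin N)) ∈ ball 0 r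
    · have hs' := hs
      rw [mem_ball_zero_iff, hθ] at hs'
      rw [indicator_of_mem hs, indicator_of_mem (show p.2 ∈ Ioc 0 r from ⟨hp, hs'.le⟩)]
      have := h (p.2 • (p.1 : EuclideanSpace ℝ (Fin N)))
      rwa [hθ] at this
    · rw [indicator_of_notMem hs, norm_zero]
      by_cases hs' : p.2 ∈ Ioc 0 r
      · rw [indicator_of_mem hs']
        have := h (p.2 • (p.1 : EuclideanSpace ℝ (Fin N)))
        rw [hθ] at this
        exact (abs_nonneg _).trans this
      · rw [indicator_of_notMem hs']
  rw [← integral_indicator measurableSet_ball, integral_polar hN hGm, integral_prod_symm _ hint,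
    integral_radialMeasure, intervalIntegral.integral_of_le hr]
  rw [← integral_indicator measurableSet_Ioi, ← integral_indicator measurableSet_Ioc]
  refine integral_congr_ae ?_
  have hne : ∀ᵐ s : ℝ, s ≠ r := by simp [ae_iff, measure_singleton]
  filter_upwards [hne] with s hsr
  by_cases hs : s ∈ Ioi (0 : ℝ)
  · have hθ : ∀ θ : sphere (0 : EuclideanSpace ℝ (Fin N)) 1,
        ‖s • (θ : EuclideanSpace ℝ (Fin N))‖ = s := fun θ => by
      rw [norm_smul, norm_eq_of_mem_sphere θ, mul_one, Real.norm_of_nonneg (le_of_lt hs)]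
    rw [indicator_of_mem hs]
    by_cases hs' : s < r
    · rw [indicator_of_mem (show s ∈ Ioc 0 r from ⟨hs, hs'.le⟩)]
      congr 1
      refine integral_congr_ae (ae_of_all _ fun θ => ?_)
      exact indicator_of_mem (by rw [mem_ball_zero_iff, hθ]; exact hs') _
    · have hs2 : r < s := lt_of_le_of_ne (not_lt.1 hs') (Ne.symm hsr)
      rw [indicator_of_notMem (show s ∉ Ioc 0 r from fun h => absurd h.2 (not_le.2 hs2))]
      rw [integral_eq_zero_of_ae, mul_zero]
      refine ae_of_all _ fun θ => ?_
      exact indicator_of_notMem (by rw [mem_ball_zero_iff, hθ]; exact hs') _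
  · rw [indicator_of_notMem hs, indicator_of_notMem fun h => hs h.1]

/-- The angular integral of `|∇u|²` at radius `t`. -/
def sphGradSq (u : EuclideanSpace ℝ (Fin N) → ℝ) (t : ℝ) : ℝ :=
  ∫ θ, ‖gradient u (t • (θ : EuclideanSpace ℝ (Fin N)))‖ ^ 2 ∂(surfMeasure N)

/-- The angular integral of `u ∂ᵣu` at radius `t`. -/
def sphFlux (u : EuclideanSpace ℝ (Fin N) → ℝ) (t : ℝ) : ℝ :=
  ∫ θ, u (t • (θ : EuclideanSpace ℝ (Fin N))) *
    ⟪gradient u (t • (θ : EuclideanSpace ℝ (Fin N))), (θ : EuclideanSpace ℝ (Fin N))⟫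
    ∂(surfMeasure N)

lemma measurable_gradient_polar (u : EuclideanSpace ℝ (Fin N) → ℝ) :
    Measurable fun p : ℝ × sphere (0 : EuclideanSpace ℝ (Fin N)) 1 =>
      gradient u (p.1 • (p.2 : EuclideanSpace ℝ (Fin N))) :=
  (measurable_gradient u).comp (by fun_prop)

lemma measurable_sphGradSq (u : EuclideanSpace ℝ (Fin N) → ℝ) : Measurable (sphGradSq u) := by
  have h : Measurable fun p : ℝ × sphere (0 : EuclideanSpace ℝ (Fin N)) 1 =>
      ‖gradient u (p.1 • (p.2 : EuclideanSpace ℝ (Fin N)))‖ ^ 2 :=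
    (measurable_gradient_polar u).norm.pow_const 2
  exact (h.stronglyMeasurable.integral_prod_right' (ν := surfMeasure N)).measurable

lemma measurable_sphFlux {u : EuclideanSpace ℝ (Fin N) → ℝ} (hu : Continuous u) :
    Measurable (sphFlux u) := by
  have h : Measurable fun p : ℝ × sphere (0 : EuclideanSpace ℝ (Fin N)) 1 =>
      u (p.1 • (p.2 : EuclideanSpace ℝ (Fin N))) *
        ⟪gradient u (p.1 • (p.2 : EuclideanSpace ℝ (Fin N))),
          (p.2 : EuclideanSpace ℝ (Fin N))⟫ := by
    have h1 := measurable_gradient_polar u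
    have h2 := hu.measurable
    fun_prop
  exact (h.stronglyMeasurable.integral_prod_right' (ν := surfMeasure N)).measurable

lemma sphGradSq_nonneg (u : EuclideanSpace ℝ (Fin N) → ℝ) (t : ℝ) : 0 ≤ sphGradSq u t :=
  integral_nonneg fun _ => sq_nonneg _

lemma integrable_sphGradSq {u : EuclideanSpace ℝ (Fin N) → ℝ} {K : ℝ≥0}
    (hu : LipschitzWith K u) (t : ℝ) :
    Integrable (fun θ : sphere (0 : EuclideanSpace ℝ (Fin N)) 1 =>
      ‖gradient u (t • (θ : EuclideanSpace ℝ (Fin N)))‖ ^ 2) (surfMeasure N) := by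
  refine integrable_sphere_of_bound (C := (K : ℝ) ^ 2) ?_ fun θ => ?_
  · exact ((measurable_gradient u).comp (by fun_prop)).norm.pow_const 2
  · rw [abs_of_nonneg (sq_nonneg _)]
    exact pow_le_pow_left₀ (norm_nonneg _) (norm_gradient_le_of_lipschitz hu _) 2

lemma abs_inner_gradient_le {u : EuclideanSpace ℝ (Fin N) → ℝ} {K : ℝ≥0}
    (hu : LipschitzWith K u) (x : EuclideanSpace ℝ (Fin N))
    (θ : sphere (0 : EuclideanSpace ℝ (Fin N)) 1) :
    |⟪gradient u x, (θ : EuclideanSpace ℝ (Fin N))⟫| ≤ K := by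
  refine (abs_real_inner_le_norm _ _).trans ?_
  rw [norm_eq_of_mem_sphere θ, mul_one]
  exact norm_gradient_le_of_lipschitz hu x

lemma abs_smul_sphere_le {u : EuclideanSpace ℝ (Fin N) → ℝ} {K : ℝ≥0}
    (hu : LipschitzWith K u) (h0 : u 0 = 0) (t : ℝ)
    (θ : sphere (0 : EuclideanSpace ℝ (Fin N)) 1) :
    |u (t • (θ : EuclideanSpace ℝ (Fin N)))| ≤ K * |t| := by
  have := hu.dist_le_mul (t • (θ : EuclideanSpace ℝ (Fin N))) 0
  rwa [Real.dist_eq, h0, sub_zero, dist_zero_right, norm_smul, norm_eq_of_mem_sphere θ, mul_one,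
    Real.norm_eq_abs] at this

lemma integrable_sphFlux {u : EuclideanSpace ℝ (Fin N) → ℝ} {K : ℝ≥0}
    (hu : LipschitzWith K u) (h0 : u 0 = 0) (t : ℝ) :
    Integrable (fun θ : sphere (0 : EuclideanSpace ℝ (Fin N)) 1 =>
      u (t • (θ : EuclideanSpace ℝ (Fin N))) *
        ⟪gradient u (t • (θ : EuclideanSpace ℝ (Fin N))), (θ : EuclideanSpace ℝ (Fin N))⟫)
      (surfMeasure N) := by
  refine integrable_sphere_of_bound (C := K * |t| * K) ?_ fun θ => ?_
  · have h1 : Measurable fun θ : sphere (0 : EuclideanSpace ℝ (Fin N)) 1 =>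
        gradient u (t • (θ : EuclideanSpace ℝ (Fin N))) :=
      (measurable_gradient u).comp (by fun_prop)
    have h2 := hu.continuous.measurable
    fun_prop
  · rw [abs_mul]
    exact mul_le_mul (abs_smul_sphere_le hu h0 t θ) (abs_inner_gradient_le hu _ θ) (abs_nonneg _)
      (by positivity)

lemma sphGradSq_le {u : EuclideanSpace ℝ (Fin N) → ℝ} {K : ℝ≥0}
    (hu : LipschitzWith K u) (t : ℝ) : sphGradSq u t ≤ (surfMeasure N).real univ * K ^ 2 := by
  refine (integral_mono (integrable_sphGradSq hu t) (integrable_const ((K : ℝ) ^ 2))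
    fun θ => ?_).trans (le_of_eq (by simp))
  exact pow_le_pow_left₀ (norm_nonneg _) (norm_gradient_le_of_lipschitz hu _) 2

lemma abs_sphFlux_le {u : EuclideanSpace ℝ (Fin N) → ℝ} {K : ℝ≥0}
    (hu : LipschitzWith K u) (h0 : u 0 = 0) (t : ℝ) :
    |sphFlux u t| ≤ (surfMeasure N).real univ * (K * |t| * K) := by
  have hC : ∫ _ : sphere (0 : EuclideanSpace ℝ (Fin N)) 1, (K * |t| * K : ℝ) ∂(surfMeasure N) =
      (surfMeasure N).real univ * (K * |t| * K) := by rw [integral_const, smul_eq_mul]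
  rw [← hC]
  refine abs_integral_le_integral_abs.trans
    (integral_mono (integrable_sphFlux hu h0 t).abs (integrable_const _) fun θ => ?_)
  simp only [abs_mul]
  exact mul_le_mul (abs_smul_sphere_le hu h0 t θ) (abs_inner_gradient_le hu _ θ) (abs_nonneg _)
    (by positivity)

lemma locallyIntegrable_sphGradSq {u : EuclideanSpace ℝ (Fin N) → ℝ} {K : ℝ≥0}
    (hu : LipschitzWith K u) : LocallyIntegrable (sphGradSq u) := by
  refine (locallyIntegrable_const ((surfMeasure N).real univ * K ^ 2)).mono
    (measurable_sphGradSq u).aestronglyMeasurable (ae_of_all _ fun t => ?_)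
  rw [Real.norm_of_nonneg (sphGradSq_nonneg u t)]
  exact (sphGradSq_le hu t).trans (le_abs_self _)

lemma locallyIntegrable_sphFlux {u : EuclideanSpace ℝ (Fin N) → ℝ} {K : ℝ≥0}
    (hu : LipschitzWith K u) (h0 : u 0 = 0) : LocallyIntegrable (sphFlux u) := by
  have hc : Continuous fun t : ℝ => (surfMeasure N).real univ * (K * |t| * K) := by fun_prop
  refine hc.locallyIntegrable.mono (measurable_sphFlux hu.continuous).aestronglyMeasurable
    (ae_of_all _ fun t => ?_)
  exact (abs_sphFlux_le hu h0 t).trans (le_abs_self _)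

lemma intervalIntegrable_mul_sphGradSq {u : EuclideanSpace ℝ (Fin N) → ℝ} {K : ℝ≥0}
    (hu : LipschitzWith K u) {g : ℝ → ℝ} (hg : Continuous g) (a b : ℝ) :
    IntervalIntegrable (fun t => g t * sphGradSq u t) volume a b :=
  ((locallyIntegrable_sphGradSq hu).integrableOn_isCompact
    isCompact_uIcc).intervalIntegrable.continuousOn_mul
    hg.continuousOn

lemma intervalIntegrable_mul_sphFlux {u : EuclideanSpace ℝ (Fin N) → ℝ} {K : ℝ≥0}
    (hu : LipschitzWith K u) (h0 : u 0 = 0) {g : ℝ → ℝ} (hg : Continuous g) (a b : ℝ) :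
    IntervalIntegrable (fun t => g t * sphFlux u t) volume a b :=
  ((locallyIntegrable_sphFlux hu h0).integrableOn_isCompact
    isCompact_uIcc).intervalIntegrable.continuousOn_mul
    hg.continuousOn

/-- The Dirichlet energy with weight `|x| ^ (2 - N)` in polar coordinates. -/
lemma weighted_energy_polar (hN : 2 ≤ N) {u : EuclideanSpace ℝ (Fin N) → ℝ} {K : ℝ≥0}
    (hu : LipschitzWith K u) {r : ℝ} (hr : 0 ≤ r) :
    ∫ x in ball 0 r, ‖gradient u x‖ ^ 2 * ‖x‖ ^ ((2 : ℤ) - (N : ℤ)) =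
      ∫ s in 0..r, s * sphGradSq u s := by
  have hpow : ∀ s : ℝ, 0 < s → s ^ (N - 1) * s ^ ((2 : ℤ) - (N : ℤ)) = s := fun s hs => by
    rw [← zpow_natCast, ← zpow_add₀ hs.ne', Nat.cast_sub (by omega)]
    rw [show ((N : ℤ) - ((1 : ℕ) : ℤ)) + (2 - N) = 1 by push_cast; ring, zpow_one]
  rw [integral_ball_polar (by omega) (b := fun s => K ^ 2 * s ^ ((2 : ℤ) - (N : ℤ))) ?_ hr ?_ ?_]
  · rw [intervalIntegral.integral_of_le hr, intervalIntegral.integral_of_le hr]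
    refine setIntegral_congr_fun measurableSet_Ioc fun s hs => ?_
    simp only [sphGradSq]
    rw [← integral_const_mul, ← integral_const_mul]
    refine integral_congr_ae (ae_of_all _ fun θ => ?_)
    simp only
    rw [norm_smul, norm_eq_of_mem_sphere θ, mul_one, Real.norm_of_nonneg hs.1.le]
    nth_rewrite 4 [← hpow s hs.1]
    ring
  · exact ((measurable_gradient u).norm.pow_const 2).mul (by fun_prop)
  · have : IntegrableOn (fun s : ℝ => (K : ℝ) ^ 2 * s) (Ioc 0 r) :=
      (by fun_prop : Continuous fun s : ℝ => (K : ℝ) ^ 2 * s).integrableOn_Ioc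
    refine this.congr_fun (fun s hs => ?_) measurableSet_Ioc
    simp only
    nth_rewrite 1 [← hpow s hs.1]
    ring
  · intro x
    rw [abs_of_nonneg (by positivity)]
    gcongr
    exact norm_gradient_le_of_lipschitz hu x

end RadialCalculus

section RadialTest

lemma inner_gradient_mul_radial {E : Type*} [NormedAddCommGroup E] [InnerProductSpace ℝ E]
    [CompleteSpace E] {u : E → ℝ} {χ : ℝ → ℝ} {θ : E} (hθ : ‖θ‖ = 1) {s : ℝ} (hs : 0 < s)
    (hu : DifferentiableAt ℝ u (s • θ)) (hχ : DifferentiableAt ℝ χ s) :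
    ⟪gradient u (s • θ), gradient (fun x => u x * χ ‖x‖) (s • θ)⟫ =
      χ s * ‖gradient u (s • θ)‖ ^ 2 +
        deriv χ s * (u (s • θ) * ⟪gradient u (s • θ), θ⟫) := by
  have hnx : ‖s • θ‖ = s := by rw [norm_smul, hθ, mul_one, Real.norm_of_nonneg hs.le]
  have hχ' : HasDerivAt χ (deriv χ s) ‖s • θ‖ := by rw [hnx]; exact hχ.hasDerivAt
  have hF := hu.hasFDerivAt.mul (hχ'.comp_hasFDerivAt (s • θ) (hasFDerivAt_norm_smul_unit hθ hs))
  have e : fderiv ℝ (fun x => u x * χ ‖x‖) (s • θ) = _ := HasFDerivAt.fderiv hF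
  rw [inner_gradient_right, e]
  simp only [Function.comp_apply, hnx]
  have e2 : fderiv ℝ u (s • θ) (gradient u (s • θ)) = ‖gradient u (s • θ)‖ ^ 2 := by
    rw [← inner_gradient_left, real_inner_self_eq_norm_sq]
  simp [e2]
  ring

variable {N : ℕ}

lemma lipschitzWith_mul_radial {u : EuclideanSpace ℝ (Fin N) → ℝ} {K C : ℝ≥0}
    (hu : LipschitzWith K u) (h0 : u 0 = 0) {χ : ℝ → ℝ} (hχ : LipschitzWith C χ) {M ρ : ℝ}
    (hM : ∀ s, |χ s| ≤ M) (hρ0 : 0 ≤ ρ) (hρ : ∀ s, ρ < s → χ s = 0) :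
    LipschitzWith (Real.toNNReal (K * ρ * C + K * M)) fun x => u x * χ ‖x‖ := by
  have key : ∀ x y, ‖x‖ ≤ ρ →
      dist (u x * χ ‖x‖) (u y * χ ‖y‖) ≤ (K * ρ * C + K * M) * dist x y := by
    intro x y hx
    have e : u x * χ ‖x‖ - u y * χ ‖y‖ = u x * (χ ‖x‖ - χ ‖y‖) + (u x - u y) * χ ‖y‖ := by ring
    have h1 : |u x| ≤ K * ρ := by
      have := hu.dist_le_mul x 0
      rw [Real.dist_eq, h0, sub_zero, dist_zero_right] at this
      exact this.trans (mul_le_mul_of_nonneg_left hx K.2)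
    have h2 : |χ ‖x‖ - χ ‖y‖| ≤ C * dist x y := by
      rw [← Real.dist_eq]
      refine (hχ.dist_le_mul _ _).trans (mul_le_mul_of_nonneg_left ?_ C.2)
      rw [dist_eq_norm x y]
      exact abs_norm_sub_norm_le x y
    have h3 : |u x - u y| ≤ K * dist x y := hu.dist_le_mul x y
    rw [Real.dist_eq, e]
    refine (abs_add_le _ _).trans ?_
    rw [abs_mul, abs_mul]
    have h4 := mul_le_mul h1 h2 (abs_nonneg _) ((abs_nonneg _).trans h1)
    have h5 := mul_le_mul h3 (hM ‖y‖) (abs_nonneg _) (by positivity)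
    linarith
  refine LipschitzWith.of_dist_le' fun x y => ?_
  rcases le_or_gt ‖x‖ ρ with hx | hx
  · exact key x y hx
  rcases le_or_gt ‖y‖ ρ with hy | hy
  · rw [dist_comm, dist_comm x y]
    exact key y x hy
  rw [hρ _ hx, hρ _ hy, mul_zero, mul_zero, dist_self]
  have hM0 : 0 ≤ M := (abs_nonneg _).trans (hM 0)
  positivity

/-- Testing subharmonicity with `u` times a radial cutoff. -/
lemma WeakSubharmonicOn.radial_test (hN : 1 ≤ N) {u : EuclideanSpace ℝ (Fin N) → ℝ} {R : ℝ}
    {K C : ℝ≥0} (hs : WeakSubharmonicOn u R) (hu : LipschitzWith K u) (hu0 : ∀ x, 0 ≤ u x)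
    (h0 : u 0 = 0) {χ : ℝ → ℝ} (hχ : LipschitzWith C χ) (hχ0 : ∀ s, 0 ≤ χ s) {M ρ : ℝ}
    (hM : ∀ s, χ s ≤ M) (hρ0 : 0 ≤ ρ) (hρR : ρ < R) (hρ : ∀ s, ρ < s → χ s = 0) :
    ∫ s in 0..R, s ^ (N - 1) * (χ s * sphGradSq u s + deriv χ s * sphFlux u s) ≤ 0 := by
  have hR : 0 ≤ R := hρ0.trans hρR.le
  have hψL := lipschitzWith_mul_radial hu h0 hχ
    (fun s => by rw [abs_of_nonneg (hχ0 s)]; exact hM s) hρ0 hρ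
  have hψρ : ∀ x : EuclideanSpace ℝ (Fin N), ρ < ‖x‖ → u x * χ ‖x‖ = 0 := fun x hx => by
    rw [hρ _ hx, mul_zero]
  set L := Real.toNNReal (K * ρ * C + K * M)
  have key := hs.integral_inner_gradient_nonpos hu hψL
    (fun x => mul_nonneg (hu0 x) (hχ0 _)) hρR hψρ
  have hout : ∀ x, x ∉ ball (0 : EuclideanSpace ℝ (Fin N)) R →
      ⟪gradient u x, gradient (fun x => u x * χ ‖x‖) x⟫ = 0 := by
    intro x hx
    rw [mem_ball_zero_iff, not_lt] at hx
    have : gradient (fun x => u x * χ ‖x‖) x = 0 := by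
      have he : (fun x : EuclideanSpace ℝ (Fin N) => u x * χ ‖x‖) =ᶠ[𝓝 x] fun _ => 0 := by
        filter_upwards [continuous_norm.continuousAt.eventually_const_lt
          (show ρ < ‖x‖ by linarith)] with y hy
        exact hψρ y hy
      rw [gradient, he.fderiv_eq, fderiv_fun_const, Pi.zero_apply, map_zero]
    rw [this, inner_zero_right]
  rw [← setIntegral_eq_integral_of_forall_compl_eq_zero hout, integral_ball_polar hN
    ((measurable_gradient u).inner (measurable_gradient _)) hR (b := fun _ => K * L) ?_ ?_] at key
  · refine le_trans (le_of_eq ?_) key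
    rw [intervalIntegral.integral_of_le hR, intervalIntegral.integral_of_le hR]
    refine setIntegral_congr_ae measurableSet_Ioc ?_
    have hd := (ae_restrict_iff' measurableSet_Ioi).1 (ae_sphere_of_ae hN hu.ae_differentiableAt)
    have hχd : ∀ᵐ s : ℝ, DifferentiableAt ℝ χ s := hχ.ae_differentiableAt
    filter_upwards [hd, hχd] with s hd hχd hs
    congr 1
    rw [sphGradSq, sphFlux, ← integral_const_mul, ← integral_const_mul, ← integral_add
      ((integrable_sphGradSq hu s).const_mul _) ((integrable_sphFlux hu h0 s).const_mul _)]
    refine integral_congr_ae ?_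
    filter_upwards [hd hs.1] with θ hθ
    rw [inner_gradient_mul_radial (norm_eq_of_mem_sphere θ) hs.1 hθ hχd]
  · exact (by fun_prop : Continuous fun s : ℝ => s ^ (N - 1) * (K * L : ℝ)).integrableOn_Ioc
  · intro x
    exact (abs_real_inner_le_norm _ _).trans (mul_le_mul (norm_gradient_le_of_lipschitz hu x)
      (norm_gradient_le_of_lipschitz hψL x) (norm_nonneg _) K.2)

/-- The radial derivative of the angular mass. -/
lemma sphMass_eq_integral_sphFlux (hN : 1 ≤ N) {u : EuclideanSpace ℝ (Fin N) → ℝ} {K : ℝ≥0}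
    (hu : LipschitzWith K u) (h0 : u 0 = 0) {r : ℝ} (hr : 0 ≤ r) :
    sphMass u r = 2 * ∫ s in 0..r, sphFlux u s := by
  have hmeas : Measurable fun p : sphere (0 : EuclideanSpace ℝ (Fin N)) 1 × ℝ =>
      u (p.2 • (p.1 : EuclideanSpace ℝ (Fin N))) *
        ⟪gradient u (p.2 • (p.1 : EuclideanSpace ℝ (Fin N))),
          (p.1 : EuclideanSpace ℝ (Fin N))⟫ := by
    have h1 : Measurable fun p : sphere (0 : EuclideanSpace ℝ (Fin N)) 1 × ℝ =>
        gradient u (p.2 • (p.1 : EuclideanSpace ℝ (Fin N))) :=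
      (measurable_gradient u).comp (by fun_prop)
    have h2 := hu.continuous.measurable
    fun_prop
  have hint : Integrable (fun p : sphere (0 : EuclideanSpace ℝ (Fin N)) 1 × ℝ =>
      u (p.2 • (p.1 : EuclideanSpace ℝ (Fin N))) *
        ⟪gradient u (p.2 • (p.1 : EuclideanSpace ℝ (Fin N))),
          (p.1 : EuclideanSpace ℝ (Fin N))⟫)
      ((surfMeasure N).prod (volume.restrict (Ioc 0 r))) := by
    refine Integrable.of_bound hmeas.aestronglyMeasurable (K * r * K) ?_
    filter_upwards [Measure.quasiMeasurePreserving_snd.ae (ae_restrict_mem measurableSet_Ioc)]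
      with p hp
    rw [norm_mul]
    refine mul_le_mul ((abs_smul_sphere_le hu h0 p.2 p.1).trans ?_)
      (abs_inner_gradient_le hu _ p.1) (abs_nonneg _) (by positivity)
    rw [abs_of_pos hp.1]
    exact mul_le_mul_of_nonneg_left hp.2 K.2
  have hθ : ∀ᵐ θ : sphere (0 : EuclideanSpace ℝ (Fin N)) 1 ∂(surfMeasure N),
      u (r • (θ : EuclideanSpace ℝ (Fin N))) ^ 2 =
        2 * ∫ s in Ioc 0 r, u (s • (θ : EuclideanSpace ℝ (Fin N))) *
          ⟪gradient u (s • (θ : EuclideanSpace ℝ (Fin N))),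
            (θ : EuclideanSpace ℝ (Fin N))⟫ := by
    filter_upwards [ae_interval_of_ae hN hu.ae_differentiableAt] with θ hd
    have hL : LipschitzWith K fun s : ℝ => u (s • (θ : EuclideanSpace ℝ (Fin N))) := by
      refine LipschitzWith.of_dist_le_mul fun s t => (hu.dist_le_mul _ _).trans (le_of_eq ?_)
      rw [dist_eq_norm, ← sub_smul, norm_smul, norm_eq_of_mem_sphere θ, mul_one, dist_eq_norm]
    have hac : AbsolutelyContinuousOnInterval
        (fun s : ℝ => u (s • (θ : EuclideanSpace ℝ (Fin N)))) 0 r :=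
      (hL.lipschitzOnWith (s := uIcc 0 r)).absolutelyContinuousOnInterval
    have := (hac.fun_mul hac).integral_deriv_eq_sub
    rw [zero_smul, h0, mul_zero, sub_zero, ← sq] at this
    rw [← this, ← integral_const_mul, intervalIntegral.integral_of_le hr]
    refine setIntegral_congr_ae measurableSet_Ioc ?_
    filter_upwards [(ae_restrict_iff' measurableSet_Ioi).1 hd] with s hs hs'
    have h1 : HasDerivAt (fun s : ℝ => u (s • (θ : EuclideanSpace ℝ (Fin N))))
        (fderiv ℝ u (s • (θ : EuclideanSpace ℝ (Fin N))) (θ : EuclideanSpace ℝ (Fin N))) s := by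
      have h2 : HasDerivAt (fun s : ℝ => s • (θ : EuclideanSpace ℝ (Fin N)))
          (θ : EuclideanSpace ℝ (Fin N)) s := by
        simpa using (hasDerivAt_id s).smul_const (θ : EuclideanSpace ℝ (Fin N))
      exact (hs hs'.1).hasFDerivAt.comp_hasDerivAt s h2
    rw [(h1.fun_mul h1).deriv, inner_gradient_left]
    ring
  rw [sphMass, integral_congr_ae hθ, integral_const_mul, integral_integral_swap hint,
    intervalIntegral.integral_of_le hr]
  rfl

end RadialTest

section RadialInequalities

variable {N : ℕ}

/-- Radial test for a cutoff that is constant before `a` and vanishes after `b`. -/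
lemma WeakSubharmonicOn.radial_test_of_deriv (hN : 1 ≤ N) {u : EuclideanSpace ℝ (Fin N) → ℝ}
    {R : ℝ} {K C : ℝ≥0} (hs : WeakSubharmonicOn u R) (hu : LipschitzWith K u)
    (hu0 : ∀ x, 0 ≤ u x) (h0 : u 0 = 0) {χ g : ℝ → ℝ} (hχ : LipschitzWith C χ)
    (hχ0 : ∀ s, 0 ≤ χ s) {M a b : ℝ} (hM : ∀ s, χ s ≤ M) (ha : 0 ≤ a) (hab : a ≤ b) (hbR : b < R)
    (hχb : ∀ s, b < s → χ s = 0) (hχa : ∀ s, s < a → deriv χ s = 0) (hg : Continuous g)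
    (hχg : ∀ s ∈ Ioo a b, s ^ (N - 1) * deriv χ s = -g s) :
    ∫ s in 0..R, χ s * s ^ (N - 1) * sphGradSq u s ≤ ∫ s in a..b, g s * sphFlux u s := by
  have hb0 : 0 ≤ b := ha.trans hab
  have hR0 : 0 ≤ R := hb0.trans hbR.le
  have key := hs.radial_test hN hu hu0 h0 hχ hχ0 hM hb0 hbR hχb
  have h1 := intervalIntegrable_mul_sphGradSq hu
    (g := fun s => χ s * s ^ (N - 1)) (hχ.continuous.mul (by fun_prop)) 0 R
  have h2 := intervalIntegrable_mul_sphFlux hu h0 hg a b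
  have h3 : Integrable ((Ioc a b).indicator fun s => g s * sphFlux u s)
      (volume.restrict (Ioc 0 R)) :=
    (((intervalIntegrable_iff_integrableOn_Ioc_of_le hab).1 h2).integrable_indicator
      measurableSet_Ioc).restrict
  have he : ∫ s in 0..R, s ^ (N - 1) * (χ s * sphGradSq u s + deriv χ s * sphFlux u s) =
      (∫ s in 0..R, χ s * s ^ (N - 1) * sphGradSq u s) - ∫ s in a..b, g s * sphFlux u s := by
    rw [intervalIntegral.integral_of_le hR0, intervalIntegral.integral_of_le hR0,
      intervalIntegral.integral_of_le hab]
    have h4 : ∫ s in Ioc a b, g s * sphFlux u s =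
        ∫ s in Ioc 0 R, (Ioc a b).indicator (fun s => g s * sphFlux u s) s := by
      rw [setIntegral_indicator measurableSet_Ioc, inter_eq_right.2 (Ioc_subset_Ioc ha hbR.le)]
    rw [h4, ← integral_sub ((intervalIntegrable_iff_integrableOn_Ioc_of_le hR0).1 h1) h3]
    refine integral_congr_ae ?_
    have hna : ∀ᵐ s : ℝ, s ≠ a := by simp [ae_iff, measure_singleton]
    have hnb : ∀ᵐ s : ℝ, s ≠ b := by simp [ae_iff, measure_singleton]
    filter_upwards [ae_restrict_of_ae hna, ae_restrict_of_ae hnb] with s hsa hsb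
    rcases lt_or_gt_of_ne hsa with h | h
    · rw [indicator_of_notMem (fun h' => absurd h'.1 (not_lt.2 h.le)), hχa s h]
      ring
    rcases lt_or_gt_of_ne hsb with h' | h'
    · rw [indicator_of_mem (show s ∈ Ioc a b from ⟨h, h'.le⟩)]
      have := hχg s ⟨h, h'⟩
      linear_combination sphFlux u s * this
    · rw [indicator_of_notMem (fun h'' => absurd h''.2 (not_le.2 h'))]
      have : deriv χ s = 0 := by
        have he : χ =ᶠ[𝓝 s] fun _ => 0 := by
          filter_upwards [eventually_gt_nhds h'] with y hy
          exact hχb y hy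
        rw [he.deriv_eq, deriv_const]
      rw [this]
      ring
  rw [he] at key
  linarith

lemma WeakSubharmonicOn.integral_sphGradSq_le_average (hN : 1 ≤ N)
    {u : EuclideanSpace ℝ (Fin N) → ℝ}
    {R : ℝ} {K : ℝ≥0} (hs : WeakSubharmonicOn u R) (hu : LipschitzWith K u)
    (hu0 : ∀ x, 0 ≤ u x) (h0 : u 0 = 0) {r δ : ℝ} (hr : 0 < r) (hδ : 0 < δ) (hrδ : r + δ < R) :
    ∫ s in 0..r, s ^ (N - 1) * sphGradSq u s ≤
      δ⁻¹ * ∫ s in r..r + δ, s ^ (N - 1) * sphFlux u s := by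
  set χ : ℝ → ℝ := fun s => max 0 (min 1 (δ⁻¹ * (r + δ - s))) with hχdef
  have hχ0 : ∀ s, 0 ≤ χ s := fun s => le_max_left _ _
  have hχL : LipschitzWith (Real.toNNReal δ⁻¹) χ := by
    refine LipschitzWith.const_max (LipschitzWith.const_min ?_ 1) 0
    refine LipschitzWith.of_dist_le' fun x y => le_of_eq ?_
    rw [Real.dist_eq, Real.dist_eq, ← mul_sub, abs_mul, abs_of_pos (inv_pos.2 hδ),
      show r + δ - x - (r + δ - y) = -(x - y) by ring, abs_neg]
  have hχ1 : ∀ s, s ≤ r → χ s = 1 := fun s hsr => by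
    have : 1 ≤ δ⁻¹ * (r + δ - s) := by
      rw [inv_mul_eq_div, le_div_iff₀ hδ]
      linarith
    simp only [hχdef]
    rw [min_eq_left this, max_eq_right zero_le_one]
  have key := hs.radial_test_of_deriv hN hu hu0 h0 (g := fun s => δ⁻¹ * s ^ (N - 1)) hχL hχ0
    (M := 1) (fun s => max_le zero_le_one (min_le_left _ _)) hr.le (le_add_of_nonneg_right hδ.le)
    hrδ ?_ ?_ (by fun_prop) ?_
  · have h1 := fun a b => intervalIntegrable_mul_sphGradSq hu
      (g := fun s => χ s * s ^ (N - 1)) (hχL.continuous.mul (by fun_prop)) a b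
    rw [← intervalIntegral.integral_add_adjacent_intervals (h1 0 r) (h1 r R)] at key
    have h2 : 0 ≤ ∫ s in r..R, χ s * s ^ (N - 1) * sphGradSq u s :=
      intervalIntegral.integral_nonneg (by linarith) fun s hs' =>
        mul_nonneg (mul_nonneg (hχ0 s) (pow_nonneg (hr.le.trans hs'.1) _)) (sphGradSq_nonneg u s)
    have h3 : ∫ s in 0..r, χ s * s ^ (N - 1) * sphGradSq u s =
        ∫ s in 0..r, s ^ (N - 1) * sphGradSq u s := by
      refine intervalIntegral.integral_congr fun s hs' => ?_
      rw [uIcc_of_le hr.le] at hs'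
      simp only [hχ1 s hs'.2, one_mul]
    rw [h3] at key
    simp only [mul_assoc] at key
    rw [intervalIntegral.integral_const_mul] at key
    simp only [mul_assoc] at h2
    linarith
  · intro s hs'
    refine max_eq_left ((min_le_right _ _).trans ?_)
    exact mul_nonpos_of_nonneg_of_nonpos (inv_pos.2 hδ).le (by linarith)
  · intro s hs'
    have he : χ =ᶠ[𝓝 s] fun _ => 1 := by
      filter_upwards [eventually_lt_nhds hs'] with y hy
      exact hχ1 y hy.le
    rw [he.deriv_eq, deriv_const]
  · intro s hs'
    have he : χ =ᶠ[𝓝 s] fun y => δ⁻¹ * (r + δ - y) := by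
      filter_upwards [eventually_gt_nhds hs'.1, eventually_lt_nhds hs'.2] with y hy hy'
      have h1 : δ⁻¹ * (r + δ - y) ≤ 1 := by
        rw [inv_mul_eq_div, div_le_one hδ]
        linarith
      have h2 : 0 ≤ δ⁻¹ * (r + δ - y) := mul_nonneg (inv_pos.2 hδ).le (by linarith)
      simp only [hχdef]
      rw [min_eq_right h1, max_eq_right h2]
    have hd : HasDerivAt (fun y => δ⁻¹ * (r + δ - y)) (δ⁻¹ * -1) s :=
      ((hasDerivAt_id s).const_sub (r + δ)).const_mul _
    rw [he.deriv_eq, hd.deriv]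
    ring

/-- The divergence-theorem inequality on almost every sphere. -/
lemma WeakSubharmonicOn.ae_integral_sphGradSq_le (hN : 1 ≤ N)
    {u : EuclideanSpace ℝ (Fin N) → ℝ}
    {R : ℝ} {K : ℝ≥0} (hs : WeakSubharmonicOn u R) (hu : LipschitzWith K u)
    (hu0 : ∀ x, 0 ≤ u x) (h0 : u 0 = 0) :
    ∀ᵐ r : ℝ, r ∈ Ioo 0 R →
      ∫ s in 0..r, s ^ (N - 1) * sphGradSq u s ≤ r ^ (N - 1) * sphFlux u r := by
  have hq : LocallyIntegrable fun s : ℝ => s ^ (N - 1) * sphFlux u s := by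
    have hc : Continuous fun t : ℝ =>
        |t| ^ (N - 1) * ((surfMeasure N).real univ * (K * |t| * K)) := by fun_prop
    have hm := measurable_sphFlux (N := N) hu.continuous
    refine hc.locallyIntegrable.mono
      (by fun_prop : Measurable fun s : ℝ => s ^ (N - 1) * sphFlux u s).aestronglyMeasurable
      (ae_of_all _ fun t => ?_)
    refine le_trans ?_ (le_abs_self _)
    rw [norm_mul, norm_pow]
    exact mul_le_mul_of_nonneg_left (abs_sphFlux_le hu h0 t) (by positivity)
  filter_upwards [LocallyIntegrable.ae_hasDerivAt_integral hq] with r hd hr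
  have ht := (hd r).tendsto_slope_zero_right
  refine ge_of_tendsto ht ?_
  filter_upwards [Ioo_mem_nhdsGT (show (0 : ℝ) < R - r by linarith [hr.2])] with δ hδ
  rw [intervalIntegral.integral_same, sub_zero, smul_eq_mul]
  exact hs.integral_sphGradSq_le_average hN hu hu0 h0 hr.1 hδ.1 (by linarith [hδ.2])

lemma pow_mul_deriv_inv_pow (n : ℕ) {s : ℝ} (hs : s ≠ 0) :
    s ^ (n + 1) * deriv (fun y : ℝ => y⁻¹ ^ n) s = -n := by
  have h := ((hasDerivAt_inv hs).fun_pow n).deriv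
  rw [h]
  rcases n with _ | n
  · simp
  · rw [Nat.add_sub_cancel, inv_pow]
    field_simp
    ring

lemma WeakSubharmonicOn.integral_profile_le (hN : 2 ≤ N) {u : EuclideanSpace ℝ (Fin N) → ℝ}
    {R : ℝ} {K : ℝ≥0} (hs : WeakSubharmonicOn u R) (hu : LipschitzWith K u)
    (hu0 : ∀ x, 0 ≤ u x) (h0 : u 0 = 0) {ε r : ℝ} (hε : 0 < ε) (hεr : ε < r) (hrR : r < R) :
    ∫ s in ε..r, (s * sphGradSq u s - r⁻¹ ^ (N - 2) * (s ^ (N - 1) * sphGradSq u s)) ≤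
      (N - 2) * sphMass u r / 2 := by
  obtain ⟨n, rfl⟩ : ∃ n, N = n + 2 := ⟨N - 2, by omega⟩
  have hr : 0 < r := hε.trans hεr
  rw [Nat.add_sub_cancel, show n + 2 - 1 = n + 1 from rfl]
  set c : ℝ → ℝ := fun s => max ε (min s r) with hc
  have hcI : ∀ s, c s ∈ Icc ε r := fun s => ⟨le_max_left _ _, max_le hεr.le (min_le_right _ _)⟩
  have hcL : LipschitzWith 1 c := (LipschitzWith.id.min_const r).const_max ε
  have hG : ContDiffOn ℝ 1 (fun y : ℝ => y⁻¹ ^ n) (Icc ε r) :=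
    (contDiffOn_inv ℝ).pow n |>.mono fun y hy => (hε.trans_le hy.1).ne'
  obtain ⟨C, hC⟩ := hG.exists_lipschitzOnWith one_ne_zero (convex_Icc ε r) isCompact_Icc
  have hanti : ∀ x y : ℝ, 0 < x → x ≤ y → y⁻¹ ^ n ≤ x⁻¹ ^ n := fun x y hx hxy =>
    pow_le_pow_left₀ (inv_nonneg.2 (hx.le.trans hxy)) (inv_anti₀ hx hxy) n
  set χ : ℝ → ℝ := fun s => (c s)⁻¹ ^ n - r⁻¹ ^ n with hχ
  have hχL : LipschitzWith C χ := by
    refine LipschitzWith.of_dist_le_mul fun x y => ?_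
    have h1 := hC.dist_le_mul _ (hcI x) _ (hcI y)
    have h2 := hcL.dist_le_mul x y
    rw [NNReal.coe_one, one_mul] at h2
    simp only [hχ, dist_sub_right]
    exact h1.trans (mul_le_mul_of_nonneg_left h2 C.2)
  have hχ0 : ∀ s, 0 ≤ χ s := fun s =>
    sub_nonneg.2 (hanti _ _ (hε.trans_le (hcI s).1) (hcI s).2)
  have hcmid : ∀ s, ε ≤ s → s ≤ r → c s = s := fun s h1 h2 => by
    simp only [hc]
    rw [min_eq_left h2, max_eq_right h1]
  have key := hs.radial_test_of_deriv (by omega) hu hu0 h0 (g := fun _ => (n : ℝ)) hχL hχ0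
    (M := ε⁻¹ ^ n) (fun s => ?_) hε.le hεr.le hrR ?_ ?_ (by fun_prop) ?_
  · have h1 := fun a b => intervalIntegrable_mul_sphGradSq hu
      (g := fun s => χ s * s ^ (n + 1)) (hχL.continuous.mul (by fun_prop)) a b
    have hpos : ∀ a b, 0 ≤ a → a ≤ b → 0 ≤ ∫ s in a..b, χ s * s ^ (n + 1) * sphGradSq u s :=
      fun a b ha hab => intervalIntegral.integral_nonneg hab fun s hs' =>
        mul_nonneg (mul_nonneg (hχ0 s) (pow_nonneg (ha.trans hs'.1) _)) (sphGradSq_nonneg u s)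
    rw [show n + 2 - 1 = n + 1 from rfl,
      ← intervalIntegral.integral_add_adjacent_intervals (h1 0 ε) (h1 ε R),
      ← intervalIntegral.integral_add_adjacent_intervals (h1 ε r) (h1 r R)] at key
    have h2 := hpos 0 ε le_rfl hε.le
    have h3 := hpos r R hr.le hrR.le
    have h4 : ∫ s in ε..r, χ s * s ^ (n + 1) * sphGradSq u s =
        ∫ s in ε..r, (s * sphGradSq u s - r⁻¹ ^ n * (s ^ (n + 1) * sphGradSq u s)) := by
      refine intervalIntegral.integral_congr fun s hs' => ?_
      rw [uIcc_of_le hεr.le] at hs'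
      have hs0 : s ≠ 0 := (hε.trans_le hs'.1).ne'
      simp only [hχ, hcmid s hs'.1 hs'.2]
      have : s⁻¹ ^ n * s ^ (n + 1) = s := by
        rw [pow_succ, ← mul_assoc, ← mul_pow, inv_mul_cancel₀ hs0, one_pow, one_mul]
      linear_combination sphGradSq u s * this
    rw [h4] at key
    have h5 : ∫ s in ε..r, (n : ℝ) * sphFlux u s = n * (sphMass u r - sphMass u ε) / 2 := by
      have hF : ∀ a b, IntervalIntegrable (sphFlux u) volume a b := fun a b => by
        simpa using intervalIntegrable_mul_sphFlux hu h0 (g := fun _ => 1) continuous_const a b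
      rw [intervalIntegral.integral_const_mul, sphMass_eq_integral_sphFlux (by omega) hu h0 hr.le,
        sphMass_eq_integral_sphFlux (by omega) hu h0 hε.le,
        ← intervalIntegral.integral_add_adjacent_intervals (hF 0 ε) (hF ε r)]
      ring
    rw [h5] at key
    have h6 : 0 ≤ n * sphMass u ε :=
      mul_nonneg (Nat.cast_nonneg n) (integral_nonneg fun _ => sq_nonneg _)
    push_cast
    linarith
  · refine (sub_le_self _ (by positivity)).trans (hanti _ _ hε (hcI s).1)
  · intro s hs'
    simp only [hχ, hc]
    rw [min_eq_right hs'.le, max_eq_right hεr.le, sub_self]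
  · intro s hs'
    have he : χ =ᶠ[𝓝 s] fun _ => ε⁻¹ ^ n - r⁻¹ ^ n := by
      filter_upwards [eventually_lt_nhds hs'] with y hy
      simp only [hχ, hc]
      rw [max_eq_left ((min_le_left _ _).trans hy.le)]
    rw [he.deriv_eq, deriv_const]
  · intro s hs'
    have he : χ =ᶠ[𝓝 s] fun y => y⁻¹ ^ n - r⁻¹ ^ n := by
      filter_upwards [eventually_gt_nhds hs'.1, eventually_lt_nhds hs'.2] with y hy hy'
      simp only [hχ, hcmid y hy.le hy'.le]
    rw [he.deriv_eq, deriv_sub_const]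
    exact pow_mul_deriv_inv_pow n (ne_of_gt (hε.trans hs'.1))

/-- The weighted energy is controlled by the boundary flux and the boundary mass. -/
lemma WeakSubharmonicOn.ae_integral_mul_sphGradSq_le (hN : 2 ≤ N)
    {u : EuclideanSpace ℝ (Fin N) → ℝ}
    {R : ℝ} {K : ℝ≥0} (hs : WeakSubharmonicOn u R) (hu : LipschitzWith K u)
    (hu0 : ∀ x, 0 ≤ u x) (h0 : u 0 = 0) :
    ∀ᵐ r : ℝ, r ∈ Ioo 0 R →
      ∫ s in 0..r, s * sphGradSq u s ≤ r * sphFlux u r + (N - 2) * sphMass u r / 2 := by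
  filter_upwards [hs.ae_integral_sphGradSq_le (by omega) hu hu0 h0] with r hr hrI
  have h1 := hr hrI
  have hr0 : 0 < r := hrI.1
  have hI1 := fun a b => intervalIntegrable_mul_sphGradSq hu
    (g := fun s => s) continuous_id a b
  have hI2 := fun a b => intervalIntegrable_mul_sphGradSq hu
    (g := fun s => s ^ (N - 1)) (by fun_prop) a b
  set f : ℝ → ℝ := fun s =>
    s * sphGradSq u s - r⁻¹ ^ (N - 2) * (s ^ (N - 1) * sphGradSq u s)
  have hf : ∀ a b, IntervalIntegrable f volume a b := fun a b =>
    (hI1 a b).sub ((hI2 a b).const_mul _)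
  have h2 : ∫ s in 0..r, f s ≤ (N - 2) * sphMass u r / 2 := by
    have ht : Tendsto (fun ε => (∫ s in 0..r, f s) - ∫ s in 0..ε, f s) (𝓝[>] 0)
        (𝓝 (∫ s in 0..r, f s)) := by
      have := ((intervalIntegral.continuous_primitive hf 0).tendsto 0).const_sub
        (∫ s in 0..r, f s)
      rw [intervalIntegral.integral_same, sub_zero] at this
      exact this.mono_left nhdsWithin_le_nhds
    refine le_of_tendsto ht ?_
    filter_upwards [Ioo_mem_nhdsGT hr0] with ε hε
    rw [intervalIntegral.integral_interval_sub_left (hf 0 r) (hf 0 ε)]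
    exact hs.integral_profile_le hN hu hu0 h0 hε.1 hε.2 hrI.2
  have h3 : ∫ s in 0..r, f s = (∫ s in 0..r, s * sphGradSq u s) -
      r⁻¹ ^ (N - 2) * ∫ s in 0..r, s ^ (N - 1) * sphGradSq u s := by
    rw [intervalIntegral.integral_sub (hI1 0 r) ((hI2 0 r).const_mul _),
      intervalIntegral.integral_const_mul]
  have h4 : r⁻¹ ^ (N - 2) * (r ^ (N - 1) * sphFlux u r) = r * sphFlux u r := by
    rw [show N - 1 = (N - 2) + 1 by omega, pow_succ, ← mul_assoc, ← mul_assoc, ← mul_pow,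
      inv_mul_cancel₀ hr0.ne', one_pow, one_mul]
  have h5 := mul_le_mul_of_nonneg_left h1 (show 0 ≤ r⁻¹ ^ (N - 2) by positivity)
  linarith

end RadialInequalities

section SphereInequality

variable {N : ℕ}

lemma two_mul_sphFlux_le {u : EuclideanSpace ℝ (Fin N) → ℝ} {K : ℝ≥0} (hu : LipschitzWith K u)
    (h0 : u 0 = 0) (r α : ℝ) :
    2 * α * (r * sphFlux u r) ≤
      r ^ 2 * sphGradSq u r - sphTangEnergy u r + α ^ 2 * sphMass u r := by
  have h1 := (integrable_sphGradSq hu r).const_mul (r ^ 2)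
  have h2 := integrable_tangSq hu r
  have h3 := (integrable_sphere_sq hu.continuous r).const_mul (α ^ 2)
  have h4 := (integrable_sphFlux hu h0 r).const_mul (2 * α * r)
  rw [← mul_assoc, sphFlux, sphGradSq, sphTangEnergy, sphMass, ← integral_const_mul,
    ← integral_const_mul, ← integral_const_mul, ← integral_sub h1 h2,
    ← integral_add (f := fun θ : sphere (0 : EuclideanSpace ℝ (Fin N)) 1 =>
      r ^ 2 * ‖gradient u (r • (θ : EuclideanSpace ℝ (Fin N)))‖ ^ 2 -
        tangSq u r (θ : EuclideanSpace ℝ (Fin N))) (h1.sub h2) h3]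
  refine integral_mono h4 ((h1.sub h2).add h3) fun θ => ?_
  simp only [tangSq]
  nlinarith [sq_nonneg (r * inner ℝ (gradient u (r • (θ : EuclideanSpace ℝ (Fin N))))
    (θ : EuclideanSpace ℝ (Fin N)) - α * u (r • (θ : EuclideanSpace ℝ (Fin N))))]

lemma exponent_bound {I κ a b τ m α : ℝ} (hα : 0 < α) (hI : 0 < I) (hκ : I ≤ κ + m * a / 2)
    (hαb : b / (2 * I) ≤ α) (hτ : 2 * α * κ ≤ b - τ + α ^ 2 * a) :
    α ^ 2 * a + τ ≤ α * (a * (2 * α + m)) := by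
  have h1 : b ≤ α * (2 * I) := (div_le_iff₀ (by positivity)).1 hαb
  have h2 := mul_le_mul_of_nonneg_left hκ hα.le
  linarith

lemma mass_pos {I κ a b τ m : ℝ} (ha : 0 ≤ a) (hI : 0 < I) (hκ : I ≤ κ + m * a / 2)
    (hτ : ∀ α : ℝ, 2 * α * κ ≤ b - τ + α ^ 2 * a) : 0 < a := by
  refine ha.lt_of_ne fun h => ?_
  subst h
  rw [mul_zero, zero_div, add_zero] at hκ
  have hκ0 : 0 < κ := hI.trans_le hκ
  have := hτ ((|b - τ| + 1) / (2 * κ))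
  rw [mul_zero, add_zero, show 2 * ((|b - τ| + 1) / (2 * κ)) * κ = |b - τ| + 1 by
    field_simp] at this
  linarith [le_abs_self (b - τ)]

/-- The algebraic core of the monotonicity: optimal exponents have sum at least two. -/
lemma four_mul_energies_le {I₁ I₂ κ₁ κ₂ a₁ a₂ b₁ b₂ τ₁ τ₂ m : ℝ} (hm : 0 ≤ m)
    (ha₁ : 0 ≤ a₁) (ha₂ : 0 ≤ a₂) (hb₁ : 0 ≤ b₁) (hb₂ : 0 ≤ b₂) (hI₁ : 0 ≤ I₁) (hI₂ : 0 ≤ I₂)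
    (hκ₁ : I₁ ≤ κ₁ + m * a₁ / 2) (hκ₂ : I₂ ≤ κ₂ + m * a₂ / 2)
    (hτ₁ : ∀ α : ℝ, 2 * α * κ₁ ≤ b₁ - τ₁ + α ^ 2 * a₁)
    (hτ₂ : ∀ α : ℝ, 2 * α * κ₂ ≤ b₂ - τ₂ + α ^ 2 * a₂)
    (h : ∀ α β : ℝ, 0 < α → 0 < β →
      2 * ((a₁ * (2 * α + m)) * (a₂ * (2 * β + m))) ≤
        (α ^ 2 * a₁ + τ₁) * (a₂ * (2 * β + m)) + (β ^ 2 * a₂ + τ₂) * (a₁ * (2 * α + m))) :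
    4 * (I₁ * I₂) ≤ b₁ * I₂ + b₂ * I₁ := by
  rcases hI₁.eq_or_lt with rfl | hI₁
  · rw [zero_mul, mul_zero, mul_zero, add_zero]
    positivity
  rcases hI₂.eq_or_lt with rfl | hI₂
  · rw [mul_zero, mul_zero, mul_zero, zero_add]
    positivity
  have hpos₁ := mass_pos ha₁ hI₁ hκ₁ hτ₁
  have hpos₂ := mass_pos ha₂ hI₂ hκ₂ hτ₂
  have key : 2 ≤ b₁ / (2 * I₁) + b₂ / (2 * I₂) := by
    refine le_of_forall_pos_le_add fun η hη => ?_
    set α := b₁ / (2 * I₁) + η / 2 with hα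
    set β := b₂ / (2 * I₂) + η / 2 with hβ
    have hα0 : 0 < α := by positivity
    have hβ0 : 0 < β := by positivity
    have h1 := exponent_bound hα0 hI₁ hκ₁ (by rw [hα]; linarith) (hτ₁ α)
    have h2 := exponent_bound hβ0 hI₂ hκ₂ (by rw [hβ]; linarith) (hτ₂ β)
    have h3 := h α β hα0 hβ0
    set A := a₁ * (2 * α + m)
    set B := a₂ * (2 * β + m)
    have hA : 0 < A := by positivity
    have hB : 0 < B := by positivity
    have h4 : 2 * (A * B) ≤ (α + β) * (A * B) := by
      have h5 := mul_le_mul_of_nonneg_right h1 hB.le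
      have h6 := mul_le_mul_of_nonneg_right h2 hA.le
      linarith
    have h7 := le_of_mul_le_mul_right h4 (mul_pos hA hB)
    linarith
  have e : b₁ / (2 * I₁) + b₂ / (2 * I₂) = (b₁ * I₂ + b₂ * I₁) / (2 * (I₁ * I₂)) := by
    field_simp
  rw [e, le_div_iff₀ (by positivity)] at key
  linarith

/-- The differential inequality behind the monotonicity formula. -/
lemma ae_four_mul_energies_le (hN : 2 ≤ N) {u₁ u₂ : EuclideanSpace ℝ (Fin N) → ℝ} {R : ℝ}
    {K₁ K₂ : ℝ≥0} (hs₁ : WeakSubharmonicOn u₁ R) (hs₂ : WeakSubharmonicOn u₂ R)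
    (hu₁ : LipschitzWith K₁ u₁) (hu₂ : LipschitzWith K₂ u₂)
    (hp₁ : ∀ x, 0 ≤ u₁ x) (hp₂ : ∀ x, 0 ≤ u₂ x) (h₁ : u₁ 0 = 0) (h₂ : u₂ 0 = 0)
    (hprod : ∀ x ∈ ball 0 R, u₁ x * u₂ x = 0) :
    ∀ᵐ r : ℝ, r ∈ Ioo 0 R →
      4 * ((∫ s in 0..r, s * sphGradSq u₁ s) * ∫ s in 0..r, s * sphGradSq u₂ s) ≤
        r ^ 2 * sphGradSq u₁ r * (∫ s in 0..r, s * sphGradSq u₂ s) +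
          r ^ 2 * sphGradSq u₂ r * ∫ s in 0..r, s * sphGradSq u₁ s := by
  have hN1 : 1 ≤ N := by omega
  have hm : (0 : ℝ) ≤ N - 2 := by
    rw [sub_nonneg]
    exact_mod_cast hN
  filter_upwards [hs₁.ae_integral_mul_sphGradSq_le hN hu₁ hp₁ h₁,
    hs₂.ae_integral_mul_sphGradSq_le hN hu₂ hp₂ h₂,
    (ae_restrict_iff' measurableSet_Ioi).1 (ae_sphere_of_ae hN1 hu₁.ae_differentiableAt),
    (ae_restrict_iff' measurableSet_Ioi).1 (ae_sphere_of_ae hN1 hu₂.ae_differentiableAt)]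
    with r hκ₁ hκ₂ hd₁ hd₂ hr
  have hI : ∀ u : EuclideanSpace ℝ (Fin N) → ℝ, 0 ≤ ∫ s in 0..r, s * sphGradSq u s := fun u =>
    intervalIntegral.integral_nonneg hr.1.le fun s hs => mul_nonneg hs.1 (sphGradSq_nonneg u s)
  have hb : ∀ u : EuclideanSpace ℝ (Fin N) → ℝ, 0 ≤ r ^ 2 * sphGradSq u r := fun u =>
    mul_nonneg (sq_nonneg r) (sphGradSq_nonneg u r)
  have ha : ∀ u : EuclideanSpace ℝ (Fin N) → ℝ, 0 ≤ sphMass u r := fun u =>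
    integral_nonneg fun _ => sq_nonneg _
  refine four_mul_energies_le hm (ha u₁) (ha u₂) (hb u₁) (hb u₂) (hI u₁) (hI u₂) (hκ₁ hr)
    (hκ₂ hr) (two_mul_sphFlux_le hu₁ h₁ r) (two_mul_sphFlux_le hu₂ h₂ r) fun α β hα hβ => ?_
  have key := spherical_two_function_inequality hN hα hβ hu₁ hu₂ hp₁ hp₂ hr.1
    (fun x hx => hprod x (by rw [mem_ball_zero_iff, hx]; exact hr.2)) (hd₁ hr.1) (hd₂ hr.1)
  simpa only [add_sub_assoc] using key

end SphereInequality

section Monotonicity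

variable {N : ℕ}

lemma monotoneOn_energy_product {β₁ β₂ : ℝ → ℝ} {R : ℝ}
    (hβ₁ : ∀ a b, IntervalIntegrable (fun s => s * β₁ s) volume a b)
    (hβ₂ : ∀ a b, IntervalIntegrable (fun s => s * β₂ s) volume a b)
    (h : ∀ᵐ r : ℝ, r ∈ Ioo 0 R →
      4 * ((∫ s in 0..r, s * β₁ s) * ∫ s in 0..r, s * β₂ s) ≤
        r ^ 2 * β₁ r * (∫ s in 0..r, s * β₂ s) + r ^ 2 * β₂ r * ∫ s in 0..r, s * β₁ s) :
    MonotoneOn (fun r : ℝ => r ^ (-4 : ℤ) *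
      (∫ s in 0..r, s * β₁ s) * ∫ s in 0..r, s * β₂ s) (Ioo 0 R) := by
  intro p hp q hq hpq
  have hp0 : 0 < p := hp.1
  have hsub : uIcc p q ⊆ uIcc 0 q := by
    rw [uIcc_of_le hpq, uIcc_of_le hq.1.le]
    exact Icc_subset_Icc_left hp0.le
  have hmem : ∀ {x}, x ∈ uIcc p q → x ∈ Ioo 0 R := fun {x} hx => by
    rw [uIcc_of_le hpq] at hx
    exact ⟨hp0.trans_le hx.1, hx.2.trans_lt hq.2⟩
  have hpow : AbsolutelyContinuousOnInterval (fun r : ℝ => r ^ (-4 : ℤ)) p q := by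
    have e : (fun r : ℝ => r ^ (-4 : ℤ)) = fun r => (r ^ 4)⁻¹ := by
      funext r
      rw [zpow_neg]
      norm_cast
    rw [e]
    refine ContDiffOn.absolutelyContinuousOnInterval fun x hx => ?_
    exact ((contDiffAt_id.pow 4).inv (pow_ne_zero 4 (hmem hx).1.ne')).contDiffWithinAt
  have hac : ∀ {β : ℝ → ℝ}, (∀ a b, IntervalIntegrable (fun s => s * β s) volume a b) →
      AbsolutelyContinuousOnInterval (fun r => ∫ s in 0..r, s * β s) p q := fun hβ =>
    ((hβ 0 q).absolutelyContinuousOnInterval_intervalIntegral left_mem_uIcc).mono hsub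
  have hint := ((hpow.fun_mul (hac hβ₁)).fun_mul (hac hβ₂)).integral_deriv_eq_sub
  refine sub_nonneg.1 ?_
  rw [← hint, intervalIntegral.integral_of_le hpq]
  refine setIntegral_nonneg_of_ae_restrict ?_
  filter_upwards [ae_restrict_mem measurableSet_Ioc, ae_restrict_of_ae h,
    ae_restrict_of_ae (hβ₁ 0 q).ae_hasDerivAt_integral,
    ae_restrict_of_ae (hβ₂ 0 q).ae_hasDerivAt_integral] with r hr h4 hd₁ hd₂
  have hr' : r ∈ uIcc p q := by
    rw [uIcc_of_le hpq]
    exact Ioc_subset_Icc_self hr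
  have hr0 : 0 < r := (hmem hr').1
  have hd := ((hasDerivAt_zpow (-4) r (Or.inl hr0.ne')).fun_mul
    (hd₁ (hsub hr') 0 left_mem_uIcc)).fun_mul (hd₂ (hsub hr') 0 left_mem_uIcc)
  rw [Pi.zero_apply, hd.deriv]
  have h5 := h4 (hmem hr')
  set I₁ := ∫ s in 0..r, s * β₁ s
  set I₂ := ∫ s in 0..r, s * β₂ s
  have e1 : r ^ (-4 - 1 : ℤ) = (r ^ 5)⁻¹ := by
    rw [show (-4 - 1 : ℤ) = -((5 : ℕ) : ℤ) by norm_num, zpow_neg, zpow_natCast]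
  have e2 : r ^ (-4 : ℤ) = (r ^ 5)⁻¹ * r := by
    rw [show (-4 : ℤ) = -((4 : ℕ) : ℤ) by norm_num, zpow_neg, zpow_natCast]
    field_simp
  rw [e1, e2]
  have h6 : 0 ≤ (r ^ 5)⁻¹ *
      (r ^ 2 * β₁ r * I₂ + r ^ 2 * β₂ r * I₁ - 4 * (I₁ * I₂)) :=
    mul_nonneg (by positivity) (sub_nonneg.2 h5)
  refine h6.trans (le_of_eq ?_)
  push_cast
  ring

lemma monotoneOn_of_weakSubharmonicOn (hN : 2 ≤ N) {u₁ u₂ : EuclideanSpace ℝ (Fin N) → ℝ} {R : ℝ}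
    {K₁ K₂ : ℝ≥0} (hs₁ : WeakSubharmonicOn u₁ R) (hs₂ : WeakSubharmonicOn u₂ R)
    (hu₁ : LipschitzWith K₁ u₁) (hu₂ : LipschitzWith K₂ u₂)
    (hp₁ : ∀ x, 0 ≤ u₁ x) (hp₂ : ∀ x, 0 ≤ u₂ x) (h₁ : u₁ 0 = 0) (h₂ : u₂ 0 = 0)
    (hprod : ∀ x ∈ ball 0 R, u₁ x * u₂ x = 0) :
    MonotoneOn (fun r : ℝ => r ^ (-4 : ℤ) *
      (∫ x in ball 0 r, ‖gradient u₁ x‖ ^ 2 * ‖x‖ ^ ((2 : ℤ) - (N : ℤ))) *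
      (∫ x in ball 0 r, ‖gradient u₂ x‖ ^ 2 * ‖x‖ ^ ((2 : ℤ) - (N : ℤ)))) (Ioo 0 R) := by
  refine (monotoneOn_energy_product (intervalIntegrable_mul_sphGradSq hu₁ continuous_id)
    (intervalIntegrable_mul_sphGradSq hu₂ continuous_id)
    (ae_four_mul_energies_le hN hs₁ hs₂ hu₁ hu₂ hp₁ hp₂ h₁ h₂ hprod)).congr fun r hr => ?_
  simp only [weighted_energy_polar hN hu₁ hr.1.le, weighted_energy_polar hN hu₂ hr.1.le]

end Monotonicity

section Translation

variable {N : ℕ}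

lemma gradient_comp_add_right {E : Type*} [NormedAddCommGroup E] [InnerProductSpace ℝ E]
    [CompleteSpace E] (h : E → ℝ) (a x : E) :
    gradient (fun y => h (y + a)) x = gradient h (x + a) := by
  rw [gradient, gradient, fderiv_comp_add_right]

lemma lap_comp_add_right (φ : EuclideanSpace ℝ (Fin N) → ℝ) (a x : EuclideanSpace ℝ (Fin N)) :
    lap N (fun y => φ (y + a)) x = lap N φ (x + a) := by
  simp only [lap, fderiv_comp_add_right]
  refine Finset.sum_congr rfl fun i _ => ?_
  rw [fderiv_comp_add_right (f := fun y => fderiv ℝ φ y (EuclideanSpace.single i 1))]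

lemma lap_eq_zero_of_notMem_tsupport {φ : EuclideanSpace ℝ (Fin N) → ℝ}
    {x : EuclideanSpace ℝ (Fin N)} (hx : x ∉ tsupport φ) : lap N φ x = 0 := by
  have h : φ =ᶠ[𝓝 x] fun _ => 0 := notMem_tsupport_iff_eventuallyEq.1 hx
  refine Finset.sum_eq_zero fun i _ => ?_
  have h2 : (fun y => fderiv ℝ φ y (EuclideanSpace.single i 1)) =ᶠ[𝓝 x] fun _ => 0 := by
    filter_upwards [h.eventually_nhds] with y hy
    rw [Filter.EventuallyEq.fderiv_eq hy, fderiv_fun_const, Pi.zero_apply,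
      zero_apply]
  rw [h2.fderiv_eq, fderiv_fun_const, Pi.zero_apply, zero_apply]

/-- A translate of `h` agrees near the origin with a globally Lipschitz subharmonic function. -/
lemma exists_lipschitz_weakSubharmonicOn {h : EuclideanSpace ℝ (Fin N) → ℝ}
    {x0 : EuclideanSpace ℝ (Fin N)} {R : ℝ} {K : ℝ≥0} (hl : LipschitzOnWith K h (ball x0 R))
    (hn : ∀ x, 0 ≤ h x)
    (hs : ∀ φ : EuclideanSpace ℝ (Fin N) → ℝ, ContDiff ℝ (⊤ : ℕ∞) φ →
      tsupport φ ⊆ ball x0 R → (∀ x, 0 ≤ φ x) → 0 ≤ ∫ x, h x * lap N φ x) :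
    ∃ u : EuclideanSpace ℝ (Fin N) → ℝ, LipschitzWith K u ∧ (∀ x, 0 ≤ u x) ∧
      (∀ x ∈ ball 0 R, u x = h (x + x0)) ∧ WeakSubharmonicOn u R := by
  obtain ⟨g, hg, hgh⟩ := hl.extend_real
  have hmem : ∀ x ∈ ball (0 : EuclideanSpace ℝ (Fin N)) R, x + x0 ∈ ball x0 R := fun x hx => by
    rwa [mem_ball_iff_norm, add_sub_cancel_right, ← mem_ball_zero_iff]
  have hu : ∀ x ∈ ball 0 R, max (g (x + x0)) 0 = h (x + x0) := fun x hx => by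
    rw [← hgh (hmem x hx), max_eq_left (hn _)]
  refine ⟨fun x => max (g (x + x0)) 0, ?_, fun x => le_max_right _ _, hu, ?_⟩
  · refine LipschitzWith.max_const ?_ 0
    refine LipschitzWith.of_dist_le_mul fun x y => (hg.dist_le_mul _ _).trans (le_of_eq ?_)
    rw [dist_add_right]
  intro φ hφ hφR hφ0
  have hts : tsupport (fun x => φ (x + -x0)) ⊆ ball x0 R := by
    intro x hx
    have h1 : x + -x0 ∈ tsupport φ :=
      tsupport_comp_subset_preimage φ (f := fun x => x + -x0) (by fun_prop) hx
    have h2 := hmem _ (hφR h1)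
    rwa [neg_add_cancel_right] at h2
  have key := hs (fun x => φ (x + -x0)) (hφ.comp (contDiff_id.add contDiff_const)) hts
    (fun x => hφ0 _)
  rw [← integral_add_right_eq_self _ x0] at key
  refine key.trans (le_of_eq (integral_congr_ae (ae_of_all _ fun x => ?_)))
  simp only [lap_comp_add_right, add_neg_cancel_right]
  by_cases hx : x ∈ tsupport φ
  · rw [hu x (hφR hx)]
  · rw [lap_eq_zero_of_notMem_tsupport hx, mul_zero, mul_zero]

lemma setIntegral_ball_gradient_translate {h u : EuclideanSpace ℝ (Fin N) → ℝ}
    {x0 : EuclideanSpace ℝ (Fin N)} {r R : ℝ} (hr : r ≤ R)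
    (hu : ∀ x ∈ ball 0 R, u x = h (x + x0)) (w : EuclideanSpace ℝ (Fin N) → ℝ) :
    ∫ x in ball x0 r, ‖gradient h x‖ ^ 2 * w (x - x0) =
      ∫ x in ball 0 r, ‖gradient u x‖ ^ 2 * w x := by
  rw [← integral_indicator measurableSet_ball, ← integral_indicator measurableSet_ball,
    ← integral_add_right_eq_self _ x0]
  refine integral_congr_ae (ae_of_all _ fun x => ?_)
  have hiff : x + x0 ∈ ball x0 r ↔ x ∈ ball 0 r := by
    rw [mem_ball_iff_norm, add_sub_cancel_right, mem_ball_zero_iff]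
  beta_reduce
  by_cases hx : x ∈ ball 0 r
  · have he : u =ᶠ[𝓝 x] fun y => h (y + x0) := by
      filter_upwards [isOpen_ball.mem_nhds (ball_subset_ball hr hx)] with y hy
      exact hu y hy
    have hgr : gradient u x = gradient h (x + x0) := by
      rw [← gradient_comp_add_right, gradient, gradient, he.fderiv_eq]
    rw [indicator_of_mem (hiff.2 hx), indicator_of_mem hx, add_sub_cancel_right, hgr]
  · rw [indicator_of_notMem (fun h' => hx (hiff.1 h')), indicator_of_notMem hx]

end Translation

/-- the Alt–Caffarelli–Friedman monotonicity formula. -/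
theorem ACF_monotonicity (N : ℕ) (hN : 2 ≤ N) (x0 : EuclideanSpace ℝ (Fin N)) (R : ℝ)
    (hR : 0 < R) (h₁ h₂ : EuclideanSpace ℝ (Fin N) → ℝ)
    (hc1 : Continuous h₁) (hc2 : Continuous h₂)
    (hn1 : ∀ x, 0 ≤ h₁ x) (hn2 : ∀ x, 0 ≤ h₂ x)
    (hl1 : ∃ K : NNReal, LipschitzOnWith K h₁ (ball x0 R))
    (hl2 : ∃ K : NNReal, LipschitzOnWith K h₂ (ball x0 R))
    (hs1 : ∀ φ : EuclideanSpace ℝ (Fin N) → ℝ, ContDiff ℝ (⊤ : ℕ∞) φ →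
      tsupport φ ⊆ ball x0 R → (∀ x, 0 ≤ φ x) → 0 ≤ ∫ x, h₁ x * lap N φ x)
    (hs2 : ∀ φ : EuclideanSpace ℝ (Fin N) → ℝ, ContDiff ℝ (⊤ : ℕ∞) φ →
      tsupport φ ⊆ ball x0 R → (∀ x, 0 ≤ φ x) → 0 ≤ ∫ x, h₂ x * lap N φ x)
    (hprod : ∀ x ∈ ball x0 R, h₁ x * h₂ x = 0)
    (hz1 : h₁ x0 = 0) (hz2 : h₂ x0 = 0) :
    MonotoneOn (fun r : ℝ =>
      r ^ (-4 : ℤ) *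
        (∫ x in ball x0 r, ‖gradient h₁ x‖ ^ 2 * ‖x - x0‖ ^ ((2 : ℤ) - (N : ℤ))) *
        ∫ x in ball x0 r, ‖gradient h₂ x‖ ^ 2 * ‖x - x0‖ ^ ((2 : ℤ) - (N : ℤ)))
      (Set.Ioo 0 R) := by
  obtain ⟨K₁, hl1⟩ := hl1
  obtain ⟨K₂, hl2⟩ := hl2
  obtain ⟨u₁, hu₁, hp₁, he₁, hs₁⟩ := exists_lipschitz_weakSubharmonicOn hl1 hn1 hs1
  obtain ⟨u₂, hu₂, hp₂, he₂, hs₂⟩ := exists_lipschitz_weakSubharmonicOn hl2 hn2 hs2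
  have h0 : (0 : EuclideanSpace ℝ (Fin N)) ∈ ball 0 R := mem_ball_self hR
  refine (monotoneOn_of_weakSubharmonicOn hN hs₁ hs₂ hu₁ hu₂ hp₁ hp₂
    (by rw [he₁ 0 h0, zero_add, hz1]) (by rw [he₂ 0 h0, zero_add, hz2]) fun x hx => ?_).congr
    fun r hr => ?_
  · rw [he₁ x hx, he₂ x hx]
    refine hprod _ ?_
    rwa [mem_ball_iff_norm, add_sub_cancel_right, ← mem_ball_zero_iff]
  · simp only
    rw [setIntegral_ball_gradient_translate hr.2.le he₁ fun x => ‖x‖ ^ ((2 : ℤ) - (N : ℤ)),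
      setIntegral_ball_gradient_translate hr.2.le he₂ fun x => ‖x‖ ^ ((2 : ℤ) - (N : ℤ))]
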